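/- Let α_1 ≤ α_2, α ≥ 0, w = (w_j)_{j∈ℕ_0} ∈ W^α_{α_1,α_2}. Let p, q ∈ P^log(ℝ^n) and u a variable exponent with 0 < p^- ≤ p(x) ≤ u(x) ≤ sup u < ∞ and 0 < q^- ≤ q^+ < ∞, and set c_{p,u} := max(0, sup_x(1/p(x) − 1/u(x)) − 1/p_∞). Let ψ_0, ψ_1 ∈ S(ℝ^n) satisfy |ψ_0(x)| > 0 on {|x| ≤ kε} and |ψ_1(x)| > 0 on {ε ≤ |x| ≤ 2kε} for some ε > 0 and k ∈ (1,2]; set ψ_j(x) := ψ_1(2^{−j+1}x) for j ≥ 2 and Ψ_j := ψ̂_j. If a > n(1/min(p^-, q^-) + c_{p,u}) + α, then there is c > 0 such that for all f ∈ S'(ℝ^n): ‖((Ψ_j^* f)_a w_j)_j‖_{M^{u(·)}_{p(·)}(ℓ^{q(·)})} ≤ c ‖((Ψ_j ∗ f) w_j)_j‖_{M^{u(·)}_{p(·)}(ℓ^{q(·)})}. -/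

import Mathlib

open MeasureTheory ENNReal Real
open scoped FourierTransform

noncomputable section

/-- Euclidean space `ℝ^n`. -/
abbrev Rn (n : ℕ) : Type := EuclideanSpace ℝ (Fin n)

variable {n : ℕ}

/-- The function `φ_t(s)` used in the semimodular of variable exponent Lebesgue spaces:
`φ_t(s) = s^t` for `t < ∞`, while `φ_∞(s) = 0` for `s ≤ 1` and `= ∞` for `s > 1`. -/
def phiVE (t : ℝ≥0∞) (s : ℝ≥0∞) : ℝ≥0∞ :=
  if t = ∞ then (if s ≤ 1 then 0 else ∞) else s ^ t.toReal

/-- The semimodular `ρ_p` of variable exponent Lebesgue spaces. -/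
def modularVE (p : Rn n → ℝ≥0∞) (g : Rn n → ℝ≥0∞) : ℝ≥0∞ :=
  ∫⁻ x, phiVE (p x) (g x)

/-- The variable exponent Lebesgue quasi-norm `‖·‖_{L^{p(·)}(ℝ^n)}`, applied to the
(pointwise) absolute value of a function, i.e. to `[0,∞]`-valued functions.
(For `p⁻ ≥ 1` this is the usual Luxemburg norm; for general `p` it agrees with the
definition via `‖f‖ = ‖|f|^t‖_{L^{p/t}}^{1/t}`.) -/
def vLpNorm (p : Rn n → ℝ≥0∞) (g : Rn n → ℝ≥0∞) : ℝ≥0∞ :=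
  sInf {lam : ℝ≥0∞ | modularVE p (fun x => g x / lam) ≤ 1}

/-- A variable exponent: a measurable function `p : ℝ^n → (0,∞]` with `p⁻ = ess inf p > 0`. -/
def IsVarExp (p : Rn n → ℝ≥0∞) : Prop :=
  Measurable p ∧ (∀ x, 0 < p x) ∧ 0 < essInf p (volume : Measure (Rn n))

/-- Local log-Hölder continuity of `g : ℝ^n → ℝ`. -/
def LocLogHolder (g : Rn n → ℝ) : Prop :=
  ∃ c > 0, ∀ x y : Rn n, |g x - g y| ≤ c / Real.log (Real.exp 1 + (dist x y)⁻¹)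

/-- Log-Hölder decay of `g` at infinity, with limit value `gInf` and constant `c`. -/
def LogDecay (g : Rn n → ℝ) (gInf c : ℝ) : Prop :=
  ∀ x : Rn n, |g x - gInf| ≤ c / Real.log (Real.exp 1 + ‖x‖)

/-- `p ∈ P^log(ℝ^n)`, with prescribed limit value `pinvInf = 1/p_∞` of `1/p` at infinity. -/
def IsPLogWith (p : Rn n → ℝ≥0∞) (pinvInf : ℝ) : Prop :=
  IsVarExp p ∧ LocLogHolder (fun x => (p x)⁻¹.toReal) ∧
    ∃ c > 0, LogDecay (fun x => (p x)⁻¹.toReal) pinvInf c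

/-- `p ∈ P^log(ℝ^n)`. -/
def IsPLog (p : Rn n → ℝ≥0∞) : Prop := ∃ pinvInf : ℝ, IsPLogWith p pinvInf

/-- The Morrey quasi-norm `‖·‖_{M^{u(·)}_{p(·)}(ℝ^n)}` of a `[0,∞]`-valued function:
`sup_{x, r>0} r^{n(1/u(x) - 1/p(x))} ‖f‖_{L^{p(·)}(B_r(x))}`. -/
def morreyNorm (p u : Rn n → ℝ≥0∞) (g : Rn n → ℝ≥0∞) : ℝ≥0∞ :=
  ⨆ (x : Rn n) (r : ℝ) (_ : 0 < r),
    ENNReal.ofReal (r ^ ((n : ℝ) * ((u x)⁻¹.toReal - (p x)⁻¹.toReal))) *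
      vLpNorm p ((Metric.ball x r).indicator g)

/-- The `ℓ^q` (quasi-)norm of a sequence in `[0,∞]`, with the usual modification for `q = ∞`. -/
def lqNorm (q : ℝ≥0∞) (a : ℕ → ℝ≥0∞) : ℝ≥0∞ :=
  if q = ∞ then ⨆ ν, a ν else (∑' ν, a ν ^ q.toReal) ^ (1 / q.toReal)

/-- The vector-valued Morrey quasi-norm `‖(f_ν)_ν‖_{M^{u(·)}_{p(·)}(ℓ^{q(·)})}`. -/
def morreySeqNorm (p u q : Rn n → ℝ≥0∞) (f : ℕ → Rn n → ℝ≥0∞) : ℝ≥0∞ :=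
  morreyNorm p u (fun x => lqNorm (q x) (fun ν => f ν x))

/-- The kernel `η_{ν,m}(x) = 2^{νn} (1 + 2^ν |x|)^{-m}`. -/
def etaK (ν : ℕ) (m : ℝ) (x : Rn n) : ℝ≥0∞ :=
  ENNReal.ofReal ((2 : ℝ) ^ (ν * n) * (1 + 2 ^ ν * ‖x‖) ^ (-m))

/-- Convolution of `[0,∞]`-valued functions. -/
def lconv (f g : Rn n → ℝ≥0∞) (x : Rn n) : ℝ≥0∞ := ∫⁻ y, f (x - y) * g y

/-- The constant `c_{p,u} = max(0, sup_x (1/p(x) - 1/u(x)) - 1/p_∞)`. -/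
def cpu (p u : Rn n → ℝ≥0∞) (pinvInf : ℝ) : ℝ :=
  max 0 ((⨆ x : Rn n, ((p x)⁻¹.toReal - (u x)⁻¹.toReal)) - pinvInf)

/-- Tempered distributions on `ℝ^n`. -/
abbrev TemperedDist (n : ℕ) : Type := SchwartzMap (Rn n) ℂ →L[ℂ] ℂ

lemma hasTemperateGrowth_reflectTranslate (y : Rn n) :
    Function.HasTemperateGrowth (fun z : Rn n => y - z) := by
  have hd : Differentiable ℝ (fun z : Rn n => y - z) :=
    (differentiable_const y).sub differentiable_id
  have hfd : fderiv ℝ (fun z : Rn n => y - z)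
      = fun _ => -(ContinuousLinearMap.id ℝ (Rn n)) := by
    funext z
    rw [fderiv_const_sub, fderiv_id']
  refine Function.HasTemperateGrowth.of_fderiv (k := 1) (C := ‖y‖ + 1) ?_ hd ?_
  · rw [hfd]; exact .const _
  · intro x
    calc ‖y - x‖ ≤ ‖y‖ + ‖x‖ := norm_sub_le _ _
      _ ≤ (‖y‖ + 1) * (1 + ‖x‖) ^ 1 := by
          have h1 := norm_nonneg x
          have h2 := norm_nonneg y
          nlinarith

/-- The map `z ↦ Ψ (y - z)`, as a Schwartz function. -/
def reflectTranslate (y : Rn n) (Ψ : SchwartzMap (Rn n) ℂ) : SchwartzMap (Rn n) ℂ :=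
  SchwartzMap.compCLMOfAntilipschitz (𝕜 := ℂ) (K := 1)
    (hasTemperateGrowth_reflectTranslate y)
    ((Isometry.of_dist_eq (fun z z' => dist_sub_left y z z')).antilipschitz) Ψ

@[simp] lemma reflectTranslate_apply (y : Rn n) (Ψ : SchwartzMap (Rn n) ℂ) (z : Rn n) :
    reflectTranslate y Ψ z = Ψ (y - z) := rfl

/-- The convolution `(Ψ ∗ f)(y) = f(Ψ(y - ·))` of a Schwartz function `Ψ` with a tempered
distribution `f`. -/
def distConv (Ψ : SchwartzMap (Rn n) ℂ) (f : TemperedDist n) (y : Rn n) : ℂ :=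
  f (reflectTranslate y Ψ)

/-- The Peetre maximal function at level `j`, with parameter `a`, of a function `F`
(to be applied with `F = Ψ_j ∗ f`):  `sup_y ‖F y‖ / (1 + |2^j (y - x)|^a)`. -/
def peetreMax (a : ℝ) (j : ℕ) (F : Rn n → ℂ) (x : Rn n) : ℝ≥0∞ :=
  ⨆ y : Rn n, (‖F y‖₊ : ℝ≥0∞) / ENNReal.ofReal (1 + ((2 : ℝ) ^ j * ‖y - x‖) ^ a)

/-- Admissible weight sequences from the class `W^α_{α₁,α₂}`, with constant `C` in
condition (i). -/
def AdmissibleWeights (al al1 al2 C : ℝ) (w : ℕ → Rn n → ℝ) : Prop :=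
  (∀ j, Measurable (w j)) ∧
  (∀ (j : ℕ) (x y : Rn n), 0 < w j x ∧ w j x ≤ C * w j y * (1 + 2 ^ j * ‖x - y‖) ^ al) ∧
  (∀ (j : ℕ) (x : Rn n), 2 ^ al1 * w j x ≤ w (j + 1) x ∧ w (j + 1) x ≤ 2 ^ al2 * w j x)

/-- An admissible pair `(φ̌, Φ̌)`, described through the generating functions `φ, Φ`. -/
def AdmissiblePair (phi Phi : SchwartzMap (Rn n) ℂ) : Prop :=
  (Function.support ⇑phi ⊆ {x : Rn n | 1 / 2 ≤ ‖x‖ ∧ ‖x‖ ≤ 2}) ∧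
  (Function.support ⇑Phi ⊆ {x : Rn n | ‖x‖ ≤ 2}) ∧
  ∃ c > 0, (∀ x : Rn n, 3 / 5 ≤ ‖x‖ → ‖x‖ ≤ 5 / 3 → c ≤ ‖phi x‖) ∧
    (∀ x : Rn n, ‖x‖ ≤ 5 / 3 → c ≤ ‖Phi x‖)

lemma one_add_norm_le_mul (x v : Rn n) : 1 + ‖x‖ ≤ (1 + ‖x - v‖) * (1 + ‖v‖) := by
  have h : ‖x‖ ≤ ‖x - v‖ + ‖v‖ := by simpa using norm_add_le (x - v) v
  nlinarith [norm_nonneg (x - v), norm_nonneg v, mul_nonneg (norm_nonneg (x - v)) (norm_nonneg v)]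

/-- Weighted decay of the derivatives of a Schwartz function. -/
lemma schwartz_weighted_decay (Φ : SchwartzMap (Rn n) ℂ) (k i : ℕ) :
    ∃ D : ℝ, 0 ≤ D ∧ ∀ x, (1 + ‖x‖) ^ k * ‖iteratedFDeriv ℝ i Φ x‖ ≤ D := by
  refine ⟨2 ^ k * ((Finset.Iic (k, i)).sup fun m => SchwartzMap.seminorm ℝ m.1 m.2) Φ,
    by positivity, fun x => ?_⟩
  exact SchwartzMap.one_add_le_sup_seminorm_apply (𝕜 := ℝ) (m := (k, i)) le_rfl le_rfl Φ x

/-- The reflection `x ↦ Φ (-x)`. -/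
def schwartzReflect (Φ : SchwartzMap (Rn n) ℂ) : SchwartzMap (Rn n) ℂ := reflectTranslate 0 Φ

lemma coe_reflectTranslate (z : Rn n) (Φ : SchwartzMap (Rn n) ℂ) :
    ⇑(reflectTranslate z Φ) = fun x => schwartzReflect Φ (x - z) := by
  funext x
  simp [schwartzReflect]

lemma iteratedFDeriv_reflectTranslate (z : Rn n) (Φ : SchwartzMap (Rn n) ℂ) (i : ℕ) (x : Rn n) :
    iteratedFDeriv ℝ i (reflectTranslate z Φ) x =
      iteratedFDeriv ℝ i (schwartzReflect Φ) (x - z) := by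
  rw [coe_reflectTranslate, iteratedFDeriv_comp_sub]

/-- Bounded continuous functions with values in the `i`-linear forms. -/
abbrev JetComp (n i : ℕ) : Type :=
  BoundedContinuousFunction (Rn n) (ContinuousMultilinearMap ℝ (fun _ : Fin i => Rn n) ℂ)

instance instNormedAddCommGroupJetComp (n i : ℕ) : NormedAddCommGroup (JetComp n i) := inferInstance

instance instNormedSpaceJetComp (n i : ℕ) : NormedSpace ℂ (JetComp n i) := inferInstance

/-- The space of jets of order at most `l`. -/
def JetSpace (n l : ℕ) : Type := ∀ i : Fin (l + 1), JetComp n i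

instance instNormedAddCommGroupJetSpace (n l : ℕ) : NormedAddCommGroup (JetSpace n l) :=
  @Pi.normedAddCommGroup (Fin (l + 1)) (fun i => JetComp n i) _
    (fun i => instNormedAddCommGroupJetComp n i)

instance instNormedSpaceJetSpace (n l : ℕ) : NormedSpace ℂ (JetSpace n l) :=
  @Pi.normedSpace ℂ _ (Fin (l + 1)) (fun i => JetComp n i) _
    (fun i => (instNormedAddCommGroupJetComp n i).toSeminormedAddCommGroup)
    (fun i => instNormedSpaceJetComp n i)

/-- Evaluation of the `i`-th component. -/
def jetEval (l : ℕ) (i : Fin (l + 1)) : JetSpace n l →L[ℂ] JetComp n i :=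
  LinearMap.mkContinuous
    { toFun := fun F => F i
      map_add' := fun _ _ => rfl
      map_smul' := fun _ _ => rfl } 1 (fun F => by
        rw [one_mul]
        exact @norm_le_pi_norm (Fin (l + 1)) (fun i => JetComp n i) _
          (fun i => ((instNormedAddCommGroupJetComp n i).toSeminormedAddCommGroup).toSeminormedAddGroup) F i)

lemma jetSpace_norm_le {l : ℕ} {F : JetSpace n l} {D : ℝ} (hD : 0 ≤ D)
    (h : ∀ i x, ‖jetEval l i F x‖ ≤ D) : ‖F‖ ≤ D :=
  (@pi_norm_le_iff_of_nonneg (Fin (l + 1)) (fun i => JetComp n i) _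
    (fun i => ((instNormedAddCommGroupJetComp n i).toSeminormedAddCommGroup).toSeminormedAddGroup) F D hD).2 fun i =>
    (BoundedContinuousFunction.norm_le hD).2 fun x => h i x

lemma jetSpace_le_norm {l : ℕ} (F : JetSpace n l) (i : Fin (l + 1)) (x : Rn n) :
    ‖jetEval l i F x‖ ≤ ‖F‖ :=
  ((jetEval l i F).norm_coe_le_norm x).trans <|
    @norm_le_pi_norm (Fin (l + 1)) (fun i => JetComp n i) _
      (fun i => ((instNormedAddCommGroupJetComp n i).toSeminormedAddCommGroup).toSeminormedAddGroup) F i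

lemma jetSpace_ext {l : ℕ} {F F' : JetSpace n l} (h : ∀ i x, jetEval l i F x = jetEval l i F' x) :
    F = F' := funext fun i => BoundedContinuousFunction.ext (h i)

/-- The component `x ↦ (1 + ‖x‖)^k • D^i φ (x)` as a bounded continuous function. -/
def weightedDeriv (k i : ℕ) : SchwartzMap (Rn n) ℂ →ₗ[ℂ]
    BoundedContinuousFunction (Rn n) (ContinuousMultilinearMap ℝ (fun _ : Fin i => Rn n) ℂ) where
  toFun φ := BoundedContinuousFunction.ofNormedAddCommGroup
    (fun x => ((1 + ‖x‖) ^ k : ℝ) • iteratedFDeriv ℝ i φ x)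
    (by
      have h := (φ.smooth ⊤).continuous_iteratedFDeriv (m := i) (by exact_mod_cast le_top)
      fun_prop)
    (Classical.choose (schwartz_weighted_decay φ k i))
    (fun x => by
      rw [norm_smul, Real.norm_of_nonneg (by positivity)]
      exact (Classical.choose_spec (schwartz_weighted_decay φ k i)).2 x)
  map_add' φ φ' := by
    ext1 x
    simp only [BoundedContinuousFunction.coe_ofNormedAddCommGroup,
      BoundedContinuousFunction.coe_add, Pi.add_apply]
    rw [show ⇑(φ + φ') = ⇑φ + ⇑φ' from rfl,
      iteratedFDeriv_add_apply ((φ.smooth i).contDiffAt) ((φ'.smooth i).contDiffAt), smul_add]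
  map_smul' c φ := by
    ext1 x
    simp only [BoundedContinuousFunction.coe_ofNormedAddCommGroup,
      BoundedContinuousFunction.coe_smul, RingHom.id_apply]
    rw [show ⇑(c • φ) = c • ⇑φ from rfl,
      iteratedFDeriv_const_smul_apply ((φ.smooth i).contDiffAt), smul_comm]

/-- The jet of order at most `l` of a Schwartz function, weighted by `(1 + ‖x‖)^k`. -/
def weightedJet (k l : ℕ) : SchwartzMap (Rn n) ℂ →ₗ[ℂ] JetSpace n l where
  toFun φ := fun i => weightedDeriv k (i : ℕ) φ
  map_add' φ φ' := funext fun i => map_add (weightedDeriv k (i : ℕ)) φ φ'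
  map_smul' c φ := funext fun i => map_smul (weightedDeriv k (i : ℕ)) c φ

lemma weightedJet_apply (k l : ℕ) (φ : SchwartzMap (Rn n) ℂ) (i : Fin (l + 1)) (x : Rn n) :
    jetEval l i (weightedJet k l φ) x = ((1 + ‖x‖) ^ k : ℝ) • iteratedFDeriv ℝ i φ x := rfl

lemma weightedJet_injective (k l : ℕ) : Function.Injective (weightedJet (n := n) k l) := by
  intro φ φ' h
  ext x
  have h1 := congrArg (fun F => jetEval l 0 F x) h
  simp only [weightedJet_apply] at h1
  have h2 := congrArg (fun m => m (fun i => Fin.elim0 i)) h1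
  simp only [_root_.smul_apply] at h2
  have h3 := smul_right_injective ℂ (show ((1 + ‖x‖) ^ k : ℝ) ≠ 0 by positivity) h2
  exact h3

lemma norm_weightedJet_le {k l : ℕ} {φ : SchwartzMap (Rn n) ℂ} {D : ℝ} (hD : 0 ≤ D)
    (h : ∀ i ≤ l, ∀ x, (1 + ‖x‖) ^ k * ‖iteratedFDeriv ℝ i φ x‖ ≤ D) :
    ‖weightedJet k l φ‖ ≤ D := by
  refine jetSpace_norm_le hD fun i x => ?_
  rw [weightedJet_apply, norm_smul, Real.norm_of_nonneg (by positivity)]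
  exact h i (Nat.lt_succ_iff.1 i.2) x

lemma le_norm_weightedJet {k l i : ℕ} (hi : i ≤ l) (φ : SchwartzMap (Rn n) ℂ) (x : Rn n) :
    (1 + ‖x‖) ^ k * ‖iteratedFDeriv ℝ i φ x‖ ≤ ‖weightedJet k l φ‖ := by
  have h2 := jetSpace_le_norm (weightedJet k l φ) ⟨i, Nat.lt_succ_iff.2 hi⟩ x
  rwa [weightedJet_apply, norm_smul, Real.norm_of_nonneg (by positivity)] at h2

/-- A tempered distribution factors through a finite jet space. -/
lemma temperedDist_factor (f : TemperedDist n) : ∃ k l : ℕ, ∃ G : StrongDual ℂ (JetSpace n l),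
    ∀ φ, f φ = G (weightedJet k l φ) := by
  obtain ⟨s, C, hC, hs⟩ := Seminorm.bound_of_continuous (schwartz_withSeminorms ℂ (Rn n) ℂ)
    ((normSeminorm ℂ ℂ).comp f.toLinearMap) (by
      show Continuous fun φ => ‖f φ‖
      exact f.continuous.norm)
  obtain ⟨k, hk⟩ : ∃ k, ∀ m ∈ s, m.1 ≤ k := ⟨s.sup Prod.fst, fun m hm => Finset.le_sup hm⟩
  obtain ⟨l, hl⟩ : ∃ l, ∀ m ∈ s, m.2 ≤ l := ⟨s.sup Prod.snd, fun m hm => Finset.le_sup hm⟩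
  have hbd : ∀ φ, ‖f φ‖ ≤ C * ‖weightedJet k l φ‖ := by
    intro φ
    have h1 : ‖f φ‖ ≤ (C • s.sup (schwartzSeminormFamily ℂ (Rn n) ℂ)) φ := hs φ
    refine h1.trans ?_
    rw [_root_.smul_apply, NNReal.smul_def, smul_eq_mul]
    refine mul_le_mul_of_nonneg_left ?_ C.2
    refine Seminorm.finset_sup_apply_le (norm_nonneg _) fun m hm => ?_
    refine SchwartzMap.seminorm_le_bound ℂ m.1 m.2 φ (norm_nonneg _) fun x => ?_
    refine le_trans ?_ (le_norm_weightedJet (k := k) (hl m hm) φ x)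
    refine mul_le_mul_of_nonneg_right ?_ (norm_nonneg _)
    calc ‖x‖ ^ m.1 ≤ (1 + ‖x‖) ^ m.1 := by gcongr; linarith
      _ ≤ (1 + ‖x‖) ^ k := pow_le_pow_right₀ (by linarith [norm_nonneg x]) (hk m hm)
  let e := LinearEquiv.ofInjective (weightedJet (n := n) k l) (weightedJet_injective k l)
  let g : StrongDual ℂ (LinearMap.range (weightedJet (n := n) k l)) :=
    LinearMap.mkContinuous (f.toLinearMap ∘ₗ e.symm.toLinearMap) C (fun y => by
      have h := hbd (e.symm y)
      have h2 : weightedJet k l (e.symm y) = (y : _) := by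
        rw [← LinearEquiv.ofInjective_apply (h := weightedJet_injective k l)]
        exact congrArg Subtype.val (e.apply_symm_apply y)
      rw [h2] at h
      exact h)
  obtain ⟨G, hG, -⟩ := exists_extension_norm_eq _ g
  refine ⟨k, l, G, fun φ => ?_⟩
  have h := hG (e φ)
  rw [show ((e φ : LinearMap.range (weightedJet (n := n) k l)) : _) = weightedJet k l φ from rfl] at h
  rw [h]
  show f φ = f (e.symm (e φ))
  rw [e.symm_apply_apply]

/-- Polynomial growth of the jets of translates. -/
lemma norm_weightedJet_reflectTranslate_le (Φ : SchwartzMap (Rn n) ℂ) (k l : ℕ) :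
    ∃ D : ℝ, 0 ≤ D ∧ ∀ z, ‖weightedJet k l (reflectTranslate z Φ)‖ ≤ D * (1 + ‖z‖) ^ k := by
  choose D hD0 hD using fun i => schwartz_weighted_decay (schwartzReflect Φ) k i
  refine ⟨∑ i ∈ Finset.range (l + 1), D i, Finset.sum_nonneg fun i _ => hD0 i, fun z => ?_⟩
  refine norm_weightedJet_le (mul_nonneg (Finset.sum_nonneg fun i _ => hD0 i) (by positivity))
    fun i hi x => ?_
  rw [iteratedFDeriv_reflectTranslate]
  calc (1 + ‖x‖) ^ k * ‖iteratedFDeriv ℝ i (schwartzReflect Φ) (x - z)‖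
      ≤ ((1 + ‖x - z‖) * (1 + ‖z‖)) ^ k * ‖iteratedFDeriv ℝ i (schwartzReflect Φ) (x - z)‖ := by
        gcongr; exact one_add_norm_le_mul x z
    _ = ((1 + ‖x - z‖) ^ k * ‖iteratedFDeriv ℝ i (schwartzReflect Φ) (x - z)‖) * (1 + ‖z‖) ^ k := by
        rw [mul_pow]; ring
    _ ≤ (∑ i ∈ Finset.range (l + 1), D i) * (1 + ‖z‖) ^ k := by
        gcongr
        exact (hD i _).trans (Finset.single_le_sum (f := D) (fun j _ => hD0 j)
          (Finset.mem_range.2 (Nat.lt_succ_iff.2 hi)))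

lemma differentiable_iteratedFDeriv_schwartz (φ : SchwartzMap (Rn n) ℂ) (i : ℕ) :
    Differentiable ℝ (iteratedFDeriv ℝ i φ) :=
  (φ.smooth ⊤).differentiable_iteratedFDeriv (m := i) (by exact_mod_cast ENat.natCast_lt_top i)

lemma continuous_weightedJet_reflectTranslate (Φ : SchwartzMap (Rn n) ℂ) (k l : ℕ) :
    Continuous fun z => weightedJet k l (reflectTranslate z Φ) := by
  choose D hD0 hD using fun i => schwartz_weighted_decay (schwartzReflect Φ) k i
  set D' := ∑ i ∈ Finset.range (l + 2), D i with hD'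
  have hD'0 : 0 ≤ D' := Finset.sum_nonneg fun i _ => hD0 i
  have key : ∀ z z' : Rn n,
      ‖weightedJet k l (reflectTranslate z Φ) - weightedJet k l (reflectTranslate z' Φ)‖
        ≤ D' * (1 + ‖z‖ + ‖z'‖) ^ k * ‖z - z'‖ := by
    intro z z'
    rw [← map_sub]
    refine norm_weightedJet_le (by positivity) fun i hi x => ?_
    have hsub : iteratedFDeriv ℝ i (reflectTranslate z Φ - reflectTranslate z' Φ) x =
        iteratedFDeriv ℝ i (schwartzReflect Φ) (x - z) -
          iteratedFDeriv ℝ i (schwartzReflect Φ) (x - z') := by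
      rw [← iteratedFDeriv_reflectTranslate, ← iteratedFDeriv_reflectTranslate]
      exact iteratedFDeriv_sub_apply (((reflectTranslate z Φ).smooth i).contDiffAt)
        (((reflectTranslate z' Φ).smooth i).contDiffAt)
    rw [show ⇑(reflectTranslate z Φ - reflectTranslate z' Φ) =
      ⇑(reflectTranslate z Φ) - ⇑(reflectTranslate z' Φ) from rfl] at *
    rw [hsub]
    have hx0 : 0 < (1 + ‖x‖) ^ k := by positivity
    have hmvt : ‖iteratedFDeriv ℝ i (schwartzReflect Φ) (x - z) -
          iteratedFDeriv ℝ i (schwartzReflect Φ) (x - z')‖ ≤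
        (D' * (1 + ‖z‖ + ‖z'‖) ^ k / (1 + ‖x‖) ^ k) * ‖(x - z) - (x - z')‖ := by
      refine (convex_segment (x - z') (x - z)).norm_image_sub_le_of_norm_fderiv_le (𝕜 := ℝ)
        (fun y _ => (differentiable_iteratedFDeriv_schwartz _ i) y) (fun y hy => ?_)
        (left_mem_segment ℝ _ _) (right_mem_segment ℝ _ _)
      rw [norm_fderiv_iteratedFDeriv, le_div_iff₀ hx0]
      have hy' : 1 + ‖x‖ ≤ (1 + ‖y‖) * (1 + ‖z‖ + ‖z'‖) := by
        have h1 := one_add_norm_le_mul x (x - y)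
        rw [_root_.sub_sub_cancel] at h1
        have h2 : ‖x - y‖ ≤ ‖z‖ + ‖z'‖ := by
          obtain ⟨a, b, ha, hb, hab, rfl⟩ := hy
          have : x - (a • (x - z') + b • (x - z)) = a • z' + b • z := by
            rw [smul_sub, smul_sub]
            have : x = (a + b) • x := by rw [hab, one_smul]
            nth_rewrite 1 [this]
            rw [add_smul]; abel
          rw [this]
          have h3 := norm_add_le (a • z') (b • z)
          rw [norm_smul, norm_smul, Real.norm_of_nonneg ha, Real.norm_of_nonneg hb] at h3
          nlinarith [norm_nonneg z, norm_nonneg z']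
        nlinarith [norm_nonneg y]
      calc ‖iteratedFDeriv ℝ (i + 1) (schwartzReflect Φ) y‖ * (1 + ‖x‖) ^ k
          ≤ ‖iteratedFDeriv ℝ (i + 1) (schwartzReflect Φ) y‖ *
              ((1 + ‖y‖) * (1 + ‖z‖ + ‖z'‖)) ^ k := by gcongr
        _ = ((1 + ‖y‖) ^ k * ‖iteratedFDeriv ℝ (i + 1) (schwartzReflect Φ) y‖) *
              (1 + ‖z‖ + ‖z'‖) ^ k := by rw [mul_pow]; ring
        _ ≤ D' * (1 + ‖z‖ + ‖z'‖) ^ k := by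
            gcongr
            exact (hD (i + 1) y).trans (Finset.single_le_sum (f := D) (fun j _ => hD0 j)
              (Finset.mem_range.2 (by omega)))
    rw [_root_.sub_sub_sub_cancel_left, norm_sub_rev z' z] at hmvt
    calc (1 + ‖x‖) ^ k * ‖iteratedFDeriv ℝ i (schwartzReflect Φ) (x - z) -
          iteratedFDeriv ℝ i (schwartzReflect Φ) (x - z')‖
        ≤ (1 + ‖x‖) ^ k * ((D' * (1 + ‖z‖ + ‖z'‖) ^ k / (1 + ‖x‖) ^ k) * ‖z - z'‖) := by gcongr
      _ = D' * (1 + ‖z‖ + ‖z'‖) ^ k * ‖z - z'‖ := by field_simp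
  rw [continuous_iff_continuousAt]
  intro z'
  rw [ContinuousAt, tendsto_iff_norm_sub_tendsto_zero]
  have hlim : Filter.Tendsto (fun z : Rn n => D' * (1 + ‖z‖ + ‖z'‖) ^ k * ‖z - z'‖)
      (nhds z') (nhds (D' * (1 + ‖z'‖ + ‖z'‖) ^ k * ‖z' - z'‖)) := by
    apply Continuous.tendsto (f := fun z : Rn n => D' * (1 + ‖z‖ + ‖z'‖) ^ k * ‖z - z'‖)
    fun_prop
  rw [sub_self, norm_zero, mul_zero] at hlim
  exact squeeze_zero (fun _ => norm_nonneg _) (fun z => key z z') hlim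

lemma continuous_distConv (Ψ : SchwartzMap (Rn n) ℂ) (f : TemperedDist n) :
    Continuous (distConv Ψ f) := by
  obtain ⟨k, l, G, hG⟩ := temperedDist_factor f
  have : distConv Ψ f = fun z => G (weightedJet k l (reflectTranslate z Ψ)) := by
    funext z; exact hG _
  rw [this]
  exact G.continuous.comp (continuous_weightedJet_reflectTranslate Ψ k l)

section DifferentiationUnderIntegral

variable {W : Type*} [NormedAddCommGroup W] [NormedSpace ℂ W]

lemma integrable_schwartz_smul (Λ : SchwartzMap (Rn n) ℂ) {K : Rn n → W} (hK : Continuous K)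
    {D : ℝ} (hD : ∀ x, ‖K x‖ ≤ D) (x : Rn n) : Integrable (fun z => Λ z • K (x - z)) := by
  have hc : Continuous (fun z => Λ z • K (x - z)) :=
    Λ.continuous.smul (hK.comp (continuous_const.sub continuous_id))
  refine (Λ.integrable.norm.mul_const D).mono' hc.aestronglyMeasurable
    (Filter.Eventually.of_forall fun z => ?_)
  rw [norm_smul]
  exact mul_le_mul_of_nonneg_left (hD _) (norm_nonneg _)

lemma hasFDerivAt_integral_schwartz_smul [NormedSpace ℝ W] [SMulCommClass ℝ ℂ W]
    (Λ : SchwartzMap (Rn n) ℂ) {K : Rn n → W}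
    (hK : ContDiff ℝ 1 K) {D D' : ℝ} (hD : ∀ x, ‖K x‖ ≤ D) (hD' : ∀ x, ‖fderiv ℝ K x‖ ≤ D')
    (x : Rn n) :
    HasFDerivAt (fun x => ∫ z, Λ z • K (x - z)) (∫ z, Λ z • fderiv ℝ K (x - z)) x := by
  have hfc : Continuous (fderiv ℝ K) := hK.continuous_fderiv one_ne_zero
  refine hasFDerivAt_integral_of_dominated_of_fderiv_le
    (F := fun x z => Λ z • K (x - z)) (F' := fun x z => Λ z • fderiv ℝ K (x - z))
    (bound := fun z => ‖Λ z‖ * D') (s := Set.univ) Filter.univ_mem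
    (Filter.Eventually.of_forall fun y =>
      (integrable_schwartz_smul Λ hK.continuous hD y).aestronglyMeasurable)
    (integrable_schwartz_smul Λ hK.continuous hD x)
    (integrable_schwartz_smul Λ hfc hD' x).aestronglyMeasurable
    (Filter.Eventually.of_forall fun z y _ => ?_)
    (Λ.integrable.norm.mul_const D') (Filter.Eventually.of_forall fun z y _ => ?_)
  · rw [norm_smul]
    exact mul_le_mul_of_nonneg_left (hD' _) (norm_nonneg _)
  · have h1 := (hK.differentiable one_ne_zero (y - z)).hasFDerivAt
    have h2 := h1.comp y ((hasFDerivAt_id y).sub_const z)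
    exact h2.const_smul (Λ z)

lemma comp_fderiv_integral_schwartz_smul [NormedSpace ℝ W] [SMulCommClass ℝ ℂ W]
    {W' : Type*} [NormedAddCommGroup W'] [NormedSpace ℂ W'] [NormedSpace ℝ W']
    (I : (Rn n →L[ℝ] W) ≃L[ℝ] W') (hI : ∀ (c : ℂ) L, I (c • L) = c • I L)
    (Λ : SchwartzMap (Rn n) ℂ) {K : Rn n → W}
    (hK : ContDiff ℝ 1 K) {D D' : ℝ} (hD : ∀ x, ‖K x‖ ≤ D) (hD' : ∀ x, ‖fderiv ℝ K x‖ ≤ D')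
    (x : Rn n) :
    I (fderiv ℝ (fun x => ∫ z, Λ z • K (x - z)) x) = ∫ z, Λ z • I (fderiv ℝ K (x - z)) := by
  rw [(hasFDerivAt_integral_schwartz_smul Λ hK hD hD' x).fderiv, ← I.integral_comp_comm]
  simp_rw [hI]

end DifferentiationUnderIntegral

lemma iteratedFDeriv_eq_integral (Λ H V : SchwartzMap (Rn n) ℂ)
    (hV : ∀ x, V x = ∫ z, Λ z * H (x - z)) (i : ℕ) (x : Rn n) :
    iteratedFDeriv ℝ i V x = ∫ z, Λ z • iteratedFDeriv ℝ i H (x - z) := by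
  have hcont : ∀ j, Continuous (iteratedFDeriv ℝ j H) := fun j =>
    (differentiable_iteratedFDeriv_schwartz H j).continuous
  have hbd : ∀ j, ∃ D : ℝ, 0 ≤ D ∧ ∀ x, ‖iteratedFDeriv ℝ j H x‖ ≤ D := fun j => by
    obtain ⟨D, h0, h⟩ := schwartz_weighted_decay H 0 j
    exact ⟨D, h0, fun x => by simpa using h x⟩
  induction i generalizing x with
  | zero =>
    ext m
    obtain ⟨D, h0, h⟩ := hbd 0
    rw [show (∫ z, Λ z • iteratedFDeriv ℝ 0 H (x - z)) m =
      ContinuousMultilinearMap.apply ℝ (fun _ : Fin 0 => Rn n) ℂ m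
        (∫ z, Λ z • iteratedFDeriv ℝ 0 H (x - z)) from rfl,
      ← ContinuousLinearMap.integral_comp_comm _ (integrable_schwartz_smul Λ (hcont 0) h x)]
    rw [iteratedFDeriv_zero_apply, hV]
    rfl
  | succ i ih =>
    have hfun : iteratedFDeriv ℝ i V = fun x => ∫ z, Λ z • iteratedFDeriv ℝ i H (x - z) :=
      funext ih
    obtain ⟨D, hD0, hD⟩ := hbd i
    obtain ⟨D', hD'0, hD'⟩ := hbd (i + 1)
    rw [iteratedFDeriv_succ_eq_comp_left, Function.comp_apply, hfun]
    refine (comp_fderiv_integral_schwartz_smul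
      (continuousMultilinearCurryLeftEquiv ℝ (fun _ : Fin (i + 1) =>
        Rn n) ℂ).symm.toContinuousLinearEquiv (fun c L => rfl) Λ
      ((H.smooth ⊤).iteratedFDeriv_right (m := 1) (i := i) (by exact_mod_cast le_top)) hD
      (fun x => by rw [norm_fderiv_iteratedFDeriv]; exact hD' x) x).trans ?_
    rfl

lemma integrable_schwartz_mul_growth (Λ : SchwartzMap (Rn n) ℂ) (k : ℕ) :
    Integrable (fun z => ‖Λ z‖ * (1 + ‖z‖) ^ k) := by
  obtain ⟨D, hD0, hD⟩ := schwartz_weighted_decay Λ (k + (n + 1)) 0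
  have h1 : Integrable (fun z : Rn n => D * (1 + ‖z‖) ^ (-((n + 1 : ℕ) : ℝ))) :=
    (integrable_one_add_norm (by simp)).const_mul D
  refine h1.mono' (by
    have := Λ.continuous
    exact Continuous.aestronglyMeasurable (by fun_prop)) (Filter.Eventually.of_forall fun z => ?_)
  have hz : 0 < 1 + ‖z‖ := by positivity
  rw [Real.norm_of_nonneg (by positivity), Real.rpow_neg hz.le, Real.rpow_natCast,
    ← div_eq_mul_inv, le_div_iff₀ (by positivity)]
  have h := hD z
  rw [norm_iteratedFDeriv_zero, pow_add] at h
  linarith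

instance instCompleteSpaceJetSpace (n l : ℕ) : CompleteSpace (JetSpace n l) :=
  inferInstanceAs (CompleteSpace (∀ i : Fin (l + 1), JetComp n i))

/-- Exchange of a tempered distribution with a convolution integral. -/
lemma temperedDist_integral (f : TemperedDist n) (Λ Φ V : SchwartzMap (Rn n) ℂ)
    (hV : ∀ x, V x = ∫ z, Λ z * Φ (z - x)) :
    f V = ∫ z, Λ z * distConv Φ f z := by
  obtain ⟨k, l, G, hG⟩ := temperedDist_factor f
  obtain ⟨D, hD0, hD⟩ := norm_weightedJet_reflectTranslate_le Φ k l
  have hc := continuous_weightedJet_reflectTranslate Φ k l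
  have hintegrable : Integrable (fun z => Λ z • weightedJet k l (reflectTranslate z Φ)) := by
    refine ((integrable_schwartz_mul_growth Λ k).const_mul D).mono'
      (Λ.continuous.smul hc).aestronglyMeasurable (Filter.Eventually.of_forall fun z => ?_)
    rw [norm_smul]
    calc ‖Λ z‖ * ‖weightedJet k l (reflectTranslate z Φ)‖ ≤ ‖Λ z‖ * (D * (1 + ‖z‖) ^ k) := by
          gcongr; exact hD z
      _ = D * (‖Λ z‖ * (1 + ‖z‖) ^ k) := by ring
  have hV' : ∀ x, V x = ∫ z, Λ z * schwartzReflect Φ (x - z) := fun x => by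
    rw [hV]
    simp [schwartzReflect]
  have hJ : weightedJet k l V = ∫ z, Λ z • weightedJet k l (reflectTranslate z Φ) := by
    refine jetSpace_ext fun i x => ?_
    obtain ⟨D', hD'0, hD'⟩ := schwartz_weighted_decay (schwartzReflect Φ) 0 i
    have hi := (jetEval (n := n) l i).integral_comp_comm hintegrable
    have hi' : Integrable fun z => jetEval l i (Λ z • weightedJet k l (reflectTranslate z Φ)) :=
      (jetEval (n := n) l i).integrable_comp hintegrable
    have he := (BoundedContinuousFunction.evalCLM ℂ
      (β := ContinuousMultilinearMap ℝ (fun _ : Fin (i : ℕ) => Rn n) ℂ) x).integral_comp_comm hi'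
    rw [hi] at he
    refine Eq.trans ?_ he
    have h2 := iteratedFDeriv_eq_integral Λ (schwartzReflect Φ) V hV' i x
    have h3 : ∀ z, (BoundedContinuousFunction.evalCLM ℂ
      (β := ContinuousMultilinearMap ℝ (fun _ : Fin (i : ℕ) => Rn n) ℂ) x)
        (jetEval l i (Λ z • weightedJet k l (reflectTranslate z Φ))) =
        ((1 + ‖x‖) ^ k : ℝ) • (Λ z • iteratedFDeriv ℝ i (schwartzReflect Φ) (x - z)) := fun z => by
      rw [map_smul, map_smul, ← iteratedFDeriv_reflectTranslate, smul_comm]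
      rfl
    simp_rw [h3]
    rw [integral_smul, ← h2]
    rfl
  rw [hG, hJ, ← G.integral_comp_comm hintegrable]
  refine integral_congr_ae (Filter.Eventually.of_forall fun z => ?_)
  simp only [map_smul, smul_eq_mul]
  rw [← hG]
  rfl

lemma fourier_mul_apply (μ ψ φ : SchwartzMap (Rn n) ℂ) (h : ∀ ξ, φ ξ = μ ξ * ψ ξ) (x y : Rn n) :
    SchwartzMap.fourierTransformCLM ℂ φ (y - x) =
      ∫ z, SchwartzMap.fourierTransformCLM ℂ μ (y - z) *
        SchwartzMap.fourierTransformCLM ℂ ψ (z - x) := by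
  have hinv : ∀ (g : SchwartzMap (Rn n) ℂ) (w : Rn n),
      (FourierTransformInv.fourierInv g : SchwartzMap (Rn n) ℂ) w =
        SchwartzMap.fourierTransformCLM ℂ g (-w) := by
    intro g w
    rw [SchwartzMap.fourierTransformCLM_apply, SchwartzMap.fourier_coe, SchwartzMap.fourierInv_coe,
      Real.fourierInv_eq_fourier_neg]
  have hφ : φ = SchwartzMap.pairing (ContinuousLinearMap.mul ℂ ℂ) μ ψ := by
    ext ξ
    rw [SchwartzMap.pairing_apply_apply, h]
    rfl
  have hconv : SchwartzMap.convolution (ContinuousLinearMap.mul ℂ ℂ)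
      (FourierTransformInv.fourierInv μ : SchwartzMap (Rn n) ℂ)
      (FourierTransformInv.fourierInv ψ : SchwartzMap (Rn n) ℂ) =
      (FourierTransformInv.fourierInv φ : SchwartzMap (Rn n) ℂ) := by
    rw [hφ, SchwartzMap.convolution]
    simp
  have h1 := hinv φ (x - y)
  rw [neg_sub] at h1
  rw [← h1, ← hconv, SchwartzMap.convolution_apply, MeasureTheory.convolution_def,
    ← integral_sub_right_eq_self _ y]
  refine integral_congr_ae (Filter.Eventually.of_forall fun z => ?_)
  simp only [ContinuousLinearMap.mul_apply', hinv]
  congr 2 <;> abel_nf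

/-- The convolution with the Fourier transform of a product. -/
lemma distConv_fourier_mul_le (f : TemperedDist n) (μ ψ φ : SchwartzMap (Rn n) ℂ)
    (h : ∀ ξ, φ ξ = μ ξ * ψ ξ) (y : Rn n) :
    ‖distConv (SchwartzMap.fourierTransformCLM ℂ φ) f y‖ₑ ≤
      ∫⁻ z, ‖SchwartzMap.fourierTransformCLM ℂ μ (y - z)‖ₑ *
        ‖distConv (SchwartzMap.fourierTransformCLM ℂ ψ) f z‖ₑ := by
  have h1 := temperedDist_integral f (reflectTranslate y (SchwartzMap.fourierTransformCLM ℂ μ))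
    (SchwartzMap.fourierTransformCLM ℂ ψ)
    (reflectTranslate y (SchwartzMap.fourierTransformCLM ℂ φ))
    (fun x => fourier_mul_apply μ ψ φ h x y)
  rw [distConv, h1]
  refine (enorm_integral_le_lintegral_enorm _).trans_eq ?_
  simp_rw [enorm_mul]
  rfl

lemma norm_iteratedFDeriv_schwartzReflect (Φ : SchwartzMap (Rn n) ℂ) (i : ℕ) (x : Rn n) :
    ‖iteratedFDeriv ℝ i (schwartzReflect Φ) x‖ = ‖iteratedFDeriv ℝ i Φ (-x)‖ := by
  have : ⇑(schwartzReflect Φ) = ⇑Φ ∘ ⇑(LinearIsometryEquiv.neg ℝ (E := Rn n)) := by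
    funext x
    simp [schwartzReflect]
  rw [this, LinearIsometryEquiv.norm_iteratedFDeriv_comp_right]
  rfl

/-- Polynomial growth of `Φ ∗ f`, with a constant depending on finitely many seminorms. -/
lemma distConv_growth (f : TemperedDist n) : ∃ k l : ℕ, ∃ C : ℝ, 0 ≤ C ∧
    ∀ (Φ : SchwartzMap (Rn n) ℂ) (D : ℝ), 0 ≤ D →
      (∀ i ≤ l, ∀ x, (1 + ‖x‖) ^ k * ‖iteratedFDeriv ℝ i Φ x‖ ≤ D) →
      ∀ y, ‖distConv Φ f y‖ ≤ C * D * (1 + ‖y‖) ^ k := by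
  obtain ⟨k, l, G, hG⟩ := temperedDist_factor f
  refine ⟨k, l, ‖G‖, norm_nonneg _, fun Φ D hD0 hD y => ?_⟩
  rw [distConv, hG]
  refine (G.le_opNorm _).trans ?_
  rw [mul_assoc]
  refine mul_le_mul_of_nonneg_left ?_ (norm_nonneg _)
  refine norm_weightedJet_le (by positivity) fun i hi x => ?_
  rw [iteratedFDeriv_reflectTranslate, norm_iteratedFDeriv_schwartzReflect]
  calc (1 + ‖x‖) ^ k * ‖iteratedFDeriv ℝ i Φ (-(x - y))‖
      ≤ ((1 + ‖-(x - y)‖) * (1 + ‖y‖)) ^ k * ‖iteratedFDeriv ℝ i Φ (-(x - y))‖ := by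
        rw [norm_neg]; gcongr; exact one_add_norm_le_mul x y
    _ = ((1 + ‖-(x - y)‖) ^ k * ‖iteratedFDeriv ℝ i Φ (-(x - y))‖) * (1 + ‖y‖) ^ k := by
        rw [mul_pow]; ring
    _ ≤ D * (1 + ‖y‖) ^ k := by
        gcongr
        exact hD i hi _

/-- Continuity of the Fourier transform in terms of weighted derivatives. -/
lemma fourier_weighted_bound (k l : ℕ) : ∃ k' l' : ℕ, ∃ C : ℝ, 0 ≤ C ∧
    ∀ (φ : SchwartzMap (Rn n) ℂ) (D : ℝ), 0 ≤ D →
      (∀ i ≤ l', ∀ x, (1 + ‖x‖) ^ k' * ‖iteratedFDeriv ℝ i φ x‖ ≤ D) →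
      ∀ i ≤ l, ∀ x, (1 + ‖x‖) ^ k *
        ‖iteratedFDeriv ℝ i (SchwartzMap.fourierTransformCLM ℂ φ) x‖ ≤ C * D := by
  set S : Seminorm ℂ (SchwartzMap (Rn n) ℂ) :=
    (Finset.Iic (k, l)).sup (schwartzSeminormFamily ℂ (Rn n) ℂ) with hS
  have hScont : Continuous S := by
    rw [hS]
    refine Finset.sup_induction (p := fun S : Seminorm ℂ (SchwartzMap (Rn n) ℂ) => Continuous S)
      continuous_const (fun p hp q hq => ?_) fun m _ => ?_
    · rw [Seminorm.coe_sup]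
      exact hp.sup hq
    exact (schwartz_withSeminorms ℂ (Rn n) ℂ).continuous_seminorm m
  obtain ⟨s, C, hC, hs⟩ := Seminorm.bound_of_continuous (schwartz_withSeminorms ℂ (Rn n) ℂ)
    (S.comp (SchwartzMap.fourierTransformCLM ℂ).toLinearMap) (by
      show Continuous fun φ => S (SchwartzMap.fourierTransformCLM ℂ φ)
      exact hScont.comp (SchwartzMap.fourierTransformCLM ℂ).continuous)
  obtain ⟨k', hk⟩ : ∃ k', ∀ m ∈ s, m.1 ≤ k' := ⟨s.sup Prod.fst, fun m hm => Finset.le_sup hm⟩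
  obtain ⟨l', hl⟩ : ∃ l', ∀ m ∈ s, m.2 ≤ l' := ⟨s.sup Prod.snd, fun m hm => Finset.le_sup hm⟩
  refine ⟨k', l', 2 ^ k * C, by positivity, fun φ D hD0 hD i hi x => ?_⟩
  have h1 := SchwartzMap.one_add_le_sup_seminorm_apply (𝕜 := ℂ) (m := (k, l)) le_rfl hi
    (SchwartzMap.fourierTransformCLM ℂ φ) x
  refine h1.trans ?_
  rw [mul_assoc]
  refine mul_le_mul_of_nonneg_left ?_ (by positivity)
  have h2 : S (SchwartzMap.fourierTransformCLM ℂ φ) ≤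
      (C • s.sup (schwartzSeminormFamily ℂ (Rn n) ℂ)) φ := hs φ
  refine h2.trans ?_
  rw [_root_.smul_apply, NNReal.smul_def, smul_eq_mul]
  refine mul_le_mul_of_nonneg_left ?_ C.2
  refine Seminorm.finset_sup_apply_le hD0 fun m hm => ?_
  refine SchwartzMap.seminorm_le_bound ℂ m.1 m.2 φ hD0 fun x => ?_
  refine le_trans ?_ (hD m.2 (hl m hm) x)
  refine mul_le_mul_of_nonneg_right ?_ (norm_nonneg _)
  calc ‖x‖ ^ m.1 ≤ (1 + ‖x‖) ^ m.1 := by gcongr; linarith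
    _ ≤ (1 + ‖x‖) ^ k' := pow_le_pow_right₀ (by linarith [norm_nonneg x]) (hk m hm)

lemma exists_schwartz_dilation (φ : SchwartzMap (Rn n) ℂ) {c : ℝ} (hc : c ≠ 0) :
    ∃ ψ : SchwartzMap (Rn n) ℂ, ∀ x, ψ x = φ (c • x) :=
  ⟨SchwartzMap.compCLMOfContinuousLinearEquiv ℂ
    (ContinuousLinearEquiv.smulLeft (Units.mk0 c hc)) φ, fun _ => rfl⟩

lemma exists_schwartz_mul (φ χ : SchwartzMap (Rn n) ℂ) :
    ∃ ψ : SchwartzMap (Rn n) ℂ, ∀ x, ψ x = φ x * χ x :=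
  ⟨SchwartzMap.pairing (ContinuousLinearMap.mul ℂ ℂ) φ χ, fun x => by
    rw [SchwartzMap.pairing_apply_apply]; rfl⟩

lemma fourier_dilation (φ ψ : SchwartzMap (Rn n) ℂ) (j : ℕ)
    (h : ∀ x, ψ x = φ (((2 : ℝ) ^ j)⁻¹ • x)) (x : Rn n) :
    SchwartzMap.fourierTransformCLM ℂ ψ x =
      ((2 : ℝ) ^ (j * n)) • SchwartzMap.fourierTransformCLM ℂ φ ((2 : ℝ) ^ j • x) := by
  have h2 : (0 : ℝ) < 2 ^ j := by positivity
  rw [SchwartzMap.fourierTransformCLM_apply, SchwartzMap.fourierTransformCLM_apply,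
    SchwartzMap.fourier_coe, SchwartzMap.fourier_coe, Real.fourier_eq, Real.fourier_eq]
  have h3 := Measure.integral_comp_smul (volume : Measure (Rn n))
    (fun v => Real.fourierChar (-inner ℝ v ((2 : ℝ) ^ j • x)) • φ v) ((2 : ℝ) ^ j)⁻¹
  rw [finrank_euclideanSpace_fin, inv_pow, inv_inv, abs_of_pos (by positivity), ← pow_mul] at h3
  rw [← h3]
  refine integral_congr_ae (Filter.Eventually.of_forall fun v => ?_)
  simp only
  rw [h, inner_smul_left, inner_smul_right]
  congr 3
  simp

lemma norm_iteratedFDeriv_comp_smul_le {χ : Rn n → ℂ} (hχ : ContDiff ℝ (⊤ : ℕ∞) χ) (c : ℝ) (b : ℕ)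
    (x : Rn n) :
    ‖iteratedFDeriv ℝ b (fun x => χ (c • x)) x‖ ≤ |c| ^ b * ‖iteratedFDeriv ℝ b χ (c • x)‖ := by
  rw [iteratedFDeriv_comp_const_smul c (hχ.of_le (by exact_mod_cast le_top)), norm_smul, norm_pow,
    Real.norm_eq_abs]

/-- Products of a Schwartz function with dilations of a function vanishing near the origin
are rapidly small. -/
lemma schwartz_mul_dilation_decay (φ : SchwartzMap (Rn n) ℂ) {χ : Rn n → ℂ}
    (hχ : ContDiff ℝ (⊤ : ℕ∞) χ) (hb : ∀ b, ∃ B, ∀ x, ‖iteratedFDeriv ℝ b χ x‖ ≤ B)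
    {ε : ℝ} (hε : 0 < ε) (hv : ∀ x, ‖x‖ < ε → χ x = 0) (k l N : ℕ) :
    ∃ D : ℝ, 0 ≤ D ∧ ∀ (i : ℕ) (ν : SchwartzMap (Rn n) ℂ),
      (∀ x, ν x = φ x * χ (((2 : ℝ) ^ i)⁻¹ • x)) →
      ∀ l' ≤ l, ∀ x, (1 + ‖x‖) ^ k * ‖iteratedFDeriv ℝ l' ν x‖ ≤ D * (((2 : ℝ) ^ i)⁻¹) ^ N := by
  choose B hB using hb
  have hB0 : ∀ b, 0 ≤ B b := fun b => (norm_nonneg _).trans (hB b 0)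
  choose P hP0 hP using fun a => schwartz_weighted_decay φ (k + N) a
  set E : ℕ → ℝ := fun l' => ∑ a ∈ Finset.range (l' + 1),
    (l'.choose a : ℝ) * P a * (B (l' - a) * (ε⁻¹) ^ N) with hE
  have hE0 : ∀ l', 0 ≤ E l' := fun l' => Finset.sum_nonneg fun a _ =>
    mul_nonneg (mul_nonneg (by positivity) (hP0 a)) (mul_nonneg (hB0 _) (by positivity))
  refine ⟨∑ l' ∈ Finset.range (l + 1), E l', Finset.sum_nonneg fun l' _ => hE0 l',
    fun i ν hν l' hl' x => ?_⟩
  set c : ℝ := ((2 : ℝ) ^ i)⁻¹ with hc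
  have hc0 : 0 < c := by positivity
  have hc1 : c ≤ 1 := inv_le_one_of_one_le₀ (one_le_pow₀ (by norm_num))
  have hχb : ∀ b, ‖iteratedFDeriv ℝ b (fun x => χ (c • x)) x‖ ≤
      B b * ((1 + ‖x‖) ^ N * (ε⁻¹) ^ N * c ^ N) := by
    intro b
    by_cases hx : ‖c • x‖ < ε
    · have hz : iteratedFDeriv ℝ b χ (c • x) = 0 := by
        have : χ =ᶠ[nhds (c • x)] fun _ => 0 := by
          have : Metric.ball (0 : Rn n) ε ∈ nhds (c • x) :=
            Metric.isOpen_ball.mem_nhds (by simpa using hx)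
          filter_upwards [this] with y hy
          exact hv y (by simpa using hy)
        rw [(this.iteratedFDeriv ℝ b).eq_of_nhds]
        simp
      refine (norm_iteratedFDeriv_comp_smul_le hχ c b x).trans ?_
      rw [hz, norm_zero, mul_zero]
      exact mul_nonneg (hB0 b) (by positivity)
    · rw [not_lt, norm_smul, Real.norm_of_nonneg hc0.le] at hx
      have h1 : 1 ≤ (1 + ‖x‖) * ε⁻¹ * c := by
        rw [mul_assoc, mul_comm ε⁻¹ c, ← mul_assoc, ← div_eq_mul_inv, le_div_iff₀ hε]
        nlinarith
      have h2 : 1 ≤ (1 + ‖x‖) ^ N * (ε⁻¹) ^ N * c ^ N := by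
        rw [← mul_pow, ← mul_pow]; exact one_le_pow₀ h1
      refine (norm_iteratedFDeriv_comp_smul_le hχ c b x).trans ?_
      have h3 : |c| ^ b ≤ 1 := by rw [abs_of_pos hc0]; exact pow_le_one₀ hc0.le hc1
      calc |c| ^ b * ‖iteratedFDeriv ℝ b χ (c • x)‖ ≤ 1 * B b := by
            gcongr; exact hB b _
        _ ≤ B b * ((1 + ‖x‖) ^ N * (ε⁻¹) ^ N * c ^ N) := by
            rw [one_mul]; exact le_mul_of_one_le_right (hB0 b) h2
  have hνf : ⇑ν = fun x => φ x * χ (c • x) := funext hν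
  have hmul := norm_iteratedFDeriv_mul_le (𝕜 := ℝ) (N := (⊤ : ℕ∞)) (φ.smooth ⊤)
    (hχ.comp (contDiff_const_smul c)) x (n := l') (by exact_mod_cast le_top)
  rw [hνf]
  calc (1 + ‖x‖) ^ k * ‖iteratedFDeriv ℝ l' (fun x => φ x * χ (c • x)) x‖
      ≤ (1 + ‖x‖) ^ k * ∑ a ∈ Finset.range (l' + 1), (l'.choose a : ℝ) *
          ‖iteratedFDeriv ℝ a φ x‖ * ‖iteratedFDeriv ℝ (l' - a) (fun x => χ (c • x)) x‖ := by
        gcongr; exact hmul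
    _ = ∑ a ∈ Finset.range (l' + 1), (1 + ‖x‖) ^ k * ((l'.choose a : ℝ) *
          ‖iteratedFDeriv ℝ a φ x‖ * ‖iteratedFDeriv ℝ (l' - a) (fun x => χ (c • x)) x‖) := by
        rw [Finset.mul_sum]
    _ ≤ ∑ a ∈ Finset.range (l' + 1),
          ((l'.choose a : ℝ) * P a * (B (l' - a) * (ε⁻¹) ^ N)) * c ^ N := by
        refine Finset.sum_le_sum fun a _ => ?_
        calc (1 + ‖x‖) ^ k * ((l'.choose a : ℝ) *
              ‖iteratedFDeriv ℝ a φ x‖ * ‖iteratedFDeriv ℝ (l' - a) (fun x => χ (c • x)) x‖)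
            ≤ (1 + ‖x‖) ^ k * ((l'.choose a : ℝ) * ‖iteratedFDeriv ℝ a φ x‖ *
              (B (l' - a) * ((1 + ‖x‖) ^ N * (ε⁻¹) ^ N * c ^ N))) := by
              gcongr; exact hχb _
          _ = (l'.choose a : ℝ) * ((1 + ‖x‖) ^ (k + N) * ‖iteratedFDeriv ℝ a φ x‖) *
              (B (l' - a) * (ε⁻¹) ^ N) * c ^ N := by rw [pow_add]; ring
          _ ≤ _ := by
              have := hB0 (l' - a)
              gcongr
              exact hP a x
    _ = E l' * c ^ N := by rw [hE, Finset.sum_mul]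
    _ ≤ (∑ l' ∈ Finset.range (l + 1), E l') * c ^ N := by
        gcongr
        exact Finset.single_le_sum (f := E) (fun j _ => hE0 j)
          (Finset.mem_range.2 (Nat.lt_succ_iff.2 hl'))

lemma exists_dyadic_cutoff (ψ : SchwartzMap (Rn n) ℂ) {ε k : ℝ} (hε : 0 < ε) (hk : 1 < k)
    (hψ : ∀ x : Rn n, ε ≤ ‖x‖ → ‖x‖ ≤ 2 * k * ε → 0 < ‖ψ x‖) :
    ∃ Θ Λ : SchwartzMap (Rn n) ℂ, (∀ x, ‖x‖ < ε → Θ x = 1) ∧ (∀ x, ‖x‖ < ε → Λ x = 0) ∧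
      ∀ x, Θ ((2 : ℝ)⁻¹ • x) - Θ x = Λ x * ψ x := by
  let B : ContDiffBump (0 : Rn n) := ⟨ε, k * ε, hε, by nlinarith⟩
  set θ : Rn n → ℂ := fun x => ((B x : ℝ) : ℂ) with hθ
  have hθs : ContDiff ℝ (⊤ : ℕ∞) θ := Complex.ofRealCLM.contDiff.comp B.contDiff
  have hθ1 : ∀ x, ‖x‖ ≤ ε → θ x = 1 := fun x hx => by
    simp only [hθ]
    rw [B.one_of_mem_closedBall (by simpa using hx)]; simp
  have hθ0 : ∀ x, k * ε ≤ ‖x‖ → θ x = 0 := fun x hx => by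
    simp only [hθ]
    rw [B.zero_of_le_dist (by simpa using hx)]; simp
  have hθc : HasCompactSupport θ := by
    refine HasCompactSupport.of_support_subset_isCompact
      (isCompact_closedBall (0 : Rn n) (k * ε)) fun x hx => ?_
    by_contra h
    simp only [Metric.mem_closedBall, dist_zero_right, not_le] at h
    exact hx (hθ0 x h.le)
  set d : Rn n → ℂ := fun x => θ ((2 : ℝ)⁻¹ • x) - θ x with hd
  have hds : ContDiff ℝ (⊤ : ℕ∞) d := (hθs.comp (contDiff_const_smul _)).sub hθs
  have hn2 : ∀ x : Rn n, ‖(2 : ℝ)⁻¹ • x‖ = 2⁻¹ * ‖x‖ := fun x => by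
    rw [norm_smul]; norm_num
  have hd0 : ∀ x, ‖x‖ < ε → d x = 0 := fun x hx => by
    simp only [hd]
    rw [hθ1 x hx.le, hθ1 _ (by rw [hn2]; linarith [norm_nonneg x]), sub_self]
  have hd1 : ∀ x, 2 * k * ε < ‖x‖ → d x = 0 := fun x hx => by
    have : k * ε ≤ ‖x‖ := by nlinarith
    simp only [hd]
    rw [hθ0 x this, hθ0 _ (by rw [hn2]; linarith), sub_self]
  set lam : Rn n → ℂ := fun x => d x / ψ x with hlam
  have hl0 : ∀ x, ‖x‖ < ε → lam x = 0 := fun x hx => by simp only [hlam]; rw [hd0 x hx, zero_div]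
  have hlc : HasCompactSupport lam := by
    refine HasCompactSupport.of_support_subset_isCompact
      (isCompact_closedBall (0 : Rn n) (2 * k * ε)) fun x hx => ?_
    by_contra h
    simp only [Metric.mem_closedBall, dist_zero_right, not_le] at h
    exact hx (by simp only [hlam]; rw [hd1 x h, zero_div])
  have hls : ContDiff ℝ (⊤ : ℕ∞) lam := by
    rw [contDiff_iff_contDiffAt]
    intro x
    by_cases h1 : ‖x‖ < ε
    · have : lam =ᶠ[nhds x] fun _ => 0 := by
        filter_upwards [(isOpen_lt continuous_norm continuous_const).mem_nhds h1] with y hy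
        exact hl0 y hy
      exact contDiffAt_const.congr_of_eventuallyEq this
    by_cases h2 : 2 * k * ε < ‖x‖
    · have : lam =ᶠ[nhds x] fun _ => 0 := by
        filter_upwards [(isOpen_lt continuous_const continuous_norm).mem_nhds h2] with y hy
        simp only [hlam]; rw [hd1 y hy, zero_div]
      exact contDiffAt_const.congr_of_eventuallyEq this
    · simp only [hlam, div_eq_mul_inv]
      exact hds.contDiffAt.mul ((ψ.smooth ⊤).contDiffAt.inv
        (norm_pos_iff.1 (hψ x (not_lt.1 h1) (not_lt.1 h2))))
  refine ⟨hθc.toSchwartzMap hθs, hlc.toSchwartzMap hls, fun x hx => hθ1 x hx.le, hl0, fun x => ?_⟩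
  change d x = lam x * ψ x
  by_cases h1 : ‖x‖ < ε
  · rw [hd0 x h1, hl0 x h1, zero_mul]
  by_cases h2 : 2 * k * ε < ‖x‖
  · simp only [hlam]; rw [hd1 x h2, zero_div, zero_mul]
  · exact (div_mul_cancel₀ _ (norm_pos_iff.1 (hψ x (not_lt.1 h1) (not_lt.1 h2)))).symm

lemma schwartz_iteratedFDeriv_bounded (Φ : SchwartzMap (Rn n) ℂ) (b : ℕ) :
    ∃ B, ∀ x, ‖iteratedFDeriv ℝ b Φ x‖ ≤ B := by
  obtain ⟨D, -, hD⟩ := schwartz_weighted_decay Φ 0 b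
  exact ⟨D, fun x => by simpa using hD x⟩

lemma enorm_fourier_dilation_le (k : ℕ) :
    ∃ k' l' : ℕ, ∃ C : ℝ, 0 ≤ C ∧ ∀ (ν μ : SchwartzMap (Rn n) ℂ) (D : ℝ) (j : ℕ), 0 ≤ D →
      (∀ i ≤ l', ∀ x, (1 + ‖x‖) ^ k' * ‖iteratedFDeriv ℝ i ν x‖ ≤ D) →
      (∀ x, μ x = ν (((2 : ℝ) ^ j)⁻¹ • x)) → ∀ x,
      ‖SchwartzMap.fourierTransformCLM ℂ μ x‖ₑ ≤ ENNReal.ofReal (C * D) * etaK j k x := by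
  obtain ⟨k', l', C, hC, h⟩ := fourier_weighted_bound (n := n) k 0
  refine ⟨k', l', C, hC, fun ν μ D j hD hν hμ x => ?_⟩
  have h1 := h ν D hD hν 0 le_rfl ((2 : ℝ) ^ j • x)
  rw [norm_iteratedFDeriv_zero, norm_smul, Real.norm_of_nonneg (by positivity)] at h1
  rw [fourier_dilation ν μ j hμ, etaK, ← ENNReal.ofReal_mul (by positivity),
    ← ofReal_norm, norm_smul, Real.norm_of_nonneg (by positivity)]
  refine ENNReal.ofReal_le_ofReal ?_
  have hp : (0 : ℝ) < (1 + 2 ^ j * ‖x‖) ^ k := by positivity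
  rw [Real.rpow_neg (by positivity), Real.rpow_natCast]
  rw [mul_comm, ← le_div_iff₀ hp] at h1
  calc (2 : ℝ) ^ (j * n) * ‖SchwartzMap.fourierTransformCLM ℂ ν ((2 : ℝ) ^ j • x)‖
      ≤ 2 ^ (j * n) * (C * D / (1 + 2 ^ j * ‖x‖) ^ k) := by gcongr
    _ = _ := by rw [div_eq_mul_inv]; ring

lemma distConv_add (Φ Ψ : SchwartzMap (Rn n) ℂ) (f : TemperedDist n) (y : Rn n) :
    distConv (Φ + Ψ) f y = distConv Φ f y + distConv Ψ f y := by
  simp only [distConv]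
  rw [reflectTranslate, map_add, map_add]; rfl

lemma distConv_fourier_add (Φ Ψ : SchwartzMap (Rn n) ℂ) (f : TemperedDist n) (y : Rn n) :
    distConv (SchwartzMap.fourierTransformCLM ℂ (Φ + Ψ)) f y =
      distConv (SchwartzMap.fourierTransformCLM ℂ Φ) f y +
      distConv (SchwartzMap.fourierTransformCLM ℂ Ψ) f y := by
  rw [map_add, distConv_add]

/-- The remainder in the telescoping Calderón decomposition tends to zero. -/
lemma tendsto_distConv_remainder (φ Θ : SchwartzMap (Rn n) ℂ) {ε : ℝ} (hε : 0 < ε)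
    (hΘ : ∀ x, ‖x‖ < ε → Θ x = 1) (R : ℕ → SchwartzMap (Rn n) ℂ)
    (hR : ∀ K x, R K x = φ x * (1 - Θ (((2 : ℝ) ^ K)⁻¹ • x))) (f : TemperedDist n) (y : Rn n) :
    Filter.Tendsto (fun K => ‖distConv (SchwartzMap.fourierTransformCLM ℂ (R K)) f y‖ₑ)
      Filter.atTop (nhds 0) := by
  obtain ⟨k, l, C, hC, hf⟩ := distConv_growth f
  obtain ⟨k', l', C', hC', hF⟩ := fourier_weighted_bound (n := n) k l
  obtain ⟨D, hD, hd⟩ := schwartz_mul_dilation_decay φ (χ := fun x => 1 - Θ x)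
    (contDiff_const.sub (Θ.smooth ⊤)) (fun b => by
      obtain ⟨B, hB⟩ := schwartz_iteratedFDeriv_bounded Θ b
      refine ⟨1 + B, fun x => ?_⟩
      have h1 : iteratedFDeriv ℝ b (fun x => 1 - Θ x) x =
          iteratedFDeriv ℝ b (fun _ : Rn n => (1 : ℂ)) x - iteratedFDeriv ℝ b Θ x :=
        iteratedFDeriv_sub_apply contDiffAt_const
          ((Θ.smooth ⊤).contDiffAt.of_le (by exact_mod_cast le_top))
      rw [h1]
      refine (norm_sub_le _ _).trans (add_le_add ?_ (hB x))
      rcases Nat.eq_zero_or_pos b with rfl | hb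
      · rw [norm_iteratedFDeriv_zero]; simp
      · rw [iteratedFDeriv_const_of_ne (by omega)]; simp)
    hε (fun x hx => by rw [hΘ x hx, sub_self]) k' l' 1
  have hb : ∀ K, ‖distConv (SchwartzMap.fourierTransformCLM ℂ (R K)) f y‖ ≤
      C * (C' * D) * (1 + ‖y‖) ^ k * (2⁻¹ : ℝ) ^ K := fun K => by
    refine (hf _ (C' * (D * ((2 : ℝ) ^ K)⁻¹)) (by positivity)
      (hF (R K) _ (by positivity) fun i hi x => ?_) y).trans_eq ?_
    · simpa using hd K (R K) (hR K) i hi x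
    · rw [inv_pow]; ring
  have hlim : Filter.Tendsto (fun K => ‖distConv (SchwartzMap.fourierTransformCLM ℂ (R K)) f y‖)
      Filter.atTop (nhds 0) := by
    refine squeeze_zero (fun _ => norm_nonneg _) hb ?_
    have := (tendsto_pow_atTop_nhds_zero_of_lt_one (r := (2⁻¹ : ℝ)) (by norm_num)
      (by norm_num)).const_mul (C * (C' * D) * (1 + ‖y‖) ^ k)
    simpa using this
  have := ENNReal.tendsto_ofReal hlim
  simpa using this

/-- Growth of `Ψ_l ∗ f` uniformly in the level `l`. -/
lemma distConv_dilation_growth (φ : SchwartzMap (Rn n) ℂ) (f : TemperedDist n) :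
    ∃ k : ℕ, ∃ C : ℝ, 0 ≤ C ∧ ∀ (l : ℕ) (ψ : SchwartzMap (Rn n) ℂ),
      (∀ x, ψ x = φ (((2 : ℝ) ^ l)⁻¹ • x)) → ∀ y,
      ‖distConv (SchwartzMap.fourierTransformCLM ℂ ψ) f y‖ ≤ C * (2 ^ l * (1 + ‖y‖)) ^ k := by
  obtain ⟨k, l, C, hC, hf⟩ := distConv_growth f
  obtain ⟨k', l', C', hC', hF⟩ := fourier_weighted_bound (n := n) k l
  choose P hP0 hP using fun a => schwartz_weighted_decay φ k' a
  set S := ∑ i ∈ Finset.range (l' + 1), P i with hS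
  have hS0 : 0 ≤ S := Finset.sum_nonneg fun i _ => hP0 i
  refine ⟨max k k', C * (C' * S), by positivity, fun m ψ hψ y => ?_⟩
  set c : ℝ := ((2 : ℝ) ^ m)⁻¹ with hc
  have hc0 : 0 < c := by positivity
  have h2m : (1 : ℝ) ≤ 2 ^ m := one_le_pow₀ (by norm_num)
  have hc1 : c ≤ 1 := inv_le_one_of_one_le₀ h2m
  have hb : ∀ i ≤ l', ∀ x, (1 + ‖x‖) ^ k' * ‖iteratedFDeriv ℝ i ψ x‖ ≤ (2 ^ m) ^ k' * S := by
    intro i hi x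
    have hψf : ⇑ψ = fun x => φ (c • x) := funext hψ
    have h1 : 1 + ‖x‖ ≤ 2 ^ m * (1 + ‖c • x‖) := by
      rw [norm_smul, Real.norm_of_nonneg hc0.le, mul_add, ← mul_assoc, hc,
        mul_inv_cancel₀ (by positivity)]
      linarith
    have h3 : |c| ^ i ≤ 1 := by rw [abs_of_pos hc0]; exact pow_le_one₀ hc0.le hc1
    rw [hψf]
    calc (1 + ‖x‖) ^ k' * ‖iteratedFDeriv ℝ i (fun x => φ (c • x)) x‖
        ≤ (2 ^ m * (1 + ‖c • x‖)) ^ k' * (1 * ‖iteratedFDeriv ℝ i φ (c • x)‖) := by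
          gcongr
          exact (norm_iteratedFDeriv_comp_smul_le (φ.smooth ⊤) c i x).trans (by gcongr)
      _ = (2 ^ m) ^ k' * ((1 + ‖c • x‖) ^ k' * ‖iteratedFDeriv ℝ i φ (c • x)‖) := by
          rw [mul_pow]; ring
      _ ≤ (2 ^ m) ^ k' * P i := by gcongr; exact hP i _
      _ ≤ (2 ^ m) ^ k' * S := by
          gcongr
          exact Finset.single_le_sum (f := P) (fun j _ => hP0 j)
            (Finset.mem_range.2 (Nat.lt_succ_iff.2 hi))
  have h1y : 1 ≤ 1 + ‖y‖ := by linarith [norm_nonneg y]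
  refine (hf _ _ (by positivity) (hF ψ _ (by positivity) hb) y).trans ?_
  calc C * (C' * ((2 ^ m) ^ k' * S)) * (1 + ‖y‖) ^ k
      = C * (C' * S) * ((2 ^ m) ^ k' * (1 + ‖y‖) ^ k) := by ring
    _ ≤ C * (C' * S) * ((2 ^ m) ^ max k k' * (1 + ‖y‖) ^ max k k') := by
        gcongr
        · exact le_max_right _ _
        · exact le_max_left _ _
    _ = _ := by rw [mul_pow]

lemma enorm_fourier_mul_dilation_le (φ Λ : SchwartzMap (Rn n) ℂ) {ε : ℝ} (hε : 0 < ε)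
    (hΛ : ∀ x, ‖x‖ < ε → Λ x = 0) (N L : ℕ) :
    ∃ C : ℝ, 0 ≤ C ∧ ∀ (j i : ℕ) (μ : SchwartzMap (Rn n) ℂ),
      (∀ ξ, μ ξ = φ (((2 : ℝ) ^ j)⁻¹ • ξ) * Λ (((2 : ℝ) ^ (j + i))⁻¹ • ξ)) → ∀ x,
      ‖SchwartzMap.fourierTransformCLM ℂ μ x‖ₑ ≤
        ENNReal.ofReal (C * (((2 : ℝ) ^ i)⁻¹) ^ N) * etaK j L x := by
  obtain ⟨k', l', C, hC, h⟩ := enorm_fourier_dilation_le (n := n) L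
  obtain ⟨D, hD, hd⟩ := schwartz_mul_dilation_decay φ (Λ.smooth ⊤)
    (schwartz_iteratedFDeriv_bounded Λ) hε hΛ k' l' N
  refine ⟨C * D, by positivity, fun j i μ hμ x => ?_⟩
  obtain ⟨Λ', hΛ'⟩ := exists_schwartz_dilation Λ (c := ((2 : ℝ) ^ i)⁻¹) (by positivity)
  obtain ⟨ν, hν⟩ := exists_schwartz_mul φ Λ'
  have := h ν μ (D * (((2 : ℝ) ^ i)⁻¹) ^ N) j (by positivity)
    (hd i ν fun x => by rw [hν, hΛ']) (fun ξ => by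
      rw [hμ, hν, hΛ', smul_smul, pow_add, mul_inv]; congr 3; ring) x
  rwa [← mul_assoc] at this

lemma enorm_fourier_dilation_le_etaK (φ : SchwartzMap (Rn n) ℂ) (L : ℕ) :
    ∃ C : ℝ, 0 ≤ C ∧ ∀ (j : ℕ) (μ : SchwartzMap (Rn n) ℂ),
      (∀ ξ, μ ξ = φ (((2 : ℝ) ^ j)⁻¹ • ξ)) → ∀ x,
      ‖SchwartzMap.fourierTransformCLM ℂ μ x‖ₑ ≤ ENNReal.ofReal C * etaK j L x := by
  obtain ⟨k', l', C, hC, h⟩ := enorm_fourier_dilation_le (n := n) L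
  choose P hP0 hP using fun a => schwartz_weighted_decay φ k' a
  refine ⟨C * ∑ i ∈ Finset.range (l' + 1), P i,
    mul_nonneg hC (Finset.sum_nonneg fun i _ => hP0 i), fun j μ hμ x => ?_⟩
  refine h φ μ _ j (Finset.sum_nonneg fun i _ => hP0 i) (fun i hi x => ?_) hμ x
  exact (hP i x).trans (Finset.single_le_sum (f := P) (fun j _ => hP0 j)
    (Finset.mem_range.2 (Nat.lt_succ_iff.2 hi)))

section Calderon

variable {ψ1 Θ Λ : SchwartzMap (Rn n) ℂ} {psis : ℕ → SchwartzMap (Rn n) ℂ}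

/-- Telescoping decomposition of `Ψ_j ∗ f`. -/
lemma distConv_telescope (hΘΛ : ∀ x, Θ ((2 : ℝ)⁻¹ • x) - Θ x = Λ x * ψ1 x)
    (hpsis : ∀ i x, psis (i + 1) x = ψ1 (((2 : ℝ) ^ i)⁻¹ • x))
    (j : ℕ) (f : TemperedDist n) (y : Rn n) (Θj : SchwartzMap (Rn n) ℂ)
    (hΘj : ∀ x, Θj x = Θ (((2 : ℝ) ^ j)⁻¹ • x)) (μ : ℕ → SchwartzMap (Rn n) ℂ)
    (hμ : ∀ i x, μ i x = psis j x * Λ (((2 : ℝ) ^ (j + i))⁻¹ • x))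
    (V : ℕ → SchwartzMap (Rn n) ℂ) (hV : ∀ K x, V K x = psis j x * Θ (((2 : ℝ) ^ (j + K))⁻¹ • x))
    (K : ℕ) :
    ‖distConv (SchwartzMap.fourierTransformCLM ℂ (V K)) f y‖ₑ ≤
      (∫⁻ z, ‖SchwartzMap.fourierTransformCLM ℂ Θj (y - z)‖ₑ *
        ‖distConv (SchwartzMap.fourierTransformCLM ℂ (psis j)) f z‖ₑ) +
      ∑ i ∈ Finset.range K, ∫⁻ z, ‖SchwartzMap.fourierTransformCLM ℂ (μ i) (y - z)‖ₑ *
        ‖distConv (SchwartzMap.fourierTransformCLM ℂ (psis (j + i + 1))) f z‖ₑ := by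
  induction K with
  | zero =>
    rw [Finset.sum_range_zero, add_zero]
    exact distConv_fourier_mul_le f Θj (psis j) (V 0)
      (fun ξ => by rw [hV, hΘj, mul_comm, add_zero]) y
  | succ K ih =>
    obtain ⟨W, hW⟩ := exists_schwartz_mul (μ K) (psis (j + K + 1))
    have hVW : V (K + 1) = V K + W := by
      ext x
      rw [_root_.add_apply, hV, hV, hW, hμ, hpsis, mul_assoc, ← hΘΛ, smul_smul, ← mul_add]
      congr 1
      rw [add_sub_cancel, ← mul_inv, ← pow_succ', add_assoc]
    rw [hVW, distConv_fourier_add, Finset.sum_range_succ, ← add_assoc]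
    refine (enorm_add_le _ _).trans (add_le_add ih ?_)
    exact distConv_fourier_mul_le f (μ K) (psis (j + K + 1)) W hW y

lemma distConv_le_tsum (φ : SchwartzMap (Rn n) ℂ)
    {ε : ℝ} (hε : 0 < ε) (hΘ : ∀ x, ‖x‖ < ε → Θ x = 1)
    (hΛ : ∀ x, ‖x‖ < ε → Λ x = 0) (hΘΛ : ∀ x, Θ ((2 : ℝ)⁻¹ • x) - Θ x = Λ x * ψ1 x)
    (hpsis : ∀ i x, psis (i + 1) x = ψ1 (((2 : ℝ) ^ i)⁻¹ • x)) (N L : ℕ) :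
    ∃ C : ℝ, 0 ≤ C ∧ ∀ (j : ℕ), (∀ x, psis j x = φ (((2 : ℝ) ^ j)⁻¹ • x)) →
      ∀ (f : TemperedDist n) (y : Rn n),
      ‖distConv (SchwartzMap.fourierTransformCLM ℂ (psis j)) f y‖ₑ ≤
        ENNReal.ofReal C * ∑' i : ℕ, ENNReal.ofReal ((((2 : ℝ) ^ i)⁻¹) ^ N) *
          ∫⁻ z, etaK j L (y - z) *
            ‖distConv (SchwartzMap.fourierTransformCLM ℂ (psis (j + i))) f z‖ₑ := by
  obtain ⟨C0, hC0, h0⟩ := enorm_fourier_dilation_le_etaK Θ L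
  obtain ⟨C1, hC1, h1⟩ := enorm_fourier_mul_dilation_le φ Λ hε hΛ N L
  refine ⟨C0 + C1 * 2 ^ N, by positivity, fun j hj f y => ?_⟩
  have h2 : ∀ i : ℕ, ((2 : ℝ) ^ i)⁻¹ ≠ 0 := fun i => by positivity
  choose Θd hΘd using fun i : ℕ => exists_schwartz_dilation Θ (h2 i)
  choose Λd hΛd using fun i : ℕ => exists_schwartz_dilation Λ (h2 i)
  choose μ hμ using fun i : ℕ => exists_schwartz_mul (psis j) (Λd (j + i))
  choose V hV using fun i : ℕ => exists_schwartz_mul (psis j) (Θd (j + i))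
  set I : ℕ → ℝ≥0∞ := fun i => ∫⁻ z, etaK j L (y - z) *
    ‖distConv (SchwartzMap.fourierTransformCLM ℂ (psis (j + i))) f z‖ₑ with hI
  have hrem : ∀ K, psis j = V K + (psis j - V K) := fun K => by abel
  have hlim := tendsto_distConv_remainder (psis j) (Θd j) (ε := 2 ^ j * ε) (by positivity)
    (fun x hx => by
      rw [hΘd]
      refine hΘ _ ?_
      rw [norm_smul, Real.norm_of_nonneg (by positivity), inv_mul_lt_iff₀ (by positivity)]
      exact hx)
    (fun K => psis j - V K) (fun K x => by
      rw [_root_.sub_apply, hV, hΘd, hΘd, smul_smul, pow_add, mul_inv]; ring) f y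
  have hT0 : (∫⁻ z, ‖SchwartzMap.fourierTransformCLM ℂ (Θd j) (y - z)‖ₑ *
        ‖distConv (SchwartzMap.fourierTransformCLM ℂ (psis j)) f z‖ₑ) ≤
        ENNReal.ofReal C0 * I 0 := by
    rw [hI, ← lintegral_const_mul' _ _ ENNReal.ofReal_ne_top]
    refine lintegral_mono fun z => ?_
    simp only
    rw [← mul_assoc]
    exact mul_le_mul_left (h0 j _ (hΘd j) _) _
  have hT : ∀ i, (∫⁻ z, ‖SchwartzMap.fourierTransformCLM ℂ (μ i) (y - z)‖ₑ *
        ‖distConv (SchwartzMap.fourierTransformCLM ℂ (psis (j + i + 1))) f z‖ₑ) ≤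
        ENNReal.ofReal (C1 * 2 ^ N) *
          (ENNReal.ofReal ((((2 : ℝ) ^ (i + 1))⁻¹) ^ N) * I (i + 1)) := fun i => by
    rw [← mul_assoc, ← ENNReal.ofReal_mul (by positivity), hI,
      ← lintegral_const_mul' _ _ ENNReal.ofReal_ne_top]
    refine lintegral_mono fun z => ?_
    simp only
    rw [← mul_assoc]
    refine mul_le_mul_left ((h1 j i (μ i) (fun ξ => by rw [hμ, hΛd, hj]) _).trans_eq ?_) _
    congr 2
    rw [mul_assoc, ← mul_pow, pow_succ]
    congr 2
    field_simp
  have hsum : (∑' i : ℕ, ENNReal.ofReal ((((2 : ℝ) ^ i)⁻¹) ^ N) * I i) =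
      I 0 + ∑' i : ℕ, ENNReal.ofReal ((((2 : ℝ) ^ (i + 1))⁻¹) ^ N) * I (i + 1) := by
    rw [tsum_eq_zero_add' ENNReal.summable]; simp
  have hbound : ∀ K, ‖distConv (SchwartzMap.fourierTransformCLM ℂ (psis j)) f y‖ₑ ≤
      ENNReal.ofReal (C0 + C1 * 2 ^ N) *
        (∑' i : ℕ, ENNReal.ofReal ((((2 : ℝ) ^ i)⁻¹) ^ N) * I i) +
      ‖distConv (SchwartzMap.fourierTransformCLM ℂ (psis j - V K)) f y‖ₑ := fun K => by
    conv_lhs => rw [hrem K]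
    rw [distConv_fourier_add]
    refine (enorm_add_le _ _).trans (add_le_add ?_ le_rfl)
    refine (distConv_telescope hΘΛ hpsis j f y (Θd j) (hΘd j) μ
      (fun i x => by rw [hμ, hΛd]) V (fun i x => by rw [hV, hΘd]) K).trans ?_
    rw [hsum, mul_add]
    refine add_le_add (hT0.trans ?_) ((Finset.sum_le_sum fun i _ => hT i).trans ?_)
    · gcongr
      exact le_add_of_nonneg_right (by positivity)
    · refine (ENNReal.sum_le_tsum _).trans ?_
      rw [ENNReal.tsum_mul_left]
      gcongr
      exact le_add_of_nonneg_left hC0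
  refine ge_of_tendsto' (x := Filter.atTop) (f := fun K => ENNReal.ofReal (C0 + C1 * 2 ^ N) *
        (∑' i : ℕ, ENNReal.ofReal ((((2 : ℝ) ^ i)⁻¹) ^ N) * I i) +
      ‖distConv (SchwartzMap.fourierTransformCLM ℂ (psis j - V K)) f y‖ₑ) ?_ hbound
  have h3 := (tendsto_const_nhds (x := ENNReal.ofReal (C0 + C1 * 2 ^ N) *
    (∑' i : ℕ, ENNReal.ofReal ((((2 : ℝ) ^ i)⁻¹) ^ N) * I i)) (f := Filter.atTop)).add hlim
  rwa [add_zero] at h3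

end Calderon

/-- The properties of the family `F j = Ψ_j ∗ f` used in the maximal function estimate. -/
lemma exists_reproducing_family (ψ0 ψ1 : SchwartzMap (Rn n) ℂ) {ε k : ℝ} (hε : 0 < ε) (hk : 1 < k)
    (hψ1 : ∀ x : Rn n, ε ≤ ‖x‖ → ‖x‖ ≤ 2 * k * ε → 0 < ‖ψ1 x‖)
    (psis : ℕ → SchwartzMap (Rn n) ℂ) (hpsis0 : psis 0 = ψ0)
    (hpsis : ∀ i x, psis (i + 1) x = ψ1 (((2 : ℝ) ^ i)⁻¹ • x)) (N L : ℕ) :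
    ∃ C : ℝ, 0 ≤ C ∧ ∀ (j : ℕ) (f : TemperedDist n) (y : Rn n),
      ‖distConv (SchwartzMap.fourierTransformCLM ℂ (psis j)) f y‖ₑ ≤
        ENNReal.ofReal C * ∑' i : ℕ, ENNReal.ofReal ((((2 : ℝ) ^ i)⁻¹) ^ N) *
          ∫⁻ z, etaK j L (y - z) *
            ‖distConv (SchwartzMap.fourierTransformCLM ℂ (psis (j + i))) f z‖ₑ := by
  obtain ⟨Θ, Λ, hΘ, hΛ, hΘΛ⟩ := exists_dyadic_cutoff ψ1 hε hk hψ1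
  obtain ⟨φ1, hφ1⟩ := exists_schwartz_dilation ψ1 (c := 2) (by norm_num)
  obtain ⟨C0, hC0, h0⟩ := distConv_le_tsum (psis := psis) ψ0 hε hΘ hΛ hΘΛ hpsis N L
  obtain ⟨C1, hC1, h1⟩ := distConv_le_tsum (psis := psis) φ1 hε hΘ hΛ hΘΛ hpsis N L
  refine ⟨C0 + C1, by positivity, fun j f y => ?_⟩
  rcases j with _ | j
  · refine (h0 0 (fun x => by rw [hpsis0]; simp) f y).trans ?_
    gcongr
    linarith
  · refine (h1 (j + 1) (fun x => ?_) f y).trans ?_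
    · rw [hpsis, hφ1, smul_smul, pow_succ, mul_inv]
      congr 2
      field_simp
    · gcongr
      linarith

lemma exists_distConv_family_growth (ψ0 ψ1 : SchwartzMap (Rn n) ℂ)
    (psis : ℕ → SchwartzMap (Rn n) ℂ) (hpsis0 : psis 0 = ψ0)
    (hpsis : ∀ i x, psis (i + 1) x = ψ1 (((2 : ℝ) ^ i)⁻¹ • x)) (f : TemperedDist n) :
    ∃ k : ℕ, ∃ C : ℝ, 0 ≤ C ∧ ∀ (l : ℕ) (y : Rn n),
      ‖distConv (SchwartzMap.fourierTransformCLM ℂ (psis l)) f y‖ ≤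
        C * (2 ^ l * (1 + ‖y‖)) ^ k := by
  obtain ⟨φ1, hφ1⟩ := exists_schwartz_dilation ψ1 (c := 2) (by norm_num)
  obtain ⟨k0, C0, hC0, h0⟩ := distConv_dilation_growth ψ0 f
  obtain ⟨k1, C1, hC1, h1⟩ := distConv_dilation_growth φ1 f
  have hb : ∀ (l : ℕ) (y : Rn n), 1 ≤ (2 : ℝ) ^ l * (1 + ‖y‖) := fun l y =>
    one_le_mul_of_one_le_of_one_le (one_le_pow₀ (by norm_num)) (by linarith [norm_nonneg y])
  refine ⟨max k0 k1, C0 + C1, by positivity, fun l y => ?_⟩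
  rcases l with _ | l
  · refine (h0 0 _ (fun x => by rw [hpsis0]; simp) y).trans ?_
    have := hb 0 y
    gcongr
    · linarith
    · exact le_max_left _ _
  · refine (h1 (l + 1) _ (fun x => ?_) y).trans ?_
    · rw [hpsis, hφ1, smul_smul, pow_succ, mul_inv]
      congr 2
      field_simp
    · have := hb (l + 1) y
      gcongr
      · linarith
      · exact le_max_right _ _

/-- The bracket `1 + 2^j |x - y|`. -/
def dyBr (j : ℕ) (x y : Rn n) : ℝ≥0∞ := ENNReal.ofReal (1 + 2 ^ j * ‖x - y‖)

lemma one_le_dyBr (j : ℕ) (x y : Rn n) : 1 ≤ dyBr j x y := by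
  rw [dyBr, ENNReal.one_le_ofReal]
  have : 0 ≤ (2 : ℝ) ^ j * ‖x - y‖ := by positivity
  linarith

lemma dyBr_ne_top (j : ℕ) (x y : Rn n) : dyBr j x y ≠ ∞ := ENNReal.ofReal_ne_top

lemma dyBr_ne_zero (j : ℕ) (x y : Rn n) : dyBr j x y ≠ 0 :=
  (zero_lt_one.trans_le (one_le_dyBr j x y)).ne'

lemma dyBr_le_mul (j : ℕ) (x y z : Rn n) : dyBr j x z ≤ dyBr j x y * dyBr j y z := by
  rw [dyBr, dyBr, dyBr, ← ENNReal.ofReal_mul (by positivity)]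
  refine ENNReal.ofReal_le_ofReal ?_
  have h1 : ‖x - z‖ ≤ ‖x - y‖ + ‖y - z‖ := norm_sub_le_norm_sub_add_norm_sub x y z
  have h2 : (0 : ℝ) ≤ 2 ^ j * ‖x - y‖ := by positivity
  have h3 : (0 : ℝ) ≤ 2 ^ j * ‖y - z‖ := by positivity
  have h4 : (2 : ℝ) ^ j * ‖x - z‖ ≤ 2 ^ j * (‖x - y‖ + ‖y - z‖) := by gcongr
  nlinarith [mul_nonneg h2 h3]

lemma dyBr_mono (j i : ℕ) (x y : Rn n) : dyBr j x y ≤ dyBr (j + i) x y := by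
  rw [dyBr, dyBr]
  refine ENNReal.ofReal_le_ofReal ?_
  gcongr
  · norm_num
  · omega

lemma measurable_dyBr (j : ℕ) (x : Rn n) : Measurable (fun z => dyBr j x z) := by
  unfold dyBr
  fun_prop

lemma dyBr_rpow_neg_anti (j : ℕ) (x y : Rn n) {s t : ℝ} (h : s ≤ t) :
    dyBr j x y ^ (-t) ≤ dyBr j x y ^ (-s) :=
  ENNReal.rpow_le_rpow_of_exponent_le (one_le_dyBr j x y) (by linarith)

lemma rpow_neg_le_rpow_neg {a b : ℝ≥0∞} (h : a ≤ b) {t : ℝ} (ht : 0 ≤ t) :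
    b ^ (-t) ≤ a ^ (-t) := by
  rw [ENNReal.rpow_neg, ENNReal.rpow_neg]
  exact ENNReal.inv_le_inv.2 (ENNReal.rpow_le_rpow h ht)

lemma dyBr_rpow_neg_mul_le (j : ℕ) (x y z : Rn n) {t : ℝ} (ht : 0 ≤ t) :
    dyBr j x y ^ (-t) * dyBr j y z ^ (-t) ≤ dyBr j x z ^ (-t) := by
  rw [← ENNReal.mul_rpow_of_ne_zero (dyBr_ne_zero _ _ _) (dyBr_ne_zero _ _ _)]
  exact rpow_neg_le_rpow_neg (dyBr_le_mul j x y z) ht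

lemma two_rpow_add (s t : ℝ) : (2 : ℝ≥0∞) ^ (s + t) = 2 ^ s * 2 ^ t :=
  ENNReal.rpow_add s t two_ne_zero ENNReal.ofNat_ne_top

lemma two_rpow_ne_top (s : ℝ) : (2 : ℝ≥0∞) ^ s ≠ ∞ :=
  ENNReal.rpow_ne_top_of_ne_zero two_ne_zero ENNReal.ofNat_ne_top

lemma two_rpow_mono {s t : ℝ} (h : s ≤ t) : (2 : ℝ≥0∞) ^ s ≤ 2 ^ t :=
  ENNReal.rpow_le_rpow_of_exponent_le one_le_two h

lemma ofReal_two_rpow (s : ℝ) : ENNReal.ofReal ((2 : ℝ) ^ s) = (2 : ℝ≥0∞) ^ s := by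
  rw [← ENNReal.ofReal_rpow_of_pos two_pos, ENNReal.ofReal_ofNat]

lemma etaK_eq (j : ℕ) (m : ℝ) (x y : Rn n) :
    etaK j m (x - y) = 2 ^ ((j : ℝ) * n) * dyBr j x y ^ (-m) := by
  have : (0 : ℝ) < 1 + 2 ^ j * ‖x - y‖ := by positivity
  rw [etaK, dyBr, ENNReal.ofReal_mul (by positivity), ENNReal.ofReal_rpow_of_pos this,
    ← ofReal_two_rpow, ← Nat.cast_mul, Real.rpow_natCast]

/-- `∑_K 2^{-Ks} ∫ 2^{jn} (1 + 2^j|x-z|)^{-t} F_{j+K}(z) dz`. -/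
def levelSum (F : ℕ → Rn n → ℝ≥0∞) (s t : ℝ) (j : ℕ) (x : Rn n) : ℝ≥0∞ :=
  ∑' K : ℕ, (2 : ℝ≥0∞) ^ (-((K : ℝ) * s)) *
    ∫⁻ z, (2 : ℝ≥0∞) ^ ((j : ℝ) * n) * dyBr j x z ^ (-t) * F (j + K) z

lemma levelSum_anti (F : ℕ → Rn n → ℝ≥0∞) {s s' t t' : ℝ} (hs : s ≤ s') (ht : t ≤ t')
    (j : ℕ) (x : Rn n) : levelSum F s' t' j x ≤ levelSum F s t j x := by
  refine ENNReal.tsum_le_tsum fun K => mul_le_mul' (two_rpow_mono ?_) (lintegral_mono fun z => ?_)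
  · have : (0 : ℝ) ≤ K := Nat.cast_nonneg K
    nlinarith
  · exact mul_le_mul_left (mul_le_mul_right (dyBr_rpow_neg_anti j x z ht) _) _

lemma tsum_add_left_le (g : ℕ → ℝ≥0∞) (k : ℕ) : ∑' i, g (k + i) ≤ ∑' i, g i :=
  ENNReal.tsum_comp_le_tsum_of_injective (add_right_injective k) g

/-- Change of the base point and the base level. -/
lemma levelSum_shift_le (F : ℕ → Rn n → ℝ≥0∞) (s : ℝ) {t : ℝ} (ht : 0 ≤ t)
    (j k : ℕ) (x y : Rn n) :
    (2 : ℝ≥0∞) ^ (-((k : ℝ) * (s + n))) * dyBr j x y ^ (-t) * levelSum F s t (j + k) y ≤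
      levelSum F s t j x := by
  have hc : (2 : ℝ≥0∞) ^ (-((k : ℝ) * (s + n))) * dyBr j x y ^ (-t) ≠ ∞ :=
    ENNReal.mul_ne_top (two_rpow_ne_top _)
      (ENNReal.rpow_ne_top_of_ne_zero (dyBr_ne_zero _ _ _) (dyBr_ne_top _ _ _))
  rw [levelSum, ← ENNReal.tsum_mul_left]
  refine le_trans (ENNReal.tsum_le_tsum fun K => ?_) (tsum_add_left_le (fun K =>
    (2 : ℝ≥0∞) ^ (-((K : ℝ) * s)) *
    ∫⁻ z, (2 : ℝ≥0∞) ^ ((j : ℝ) * n) * dyBr j x z ^ (-t) * F (j + K) z) k)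
  rw [mul_left_comm, ← lintegral_const_mul' _ _ hc, ← lintegral_const_mul' _ _ (two_rpow_ne_top _),
    ← lintegral_const_mul' _ _ (two_rpow_ne_top _)]
  refine lintegral_mono fun z => ?_
  have h1 : dyBr j x y ^ (-t) * dyBr (j + k) y z ^ (-t) ≤ dyBr j x z ^ (-t) :=
    (mul_le_mul_right (rpow_neg_le_rpow_neg (dyBr_mono j k y z) ht) _).trans
      (dyBr_rpow_neg_mul_le j x y z ht)
  have h2 : (2 : ℝ≥0∞) ^ (-((K : ℝ) * s)) * (2 ^ (-((k : ℝ) * (s + n))) *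
      2 ^ (((j + k : ℕ) : ℝ) * n)) = 2 ^ (-(((k + K : ℕ) : ℝ) * s)) * 2 ^ ((j : ℝ) * n) := by
    rw [← two_rpow_add, ← two_rpow_add, ← two_rpow_add]
    congr 1; push_cast; ring
  calc _ = ((2 : ℝ≥0∞) ^ (-((K : ℝ) * s)) * (2 ^ (-((k : ℝ) * (s + n))) *
      2 ^ (((j + k : ℕ) : ℝ) * n))) * (dyBr j x y ^ (-t) * dyBr (j + k) y z ^ (-t)) *
      F (j + k + K) z := by ring
    _ ≤ ((2 : ℝ≥0∞) ^ (-((K : ℝ) * s)) * (2 ^ (-((k : ℝ) * (s + n))) *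
      2 ^ (((j + k : ℕ) : ℝ) * n))) * dyBr j x z ^ (-t) * F (j + k + K) z := by gcongr
    _ = _ := by rw [h2, add_assoc]; ring

/-- Jensen's inequality. -/
lemma lintegral_mul_rpow_le {X : Type*} [MeasurableSpace X] (μ : Measure X) {w f : X → ℝ≥0∞}
    (hw : AEMeasurable w μ) (hf : AEMeasurable f μ) {r : ℝ} (hr : 1 ≤ r) :
    (∫⁻ x, w x * f x ∂μ) ^ r ≤ (∫⁻ x, w x ∂μ) ^ (r - 1) * ∫⁻ x, w x * f x ^ r ∂μ := by
  rcases hr.eq_or_lt with rfl | hr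
  · simp
  have hr0 : 0 < r := by linarith
  have hpq : r.HolderConjugate (r / (r - 1)) := Real.HolderConjugate.conjExponent hr
  have hd : 0 < r - 1 := by linarith
  have h := ENNReal.lintegral_mul_le_Lp_mul_Lq μ hpq (f := fun x => w x ^ (1 / r) * f x)
    (g := fun x => w x ^ ((r - 1) / r)) ((hw.pow_const _).mul hf) (hw.pow_const _)
  have h1 : ∀ x, w x ^ (1 / r) * f x * w x ^ ((r - 1) / r) = w x * f x := fun x => by
    rw [mul_right_comm, ← ENNReal.rpow_add_of_nonneg _ _ (by positivity) (by positivity)]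
    rw [← add_div, add_sub_cancel, div_self hr0.ne', ENNReal.rpow_one]
  have h2 : ∀ x, (w x ^ (1 / r) * f x) ^ r = w x * f x ^ r := fun x => by
    rw [ENNReal.mul_rpow_of_nonneg _ _ hr0.le, ← ENNReal.rpow_mul, one_div,
      inv_mul_cancel₀ hr0.ne', ENNReal.rpow_one]
  have h3 : ∀ x, (w x ^ ((r - 1) / r)) ^ (r / (r - 1)) = w x := fun x => by
    rw [← ENNReal.rpow_mul, div_mul_div_cancel₀ hr0.ne', div_self hd.ne', ENNReal.rpow_one]
  simp only [Pi.mul_apply, h1, h2, h3] at h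
  calc (∫⁻ x, w x * f x ∂μ) ^ r
      ≤ ((∫⁻ x, w x * f x ^ r ∂μ) ^ (1 / r) * (∫⁻ x, w x ∂μ) ^ (1 / (r / (r - 1)))) ^ r :=
        ENNReal.rpow_le_rpow h hr0.le
    _ = _ := by
        rw [ENNReal.mul_rpow_of_nonneg _ _ hr0.le, ← ENNReal.rpow_mul, ← ENNReal.rpow_mul,
          one_div_mul_cancel hr0.ne', ENNReal.rpow_one, mul_comm, one_div_div,
          div_mul_cancel₀ _ hr0.ne']

lemma tsum_mul_rpow_le (w f : ℕ → ℝ≥0∞) {r : ℝ} (hr : 1 ≤ r) :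
    (∑' i, w i * f i) ^ r ≤ (∑' i, w i) ^ (r - 1) * ∑' i, w i * f i ^ r := by
  have := lintegral_mul_rpow_le Measure.count (w := w) (f := f)
    (measurable_of_countable _).aemeasurable (measurable_of_countable _).aemeasurable hr
  simpa only [lintegral_count] using this

lemma lintegral_dyBr_rpow_lt_top {t : ℝ} (ht : n < t) (x : Rn n) :
    ∫⁻ z, dyBr 0 x z ^ (-t) < ∞ := by
  have h := finite_integral_one_add_norm (E := Rn n) (μ := volume) (r := t) (by simpa using ht)
  refine lt_of_eq_of_lt ?_ h
  rw [← lintegral_sub_left_eq_self _ x]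
  refine lintegral_congr fun z => ?_
  rw [dyBr, ENNReal.ofReal_rpow_of_pos (by positivity)]
  simp

lemma lintegral_comp_dilation (f : Rn n → ℝ≥0∞) (hf : Measurable f) (j : ℕ) :
    (2 : ℝ≥0∞) ^ ((j : ℝ) * n) * ∫⁻ z, f ((2 : ℝ) ^ j • z) = ∫⁻ z, f z := by
  have h := Measure.map_addHaar_smul (volume : Measure (Rn n)) (r := (2 : ℝ) ^ j) (by positivity)
  have h2 : ∫⁻ z, f ((2 : ℝ) ^ j • z) = ∫⁻ z, f z ∂(Measure.map (((2 : ℝ) ^ j) • ·) volume) := by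
    rw [lintegral_map hf (by fun_prop)]
  rw [h2, h, lintegral_smul_measure, smul_eq_mul, ← mul_assoc, finrank_euclideanSpace_fin,
    abs_of_pos (by positivity), ← ofReal_two_rpow, ← ENNReal.ofReal_mul (by positivity),
    ← Nat.cast_mul, Real.rpow_natCast, pow_mul, mul_inv_cancel₀ (by positivity), ENNReal.ofReal_one,
    one_mul]

lemma lintegral_dyBr_eq (t : ℝ) (j : ℕ) (x : Rn n) :
    ∫⁻ z, (2 : ℝ≥0∞) ^ ((j : ℝ) * n) * dyBr j x z ^ (-t) = ∫⁻ z, dyBr 0 (0 : Rn n) z ^ (-t) := by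
  rw [lintegral_const_mul' _ _ (two_rpow_ne_top _),
    ← lintegral_comp_dilation _ ((measurable_dyBr 0 0).pow_const _) j,
    ← lintegral_sub_left_eq_self _ x]
  congr 1
  refine lintegral_congr fun z => ?_
  rw [dyBr, dyBr, zero_sub, norm_neg, norm_smul, Real.norm_of_nonneg (by positivity)]
  simp

/-- A family reproduced by rapidly decaying averages over higher levels. -/
def Reproducing (A : ℕ → ℕ → ℝ≥0∞) (F : ℕ → Rn n → ℝ≥0∞) : Prop :=
  ∀ (N L : ℕ) (j : ℕ) (y : Rn n), F j y ≤ A N L * levelSum F N L j y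

/-- Polynomial growth of a family of functions. -/
def PolyGrowth (F : ℕ → Rn n → ℝ≥0∞) : Prop :=
  ∃ (k : ℕ) (C : ℝ≥0∞), C ≠ ∞ ∧ ∀ (l : ℕ) (y : Rn n), F l y ≤ C * (2 ^ l * dyBr 0 0 y) ^ k

lemma tsum_two_rpow_ne_top {s : ℝ} (hs : 0 < s) : ∑' i : ℕ, (2 : ℝ≥0∞) ^ (-((i : ℝ) * s)) ≠ ∞ := by
  have h1 : ∀ i : ℕ, (2 : ℝ≥0∞) ^ (-((i : ℝ) * s)) = ((2 : ℝ≥0∞) ^ (-s)) ^ i := fun i => by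
    rw [← ENNReal.rpow_natCast, ← ENNReal.rpow_mul]; congr 1; ring
  simp_rw [h1]
  rw [ENNReal.tsum_geometric]
  have h2 : (2 : ℝ≥0∞) ^ (-s) < 1 := ENNReal.rpow_lt_one_of_one_lt_of_neg one_lt_two (by linarith)
  exact ENNReal.inv_ne_top.2 (tsub_pos_of_lt h2).ne'

lemma reproducing_rpow_of_one_le {A : ℕ → ℕ → ℝ≥0∞} (hA : ∀ N L, A N L ≠ ∞) {r : ℝ} (hr : 1 ≤ r)
    (s t : ℝ) : ∃ C : ℝ≥0∞, C ≠ ∞ ∧ ∀ F : ℕ → Rn n → ℝ≥0∞, (∀ j, Measurable (F j)) →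
      Reproducing A F → ∀ j y, F j y ^ r ≤ C * levelSum (fun l z => F l z ^ r) s t j y := by
  obtain ⟨N, hN⟩ := exists_nat_ge (max s 1)
  obtain ⟨L, hL⟩ := exists_nat_ge (max t (n + 1))
  have hN0 : (0 : ℝ) < N := by linarith [le_max_right s 1]
  have hLn : (n : ℝ) < L := by linarith [le_max_right t ((n : ℝ) + 1)]
  have hr0 : 0 ≤ r := by linarith
  set S : ℝ≥0∞ := ∑' i : ℕ, (2 : ℝ≥0∞) ^ (-((i : ℝ) * N)) with hS
  have hSt : S ≠ ∞ := tsum_two_rpow_ne_top hN0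
  set I : ℝ≥0∞ := ∫⁻ z, dyBr 0 (0 : Rn n) z ^ (-(L : ℝ)) with hI
  have hIt : I ≠ ∞ := (lintegral_dyBr_rpow_lt_top hLn 0).ne
  refine ⟨A N L ^ r * (S ^ (r - 1) * I ^ (r - 1)), ENNReal.mul_ne_top
    (ENNReal.rpow_ne_top_of_nonneg hr0 (hA N L)) (ENNReal.mul_ne_top
      (ENNReal.rpow_ne_top_of_nonneg (by linarith) hSt)
      (ENNReal.rpow_ne_top_of_nonneg (by linarith) hIt)), fun F hF h j y => ?_⟩
  refine (ENNReal.rpow_le_rpow (h N L j y) hr0).trans ?_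
  rw [ENNReal.mul_rpow_of_nonneg _ _ hr0, mul_assoc]
  refine mul_le_mul_right ?_ _
  refine (tsum_mul_rpow_le _ _ hr).trans ?_
  rw [mul_assoc]
  refine mul_le_mul_right ?_ _
  refine le_trans ?_ (mul_le_mul_right (levelSum_anti _ ((le_max_left _ _).trans hN)
    ((le_max_left _ _).trans hL) j y) _)
  rw [levelSum, ← ENNReal.tsum_mul_left]
  refine ENNReal.tsum_le_tsum fun i => ?_
  rw [mul_left_comm]
  refine mul_le_mul_right ?_ _
  have := lintegral_mul_rpow_le volume (w := fun z => (2 : ℝ≥0∞) ^ ((j : ℝ) * n) *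
    dyBr j y z ^ (-(L : ℝ))) (f := F (j + i))
    ((measurable_const.mul ((measurable_dyBr j y).pow_const _)).aemeasurable)
    (hF (j + i)).aemeasurable hr
  rwa [lintegral_dyBr_eq] at this

/-- The two-parameter maximal function used for exponents below one. -/
def levelSup (F : ℕ → Rn n → ℝ≥0∞) (N b : ℝ) (j : ℕ) (x : Rn n) : ℝ≥0∞ :=
  ⨆ (k : ℕ) (y : Rn n), (2 : ℝ≥0∞) ^ (-((k : ℝ) * N)) * (F (j + k) y * dyBr j x y ^ (-b))

lemma le_levelSup (F : ℕ → Rn n → ℝ≥0∞) (N b : ℝ) (j k : ℕ) (x y : Rn n) :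
    F (j + k) y ≤ levelSup F N b j x * (2 ^ ((k : ℝ) * N) * dyBr j x y ^ b) := by
  have h1 : (2 : ℝ≥0∞) ^ (-((k : ℝ) * N)) * (F (j + k) y * dyBr j x y ^ (-b)) ≤
      levelSup F N b j x := le_iSup₂ (f := fun (k : ℕ) (y : Rn n) =>
      (2 : ℝ≥0∞) ^ (-((k : ℝ) * N)) * (F (j + k) y * dyBr j x y ^ (-b))) k y
  refine le_trans (le_of_eq ?_) (mul_le_mul_left h1 _)
  have h2 : (2 : ℝ≥0∞) ^ (-((k : ℝ) * N)) * 2 ^ ((k : ℝ) * N) = 1 := by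
    rw [← two_rpow_add]; simp
  have h3 : dyBr j x y ^ (-b) * dyBr j x y ^ b = 1 := by
    rw [← ENNReal.rpow_add _ _ (dyBr_ne_zero _ _ _) (dyBr_ne_top _ _ _)]; simp
  calc F (j + k) y = F (j + k) y * (((2 : ℝ≥0∞) ^ (-((k : ℝ) * N)) * 2 ^ ((k : ℝ) * N)) *
      (dyBr j x y ^ (-b) * dyBr j x y ^ b)) := by rw [h2, h3]; simp
    _ = _ := by ring

lemma levelSup_le {A : ℕ → ℕ → ℝ≥0∞} {F : ℕ → Rn n → ℝ≥0∞} (hF : Reproducing A F) {r : ℝ}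
    (hr0 : 0 < r) (hr1 : r < 1) (N L : ℕ) {b : ℝ} (hb0 : 0 ≤ b) (hb : b ≤ L) (j : ℕ) (x : Rn n)
    (hM : levelSup F N b j x ≠ ∞) :
    levelSup F N b j x ≤ A N L * (levelSup F N b j x ^ (1 - r) *
      levelSum (fun l z => F l z ^ r) (N * r - n) (b * r) j x) := by
  set M := levelSup F N b j x with hMdef
  have hMr : M ^ (1 - r) ≠ ∞ := ENNReal.rpow_ne_top_of_nonneg (by linarith) hM
  refine iSup₂_le fun k y => ?_
  have hJ : dyBr j x y ^ (-b) ≠ ∞ :=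
    ENNReal.rpow_ne_top_of_ne_zero (dyBr_ne_zero _ _ _) (dyBr_ne_top _ _ _)
  have hc : (2 : ℝ≥0∞) ^ (-((k : ℝ) * N)) * dyBr j x y ^ (-b) ≠ ∞ :=
    ENNReal.mul_ne_top (two_rpow_ne_top _) hJ
  calc (2 : ℝ≥0∞) ^ (-((k : ℝ) * N)) * (F (j + k) y * dyBr j x y ^ (-b))
      ≤ (2 : ℝ≥0∞) ^ (-((k : ℝ) * N)) * ((A N L * levelSum F N L (j + k) y) *
          dyBr j x y ^ (-b)) := by gcongr; exact hF N L (j + k) y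
    _ = A N L * (((2 : ℝ≥0∞) ^ (-((k : ℝ) * N)) * dyBr j x y ^ (-b)) *
          levelSum F N L (j + k) y) := by ring
    _ ≤ _ := ?_
  refine mul_le_mul_right ?_ _
  rw [levelSum, levelSum, ← ENNReal.tsum_mul_left, ← ENNReal.tsum_mul_left]
  refine le_trans (ENNReal.tsum_le_tsum fun i => ?_) (tsum_add_left_le (fun K =>
    M ^ (1 - r) * ((2 : ℝ≥0∞) ^ (-((K : ℝ) * (N * r - n))) *
    ∫⁻ z, (2 : ℝ≥0∞) ^ ((j : ℝ) * n) * dyBr j x z ^ (-(b * r)) * F (j + K) z ^ r)) k)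
  rw [← lintegral_const_mul' _ _ (two_rpow_ne_top _),
    ← lintegral_const_mul' _ _ (two_rpow_ne_top _), ← lintegral_const_mul' _ _ hc,
    ← lintegral_const_mul' _ _ hMr]
  refine lintegral_mono fun z => ?_
  have h1 : F (j + (k + i)) z ≤ F (j + (k + i)) z ^ r *
      (M ^ (1 - r) * (2 ^ (((k + i : ℕ) : ℝ) * N * (1 - r)) * dyBr j x z ^ (b * (1 - r)))) := by
    calc F (j + (k + i)) z = F (j + (k + i)) z ^ r * F (j + (k + i)) z ^ (1 - r) := by
          rw [← ENNReal.rpow_add_of_nonneg _ _ hr0.le (by linarith)]; simp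
      _ ≤ F (j + (k + i)) z ^ r * (M * (2 ^ (((k + i : ℕ) : ℝ) * N) * dyBr j x z ^ b)) ^ (1 - r) := by
          gcongr
          exact le_levelSup F N b j (k + i) x z
      _ = _ := by
          rw [ENNReal.mul_rpow_of_nonneg _ _ (by linarith),
            ENNReal.mul_rpow_of_nonneg _ _ (by linarith), ← ENNReal.rpow_mul, ← ENNReal.rpow_mul]
  have h2 : dyBr j x y ^ (-b) * dyBr (j + k) y z ^ (-(L : ℝ)) ≤ dyBr j x z ^ (-b) := by
    refine (mul_le_mul_right ((dyBr_rpow_neg_anti _ _ _ hb).trans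
      (rpow_neg_le_rpow_neg (dyBr_mono j k y z) hb0)) _).trans
      (dyBr_rpow_neg_mul_le j x y z hb0)
  have h3 : dyBr j x z ^ (-b) * dyBr j x z ^ (b * (1 - r)) = dyBr j x z ^ (-(b * r)) := by
    rw [← ENNReal.rpow_add _ _ (dyBr_ne_zero _ _ _) (dyBr_ne_top _ _ _)]; congr 1; ring
  have h4 : (2 : ℝ≥0∞) ^ (-((k : ℝ) * N)) * (2 ^ (-((i : ℝ) * N)) * (2 ^ (((j + k : ℕ) : ℝ) * n) *
      2 ^ (((k + i : ℕ) : ℝ) * N * (1 - r)))) ≤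
      2 ^ (-(((k + i : ℕ) : ℝ) * (N * r - n))) * 2 ^ ((j : ℝ) * n) := by
    rw [← two_rpow_add, ← two_rpow_add, ← two_rpow_add, ← two_rpow_add]
    refine two_rpow_mono ?_
    push_cast
    have : (0 : ℝ) ≤ i * n := by positivity
    nlinarith
  simp only
  rw [add_assoc]
  calc _ ≤ ((2 : ℝ≥0∞) ^ (-((k : ℝ) * N)) * dyBr j x y ^ (-b)) * (2 ^ (-((i : ℝ) * N)) *
        (2 ^ (((j + k : ℕ) : ℝ) * n) * dyBr (j + k) y z ^ (-(L : ℝ)) * (F (j + (k + i)) z ^ r *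
        (M ^ (1 - r) * (2 ^ (((k + i : ℕ) : ℝ) * N * (1 - r)) *
          dyBr j x z ^ (b * (1 - r))))))) := by gcongr
    _ = ((2 : ℝ≥0∞) ^ (-((k : ℝ) * N)) * (2 ^ (-((i : ℝ) * N)) * (2 ^ (((j + k : ℕ) : ℝ) * n) *
      2 ^ (((k + i : ℕ) : ℝ) * N * (1 - r))))) * ((dyBr j x y ^ (-b) *
        dyBr (j + k) y z ^ (-(L : ℝ))) * dyBr j x z ^ (b * (1 - r))) *
        (M ^ (1 - r) * F (j + (k + i)) z ^ r) := by ring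
    _ ≤ (2 ^ (-(((k + i : ℕ) : ℝ) * (N * r - n))) * 2 ^ ((j : ℝ) * n)) *
        (dyBr j x z ^ (-b) * dyBr j x z ^ (b * (1 - r))) *
        (M ^ (1 - r) * F (j + (k + i)) z ^ r) := by gcongr
    _ = _ := by rw [h3]; ring

lemma levelSup_rpow_le {A : ℕ → ℕ → ℝ≥0∞} {F : ℕ → Rn n → ℝ≥0∞} (hF : Reproducing A F) {r : ℝ}
    (hr0 : 0 < r) (hr1 : r < 1) (N L : ℕ) {b : ℝ} (hb0 : 0 ≤ b) (hb : b ≤ L) (j : ℕ) (x : Rn n)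
    (hM : levelSup F N b j x ≠ ∞) :
    levelSup F N b j x ^ r ≤ A N L *
      levelSum (fun l z => F l z ^ r) (N * r - n) (b * r) j x := by
  have h := levelSup_le hF hr0 hr1 N L hb0 hb j x hM
  set M := levelSup F N b j x
  rcases eq_or_ne M 0 with h0 | h0
  · rw [h0, ENNReal.zero_rpow_of_pos hr0]; exact zero_le
  have h1 : M ^ (1 - r) ≠ 0 := (ENNReal.rpow_pos (pos_iff_ne_zero.2 h0) hM).ne'
  have h2 : M ^ (1 - r) ≠ ∞ := ENNReal.rpow_ne_top_of_nonneg (by linarith) hM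
  have h3 : M = M ^ (1 - r) * M ^ r := by
    rw [← ENNReal.rpow_add _ _ h0 hM]; simp
  rw [mul_left_comm] at h
  conv_lhs at h => rw [h3]
  exact (ENNReal.mul_le_mul_iff_right h1 h2).1 h

lemma levelSup_ne_top {F : ℕ → Rn n → ℝ≥0∞} {k : ℕ} {C : ℝ≥0∞} (hC : C ≠ ∞)
    (hF : ∀ (l : ℕ) (y : Rn n), F l y ≤ C * (2 ^ l * dyBr 0 0 y) ^ k) {N b : ℝ} (hN : k ≤ N)
    (hb : k ≤ b) (j : ℕ) (x : Rn n) : levelSup F N b j x ≠ ∞ := by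
  have hfin : C * (2 ^ j * dyBr 0 0 x) ^ k ≠ ∞ := ENNReal.mul_ne_top hC (ENNReal.pow_ne_top
    (ENNReal.mul_ne_top (ENNReal.pow_ne_top ENNReal.ofNat_ne_top) (dyBr_ne_top _ _ _)))
  refine ne_top_of_le_ne_top hfin (iSup₂_le fun l y => ?_)
  have h1 : dyBr 0 0 y ≤ dyBr 0 0 x * dyBr j x y := by
    refine (dyBr_le_mul 0 0 x y).trans (mul_le_mul_right ?_ _)
    simpa using dyBr_mono 0 j x y
  have h2 : (2 : ℝ≥0∞) ^ (-((l : ℝ) * N)) * (2 ^ l) ^ k ≤ 1 := by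
    rw [← pow_mul, ← ENNReal.rpow_natCast, ← two_rpow_add]
    refine (two_rpow_mono (t := 0) ?_).trans_eq (by simp)
    push_cast
    have : (0 : ℝ) ≤ l := Nat.cast_nonneg l
    nlinarith
  have h3 : dyBr j x y ^ (-b) * dyBr j x y ^ k ≤ 1 := by
    rw [← ENNReal.rpow_natCast, ← ENNReal.rpow_add _ _ (dyBr_ne_zero _ _ _) (dyBr_ne_top _ _ _)]
    refine (ENNReal.rpow_le_rpow_of_exponent_le (one_le_dyBr j x y) (z := 0) (by linarith)).trans_eq
      (by simp)
  calc (2 : ℝ≥0∞) ^ (-((l : ℝ) * N)) * (F (j + l) y * dyBr j x y ^ (-b))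
      ≤ (2 : ℝ≥0∞) ^ (-((l : ℝ) * N)) * ((C * (2 ^ (j + l) * (dyBr 0 0 x * dyBr j x y)) ^ k) *
        dyBr j x y ^ (-b)) := by
        gcongr
        refine (hF (j + l) y).trans ?_
        gcongr
    _ = C * (2 ^ j * dyBr 0 0 x) ^ k * ((2 : ℝ≥0∞) ^ (-((l : ℝ) * N)) * (2 ^ l) ^ k) *
        (dyBr j x y ^ (-b) * dyBr j x y ^ k) := by
        rw [pow_add, mul_pow, mul_pow, mul_pow, mul_pow]; ring
    _ ≤ C * (2 ^ j * dyBr 0 0 x) ^ k * 1 * 1 := by gcongr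
    _ = _ := by rw [mul_one, mul_one]

lemma levelSup_ne_top_of_levelSum {A : ℕ → ℕ → ℝ≥0∞} (hA : ∀ N L, A N L ≠ ∞)
    {F : ℕ → Rn n → ℝ≥0∞} (hF : Reproducing A F) (hg : PolyGrowth F) {r : ℝ}
    (hr0 : 0 < r) (hr1 : r < 1) (N : ℕ) {b : ℝ} (hb0 : 0 ≤ b) (j : ℕ) (x : Rn n)
    (hR : levelSum (fun l z => F l z ^ r) (N * r - n) (b * r) j x ≠ ∞) :
    levelSup F N b j x ≠ ∞ := by
  obtain ⟨k, C, hC, hk⟩ := hg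
  obtain ⟨L, hL⟩ := exists_nat_ge (max b k)
  have hNk : (k : ℝ) ≤ (max N k : ℕ) := by exact_mod_cast le_max_right N k
  have hNN : (N : ℝ) ≤ (max N k : ℕ) := by exact_mod_cast le_max_left N k
  have hbL : b ≤ L := (le_max_left _ _).trans hL
  have hpt : ∀ l y, F l y ^ r ≤ A (max N k) L *
      levelSum (fun l z => F l z ^ r) (N * r - n) (b * r) l y := by
    intro l y
    have h1 := levelSup_rpow_le hF hr0 hr1 (max N k) L (b := L) (by positivity) le_rfl l y
      (levelSup_ne_top hC hk hNk ((le_max_right _ _).trans hL) l y)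
    have h2 := le_levelSup F (max N k : ℕ) L l 0 y y
    have h3 : F l y ≤ levelSup F (max N k : ℕ) L l y := by simpa [dyBr] using h2
    refine (ENNReal.rpow_le_rpow h3 hr0.le).trans (h1.trans (mul_le_mul_right ?_ _))
    exact levelSum_anti _ (by nlinarith) (by nlinarith) l y
  suffices h : levelSup F N b j x ^ r ≤ A (max N k) L *
      levelSum (fun l z => F l z ^ r) (N * r - n) (b * r) j x by
    intro ht
    rw [ht, ENNReal.top_rpow_of_pos hr0, top_le_iff] at h
    exact ENNReal.mul_ne_top (hA _ _) hR h
  rw [← ENNReal.le_rpow_inv_iff hr0]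
  refine iSup₂_le fun i y => ?_
  rw [ENNReal.le_rpow_inv_iff hr0, ENNReal.mul_rpow_of_nonneg _ _ hr0.le,
    ENNReal.mul_rpow_of_nonneg _ _ hr0.le, ← ENNReal.rpow_mul, ← ENNReal.rpow_mul]
  calc (2 : ℝ≥0∞) ^ (-((i : ℝ) * N) * r) * (F (j + i) y ^ r * dyBr j x y ^ (-b * r))
      ≤ (2 : ℝ≥0∞) ^ (-((i : ℝ) * N) * r) * ((A (max N k) L *
      levelSum (fun l z => F l z ^ r) (N * r - n) (b * r) (j + i) y) * dyBr j x y ^ (-b * r)) := by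
        gcongr; exact hpt _ _
    _ = A (max N k) L * ((2 : ℝ≥0∞) ^ (-((i : ℝ) * (N * r - n + n))) * dyBr j x y ^ (-(b * r)) *
      levelSum (fun l z => F l z ^ r) (N * r - n) (b * r) (j + i) y) := by
        rw [sub_add_cancel, neg_mul, neg_mul, mul_assoc (i : ℝ)]; ring
    _ ≤ _ := mul_le_mul_right (levelSum_shift_le _ _ (by positivity) j i x y) _

/-- Pointwise control of `F_j^r` by averages of `F_{j+k}^r`. -/
lemma reproducing_rpow_le {A : ℕ → ℕ → ℝ≥0∞} (hA : ∀ N L, A N L ≠ ∞) {r : ℝ} (hr : 0 < r)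
    (s : ℝ) {t : ℝ} (ht : 0 ≤ t) :
    ∃ C : ℝ≥0∞, C ≠ ∞ ∧ ∀ F : ℕ → Rn n → ℝ≥0∞, (∀ j, Measurable (F j)) →
      Reproducing A F → PolyGrowth F →
      ∀ j y, F j y ^ r ≤ C * levelSum (fun l z => F l z ^ r) s t j y := by
  rcases le_or_gt 1 r with hr1 | hr1
  · obtain ⟨C, hC, h⟩ := reproducing_rpow_of_one_le (n := n) hA hr1 s t
    exact ⟨C, hC, fun F hF hR _ => h F hF hR⟩
  obtain ⟨N, hN⟩ := exists_nat_ge ((s + n) / r)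
  obtain ⟨L, hL⟩ := exists_nat_ge (t / r)
  -- the constant is enlarged so that multiplication by an infinite sum is harmless
  refine ⟨A N L + 1, ENNReal.add_ne_top.2 ⟨hA N L, ENNReal.one_ne_top⟩, fun F _ hR hg j y => ?_⟩
  have hb0 : 0 ≤ t / r := by positivity
  have hbr : t / r * r = t := div_mul_cancel₀ _ hr.ne'
  have hNs : s ≤ N * r - n := by
    rw [div_le_iff₀ hr] at hN; linarith
  refine le_trans ?_ (mul_le_mul_right (levelSum_anti _ hNs hbr.ge j y) _)
  by_cases hfin : levelSum (fun l z => F l z ^ r) (N * r - n) (t / r * r) j y = ∞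
  · rw [hfin, ENNReal.mul_top (by simp)]; exact le_top
  have hM := levelSup_ne_top_of_levelSum hA hR hg hr hr1 N hb0 j y hfin
  have h2 := le_levelSup F N (t / r) j 0 y y
  have h3 : F j y ≤ levelSup F N (t / r) j y := by simpa [dyBr] using h2
  refine (ENNReal.rpow_le_rpow h3 hr.le).trans
    ((levelSup_rpow_le hR hr hr1 N L hb0 hL j y hM).trans (mul_le_mul_left le_self_add _))

lemma div_le_dyBr (a : ℝ) (ha : 0 ≤ a) (j : ℕ) (x y : Rn n) (b : ℝ≥0∞) :
    b / ENNReal.ofReal (1 + ((2 : ℝ) ^ j * ‖y - x‖) ^ a) ≤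
      2 ^ a * (b * dyBr j x y ^ (-a)) := by
  set ρ : ℝ := 2 ^ j * ‖y - x‖ with hρ
  have hρ0 : 0 ≤ ρ := by positivity
  have h1 : (1 + ρ) ^ a ≤ 2 ^ a * (1 + ρ ^ a) := by
    have h2 : 1 + ρ ≤ 2 * max 1 ρ := by linarith [le_max_left 1 ρ, le_max_right 1 ρ]
    refine (Real.rpow_le_rpow (by positivity) h2 ha).trans ?_
    rw [Real.mul_rpow two_pos.le (by positivity)]
    gcongr
    have h0 : 0 ≤ ρ ^ a := by positivity
    rcases max_cases 1 ρ with ⟨h, _⟩ | ⟨h, _⟩ <;> rw [h]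
    · rw [Real.one_rpow]; linarith
    · linarith
  have h3 : dyBr j x y ^ a ≤ 2 ^ a * ENNReal.ofReal (1 + ρ ^ a) := by
    rw [dyBr, norm_sub_rev x y, ENNReal.ofReal_rpow_of_pos (by positivity), ← ofReal_two_rpow,
      ← ENNReal.ofReal_mul (by positivity)]
    exact ENNReal.ofReal_le_ofReal h1
  refine ENNReal.div_le_of_le_mul ?_
  have h4 : dyBr j x y ^ (-a) * dyBr j x y ^ a = 1 := by
    rw [← ENNReal.rpow_add _ _ (dyBr_ne_zero _ _ _) (dyBr_ne_top _ _ _)]; simp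
  calc b = b * dyBr j x y ^ (-a) * dyBr j x y ^ a := by rw [mul_assoc, h4, mul_one]
    _ ≤ b * dyBr j x y ^ (-a) * (2 ^ a * ENNReal.ofReal (1 + ρ ^ a)) := by gcongr
    _ = _ := by ring

lemma peetreMax_rpow_le {F : Rn n → ℂ} {G : ℕ → Rn n → ℝ≥0∞} {r a s : ℝ} (hr : 0 < r)
    (ha : 0 ≤ a) {C : ℝ≥0∞} {j : ℕ}
    (h : ∀ y, ‖F y‖ₑ ^ r ≤ C * levelSum G s (a * r) j y) (x : Rn n) :
    peetreMax a j F x ^ r ≤ 2 ^ (a * r) * C * levelSum G s (a * r) j x := by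
  rw [← ENNReal.le_rpow_inv_iff hr]
  refine iSup_le fun y => (div_le_dyBr a ha j x y _).trans ?_
  rw [ENNReal.le_rpow_inv_iff hr, ENNReal.mul_rpow_of_nonneg _ _ hr.le,
    ENNReal.mul_rpow_of_nonneg _ _ hr.le, ← ENNReal.rpow_mul, ← ENNReal.rpow_mul, mul_assoc]
  refine mul_le_mul_right ?_ _
  calc ‖F y‖ₑ ^ r * dyBr j x y ^ (-a * r) ≤ C * levelSum G s (a * r) j y * dyBr j x y ^ (-a * r) := by
        gcongr; exact h y
    _ = C * ((2 : ℝ≥0∞) ^ (-(((0 : ℕ) : ℝ) * (s + n))) * dyBr j x y ^ (-(a * r)) *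
        levelSum G s (a * r) (j + 0) y) := by simp; ring
    _ ≤ _ := mul_le_mul_right (levelSum_shift_le G s (by positivity) j 0 x y) _

lemma weight_le_two_rpow {al al1 al2 C : ℝ} {w : ℕ → Rn n → ℝ}
    (hw : AdmissibleWeights al al1 al2 C w) (j k : ℕ) (x : Rn n) :
    2 ^ ((k : ℝ) * al1) * w j x ≤ w (j + k) x := by
  induction k with
  | zero => simp
  | succ k ih =>
    have h := (hw.2.2 (j + k) x).1
    refine le_trans ?_ h
    calc (2 : ℝ) ^ (((k + 1 : ℕ) : ℝ) * al1) * w j x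
        = 2 ^ al1 * (2 ^ ((k : ℝ) * al1) * w j x) := by
          rw [← mul_assoc, ← Real.rpow_add two_pos]; congr 2; push_cast; ring
      _ ≤ _ := by gcongr

lemma weight_ofReal_le {al al1 al2 C : ℝ} {w : ℕ → Rn n → ℝ}
    (hw : AdmissibleWeights al al1 al2 C w) (j k : ℕ) (x z : Rn n) :
    ENNReal.ofReal (w j x) ≤ ENNReal.ofReal C * (2 : ℝ≥0∞) ^ (-((k : ℝ) * al1)) *
      dyBr j x z ^ al * ENNReal.ofReal (w (j + k) z) := by
  have h1 := (hw.2.1 j x z).2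
  have h2 := weight_le_two_rpow hw j k z
  have hz := (hw.2.1 j z z).1
  have hC : 0 ≤ C := by
    have h3 := (hw.2.1 j z z).2
    simp only [sub_self, norm_zero, mul_zero, add_zero, Real.one_rpow, mul_one] at h3
    by_contra h
    nlinarith
  have h4 : w j z ≤ 2 ^ (-((k : ℝ) * al1)) * w (j + k) z := by
    rw [Real.rpow_neg two_pos.le, le_inv_mul_iff₀ (by positivity)]; exact h2
  rw [dyBr, ENNReal.ofReal_rpow_of_pos (by positivity), ← ofReal_two_rpow,
    ← ENNReal.ofReal_mul hC, ← ENNReal.ofReal_mul (by positivity),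
    ← ENNReal.ofReal_mul (by positivity)]
  refine ENNReal.ofReal_le_ofReal (h1.trans ?_)
  calc C * w j z * (1 + 2 ^ j * ‖x - z‖) ^ al
      ≤ C * (2 ^ (-((k : ℝ) * al1)) * w (j + k) z) * (1 + 2 ^ j * ‖x - z‖) ^ al := by gcongr
    _ = _ := by ring

lemma weight_rpow_mul_levelSum_le {al al1 al2 C : ℝ} {w : ℕ → Rn n → ℝ}
    (hw : AdmissibleWeights al al1 al2 C w) {r : ℝ} (hr : 0 < r) (s t : ℝ)
    (F : ℕ → Rn n → ℝ≥0∞) (j : ℕ) (x : Rn n) :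
    ENNReal.ofReal (w j x) ^ r * levelSum (fun l z => F l z ^ r) (s - al1 * r) t j x ≤
      ENNReal.ofReal C ^ r *
        levelSum (fun l z => (ENNReal.ofReal (w l z) * F l z) ^ r) s (t - al * r) j x := by
  have hc : ENNReal.ofReal C ^ r ≠ ∞ := ENNReal.rpow_ne_top_of_nonneg hr.le ENNReal.ofReal_ne_top
  rw [levelSum, levelSum, ← ENNReal.tsum_mul_left, ← ENNReal.tsum_mul_left]
  refine ENNReal.tsum_le_tsum fun k => ?_
  rw [← lintegral_const_mul' _ _ (two_rpow_ne_top _), ← lintegral_const_mul' _ _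
    (ENNReal.rpow_ne_top_of_nonneg hr.le ENNReal.ofReal_ne_top),
    ← lintegral_const_mul' _ _ (two_rpow_ne_top _), ← lintegral_const_mul' _ _ hc]
  refine lintegral_mono fun z => ?_
  simp only
  have h1 := ENNReal.rpow_le_rpow (weight_ofReal_le hw j k x z) hr.le
  rw [ENNReal.mul_rpow_of_nonneg _ _ hr.le, ENNReal.mul_rpow_of_nonneg _ _ hr.le,
    ENNReal.mul_rpow_of_nonneg _ _ hr.le, ← ENNReal.rpow_mul, ← ENNReal.rpow_mul] at h1
  have h2 : (2 : ℝ≥0∞) ^ (-((k : ℝ) * al1) * r) * 2 ^ (-((k : ℝ) * (s - al1 * r))) =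
      2 ^ (-((k : ℝ) * s)) := by
    rw [← two_rpow_add]; congr 1; ring
  have h3 : dyBr j x z ^ (al * r) * dyBr j x z ^ (-t) = dyBr j x z ^ (-(t - al * r)) := by
    rw [← ENNReal.rpow_add _ _ (dyBr_ne_zero _ _ _) (dyBr_ne_top _ _ _)]; congr 1; ring
  calc _ ≤ (ENNReal.ofReal C ^ r * (2 : ℝ≥0∞) ^ (-((k : ℝ) * al1) * r) *
      dyBr j x z ^ (al * r) * ENNReal.ofReal (w (j + k) z) ^ r) *
      ((2 : ℝ≥0∞) ^ (-((k : ℝ) * (s - al1 * r))) * (2 ^ ((j : ℝ) * n) * dyBr j x z ^ (-t) *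
        F (j + k) z ^ r)) := mul_le_mul_left h1 _
    _ = ENNReal.ofReal C ^ r * (((2 : ℝ≥0∞) ^ (-((k : ℝ) * al1) * r) *
      2 ^ (-((k : ℝ) * (s - al1 * r)))) * (2 ^ ((j : ℝ) * n) *
      (dyBr j x z ^ (al * r) * dyBr j x z ^ (-t)) *
      (ENNReal.ofReal (w (j + k) z) ^ r * F (j + k) z ^ r))) := by ring
    _ = _ := by rw [h2, h3, ENNReal.mul_rpow_of_nonneg _ _ hr.le]

/-- Pointwise estimate of the weighted Peetre maximal functions by local averages. -/
theorem weighted_peetreMax_rpow_le {al al1 al2 Cw : ℝ} {w : ℕ → Rn n → ℝ}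
    (hw : AdmissibleWeights al al1 al2 Cw w) (ψ0 ψ1 : SchwartzMap (Rn n) ℂ) {ε k : ℝ} (hε : 0 < ε)
    (hk : 1 < k) (hψ1 : ∀ x : Rn n, ε ≤ ‖x‖ → ‖x‖ ≤ 2 * k * ε → 0 < ‖ψ1 x‖)
    (psis : ℕ → SchwartzMap (Rn n) ℂ) (hpsis0 : psis 0 = ψ0)
    (hpsis : ∀ i x, psis (i + 1) x = ψ1 (((2 : ℝ) ^ i)⁻¹ • x)) {r a : ℝ} (hr : 0 < r)
    (ha : 0 ≤ a) (s : ℝ) :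
    ∃ C : ℝ≥0∞, C ≠ ∞ ∧ ∀ (f : TemperedDist n) (j : ℕ) (x : Rn n),
      (ENNReal.ofReal (w j x) *
        peetreMax a j (distConv (SchwartzMap.fourierTransformCLM ℂ (psis j)) f) x) ^ r ≤
      C * levelSum (fun l z => (ENNReal.ofReal (w l z) *
        (‖distConv (SchwartzMap.fourierTransformCLM ℂ (psis l)) f z‖₊ : ℝ≥0∞)) ^ r)
        s ((a - al) * r) j x := by
  choose A hA0 hA using fun N L => exists_reproducing_family ψ0 ψ1 hε hk hψ1 psis hpsis0 hpsis N L
  obtain ⟨C, hC, h⟩ := reproducing_rpow_le (n := n) (A := fun N L => ENNReal.ofReal (A N L))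
    (fun _ _ => ENNReal.ofReal_ne_top) hr (s - al1 * r) (t := a * r) (by positivity)
  refine ⟨2 ^ (a * r) * C * ENNReal.ofReal Cw ^ r, ENNReal.mul_ne_top
    (ENNReal.mul_ne_top (two_rpow_ne_top _) hC)
    (ENNReal.rpow_ne_top_of_nonneg hr.le ENNReal.ofReal_ne_top), fun f j x => ?_⟩
  set F : ℕ → Rn n → ℝ≥0∞ := fun l z =>
    ‖distConv (SchwartzMap.fourierTransformCLM ℂ (psis l)) f z‖ₑ with hF
  have hrep : Reproducing (fun N L => ENNReal.ofReal (A N L)) F := by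
    intro N L j y
    refine (hA N L j f y).trans (mul_le_mul_right (ENNReal.tsum_le_tsum fun i => ?_) _)
    refine mul_le_mul' (le_of_eq ?_) (lintegral_mono fun z => ?_)
    · rw [← ofReal_two_rpow, Real.rpow_neg two_pos.le, Real.rpow_mul two_pos.le,
        Real.rpow_natCast, Real.rpow_natCast, inv_pow]
    · rw [etaK_eq]
  have hgrow : PolyGrowth F := by
    obtain ⟨k, C, hC, h⟩ := exists_distConv_family_growth ψ0 ψ1 psis hpsis0 hpsis f
    refine ⟨k, ENNReal.ofReal C, ENNReal.ofReal_ne_top, fun l y => ?_⟩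
    simp only [hF]
    rw [← ofReal_norm]
    refine (ENNReal.ofReal_le_ofReal (h l y)).trans_eq ?_
    rw [ENNReal.ofReal_mul hC, ENNReal.ofReal_pow (by positivity),
      ENNReal.ofReal_mul (by positivity), ENNReal.ofReal_pow (by positivity),
      ENNReal.ofReal_ofNat, dyBr]
    simp
  have hmeas : ∀ l, Measurable (F l) := fun l => (continuous_distConv _ f).measurable.enorm
  have h1 := peetreMax_rpow_le (F := distConv (SchwartzMap.fourierTransformCLM ℂ (psis j)) f)
    hr ha (h F hmeas hrep hgrow j) x
  rw [ENNReal.mul_rpow_of_nonneg _ _ hr.le]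
  have h2 := weight_rpow_mul_levelSum_le hw hr s (a * r) F j x
  calc _ ≤ ENNReal.ofReal (w j x) ^ r * (2 ^ (a * r) * C *
      levelSum (fun l z => F l z ^ r) (s - al1 * r) (a * r) j x) := by gcongr
    _ = 2 ^ (a * r) * C * (ENNReal.ofReal (w j x) ^ r *
      levelSum (fun l z => F l z ^ r) (s - al1 * r) (a * r) j x) := by ring
    _ ≤ 2 ^ (a * r) * C * (ENNReal.ofReal Cw ^ r *
        levelSum (fun l z => (ENNReal.ofReal (w l z) * F l z) ^ r) s (a * r - al * r) j x) := by
        gcongr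
    _ = _ := by rw [← mul_assoc, sub_mul]; rfl

/-- The volume of the unit ball. -/
def unitVol (n : ℕ) : ℝ≥0∞ := volume (Metric.ball (0 : Rn n) 1)

lemma unitVol_ne_top (n : ℕ) : unitVol n ≠ ∞ := Metric.isBounded_ball.measure_lt_top.ne

lemma unitVol_ne_zero (n : ℕ) : unitVol n ≠ 0 :=
  (Metric.measure_ball_pos volume (0 : Rn n) one_pos).ne'

lemma volume_ball_eq (x : Rn n) {R : ℝ} (hR : 0 < R) :
    volume (Metric.ball x R) = ENNReal.ofReal R ^ n * unitVol n := by
  have := Measure.addHaar_ball_mul_of_pos (volume : Measure (Rn n)) x hR 1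
  rw [mul_one] at this
  rw [this, finrank_euclideanSpace_fin, ENNReal.ofReal_pow hR.le, unitVol]

/-- Averages over balls, normalised by the power of the radius. -/
def ballAvg (R : ℝ) (f : Rn n → ℝ≥0∞) (x : Rn n) : ℝ≥0∞ :=
  (ENNReal.ofReal R)⁻¹ ^ n * ∫⁻ z in Metric.ball x R, f z

lemma ofReal_inv_pow_mul {R : ℝ} (hR : 0 < R) :
    (ENNReal.ofReal R)⁻¹ ^ n * ENNReal.ofReal R ^ n = 1 := by
  rw [← mul_pow, ENNReal.inv_mul_cancel (by simpa using hR) ENNReal.ofReal_ne_top, one_pow]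

lemma ballAvg_const {R : ℝ} (hR : 0 < R) (c : ℝ≥0∞) (x : Rn n) :
    ballAvg R (fun _ => c) x = unitVol n * c := by
  rw [ballAvg, lintegral_const, Measure.restrict_apply_univ, volume_ball_eq x hR,
    mul_left_comm, ← mul_assoc, ← mul_assoc, mul_assoc c, ofReal_inv_pow_mul hR, mul_one, mul_comm]

lemma ballAvg_mono {f g : Rn n → ℝ≥0∞} {R : ℝ} {x : Rn n}
    (h : ∀ z ∈ Metric.ball x R, f z ≤ g z) : ballAvg R f x ≤ ballAvg R g x := by
  unfold ballAvg
  gcongr 1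
  exact setLIntegral_mono' measurableSet_ball h

lemma ballAvg_congr {f g : Rn n → ℝ≥0∞} {R : ℝ} {x : Rn n}
    (h : ∀ z ∈ Metric.ball x R, f z = g z) : ballAvg R f x = ballAvg R g x :=
  le_antisymm (ballAvg_mono fun z hz => (h z hz).le) (ballAvg_mono fun z hz => (h z hz).ge)

lemma ballAvg_add {f g : Rn n → ℝ≥0∞} (hf : Measurable f) (R : ℝ) (x : Rn n) :
    ballAvg R (fun z => f z + g z) x = ballAvg R f x + ballAvg R g x := by
  rw [ballAvg, lintegral_add_left hf, mul_add, ballAvg, ballAvg]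

lemma ballAvg_const_mul {f : Rn n → ℝ≥0∞} (hf : Measurable f) (c : ℝ≥0∞) (R : ℝ) (x : Rn n) :
    ballAvg R (fun z => c * f z) x = c * ballAvg R f x := by
  rw [ballAvg, lintegral_const_mul c hf, mul_left_comm, ballAvg]

/-- The indicator of `dist z x < R`, as a function of two variables. -/
def nearInd (R : ℝ) (x z : Rn n) : ℝ≥0∞ := (Metric.ball x R).indicator 1 z

lemma nearInd_comm (R : ℝ) (x z : Rn n) : nearInd R x z = nearInd R z x := by
  simp only [nearInd, Set.indicator, Metric.mem_ball, dist_comm, Pi.one_apply]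

lemma measurable_nearInd (R : ℝ) : Measurable (fun y : Rn n × Rn n => nearInd R y.1 y.2) := by
  have : (fun y : Rn n × Rn n => nearInd R y.1 y.2) =
      Set.indicator {y : Rn n × Rn n | dist y.2 y.1 < R} 1 := by
    funext y
    simp only [nearInd, Set.indicator, Metric.mem_ball, Set.mem_ofPred_eq, Pi.one_apply]
  rw [this]
  exact measurable_one.indicator (measurableSet_lt (by fun_prop) measurable_const)

lemma ballAvg_eq (R : ℝ) (f : Rn n → ℝ≥0∞) (x : Rn n) :
    ballAvg R f x = (ENNReal.ofReal R)⁻¹ ^ n * ∫⁻ z, nearInd R x z * f z := by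
  rw [ballAvg, ← lintegral_indicator measurableSet_ball]
  congr 2
  funext z
  simp only [nearInd, Set.indicator]
  split_ifs <;> simp

lemma measurable_ballAvg (R : ℝ) {f : Rn n → ℝ≥0∞} (hf : Measurable f) :
    Measurable (ballAvg R f) := by
  have : ballAvg R f = fun x => (ENNReal.ofReal R)⁻¹ ^ n * ∫⁻ z, nearInd R x z * f z :=
    funext (ballAvg_eq R f)
  rw [this]
  refine measurable_const.mul (Measurable.lintegral_prod_right' (f := fun y : Rn n × Rn n =>
    nearInd R y.1 y.2 * f y.2) ?_)
  exact (measurable_nearInd R).mul (hf.comp measurable_snd)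

lemma lintegral_mul_ballAvg (R : ℝ) {f h : Rn n → ℝ≥0∞} (hf : Measurable f) (hh : Measurable h) :
    ∫⁻ x, h x * ballAvg R f x = ∫⁻ x, ballAvg R h x * f x := by
  have e1 : ∀ x, h x * ballAvg R f x =
      (ENNReal.ofReal R)⁻¹ ^ n * ∫⁻ z, h x * (nearInd R x z * f z) := fun x => by
    rw [ballAvg_eq, mul_left_comm, lintegral_const_mul]
    exact ((measurable_nearInd R).comp measurable_prodMk_left).mul hf
  have e2 : ∀ z, ballAvg R h z * f z =
      (ENNReal.ofReal R)⁻¹ ^ n * ∫⁻ x, h x * (nearInd R x z * f z) := fun z => by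
    rw [ballAvg_eq, mul_assoc, ← lintegral_mul_const]
    · congr 2
      funext x
      rw [nearInd_comm]
      ring
    · exact ((measurable_nearInd R).comp measurable_prodMk_left).mul hh
  simp_rw [e1, e2]
  have hm : Measurable (fun y : Rn n × Rn n => h y.1 * (nearInd R y.1 y.2 * f y.2)) :=
    (hh.comp measurable_fst).mul ((measurable_nearInd R).mul (hf.comp measurable_snd))
  rw [lintegral_const_mul _ hm.lintegral_prod_right', lintegral_const_mul _ hm.lintegral_prod_left',
    lintegral_lintegral_swap hm.aemeasurable]

lemma lintegral_ballAvg {R : ℝ} (hR : 0 < R) {f : Rn n → ℝ≥0∞} (hf : Measurable f) :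
    ∫⁻ x, ballAvg R f x = unitVol n * ∫⁻ x, f x := by
  have := lintegral_mul_ballAvg R hf (measurable_const (a := (1 : ℝ≥0∞)))
  simp only [one_mul, ballAvg_const hR, mul_one] at this
  rw [this, lintegral_const_mul _ hf]

lemma ballAvg_rpow_le {R : ℝ} (hR : 0 < R) {f : Rn n → ℝ≥0∞} (hf : Measurable f) {p : ℝ}
    (hp : 1 ≤ p) (x : Rn n) :
    ballAvg R f x ^ p ≤ unitVol n ^ (p - 1) * ballAvg R (fun z => f z ^ p) x := by
  have h := lintegral_mul_rpow_le (volume.restrict (Metric.ball x R))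
    (w := fun _ => (ENNReal.ofReal R)⁻¹ ^ n) measurable_const.aemeasurable hf.aemeasurable hp
  rw [lintegral_const_mul _ hf, lintegral_const_mul _ (hf.pow_const p)] at h
  have h1 := ballAvg_const hR 1 x
  rw [ballAvg] at h1
  rw [lintegral_const] at h h1
  rw [one_mul] at h1
  rw [h1, mul_one] at h
  exact h

lemma ballAvg_indicator {x0 : Rn n} {R ρ τ : ℝ} {f : Rn n → ℝ≥0∞} {x : Rn n}
    (hx : x ∈ Metric.ball x0 ρ) (hR : ρ + R ≤ τ) :
    ballAvg R f x = ballAvg R ((Metric.ball x0 τ).indicator f) x := by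
  refine ballAvg_congr fun z hz => ?_
  rw [Set.indicator_of_mem]
  rw [Metric.mem_ball] at *
  linarith [dist_triangle z x x0]

/-- The local dyadic maximal function. -/
def locMax (f : Rn n → ℝ≥0∞) (x : Rn n) : ℝ≥0∞ := ⨆ μ : ℕ, ballAvg ((2 : ℝ)⁻¹ ^ μ) f x

lemma ballAvg_le_locMax (f : Rn n → ℝ≥0∞) (μ : ℕ) (x : Rn n) :
    ballAvg ((2 : ℝ)⁻¹ ^ μ) f x ≤ locMax f x := le_iSup (fun μ => ballAvg ((2 : ℝ)⁻¹ ^ μ) f x) μ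

lemma measurable_locMax {f : Rn n → ℝ≥0∞} (hf : Measurable f) : Measurable (locMax f) :=
  Measurable.iSup fun _ => measurable_ballAvg _ hf

lemma volume_closedBall_four_mul_le (x : Rn n) {R : ℝ} (hR : 0 < R) :
    volume (Metric.closedBall x (4 * R)) ≤ 5 ^ n * (ENNReal.ofReal R ^ n * unitVol n) := by
  calc volume (Metric.closedBall x (4 * R)) ≤ volume (Metric.ball x (5 * R)) :=
        measure_mono (Metric.closedBall_subset_ball (by linarith))
    _ = 5 ^ n * (ENNReal.ofReal R ^ n * unitVol n) := by
        rw [volume_ball_eq x (by linarith), ENNReal.ofReal_mul (by norm_num), mul_pow, mul_assoc]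
        norm_num

lemma weak_type_locMax (f : Rn n → ℝ≥0∞) (lam : ℝ≥0∞) :
    lam * volume {x | lam < locMax f x} ≤ 5 ^ n * unitVol n * ∫⁻ x, f x := by
  have hex : ∀ x ∈ {x | lam < locMax f x}, ∃ μ : ℕ, lam < ballAvg ((2 : ℝ)⁻¹ ^ μ) f x :=
    fun x hx => lt_iSup_iff.1 hx
  choose! μ hμ using hex
  set r : Rn n → ℝ := fun x => (2 : ℝ)⁻¹ ^ μ x with hr
  have hrpos : ∀ x, 0 < r x := fun x => by positivity
  obtain ⟨s, hs, hdisj, hcov⟩ := Vitali.exists_disjoint_subfamily_covering_enlargement_closedBall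
    {x | lam < locMax f x} (fun x => x) r 1
    (fun x _ => pow_le_one₀ (by norm_num) (by norm_num)) 4 (by norm_num)
  have hcount : s.Countable := by
    refine hdisj.countable_of_nonempty_interior fun x _ => ?_
    exact ⟨x, Metric.ball_subset_interior_closedBall (Metric.mem_ball_self (hrpos x))⟩
  have hsub : {x | lam < locMax f x} ⊆ ⋃ b ∈ s, Metric.closedBall b (4 * r b) := by
    intro x hx
    obtain ⟨b, hb, hxb⟩ := hcov x hx
    exact Set.mem_biUnion hb (hxb (Metric.mem_closedBall_self (hrpos x).le))
  have hdisj' : s.PairwiseDisjoint fun x => Metric.ball x (r x) :=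
    hdisj.mono fun x => Metric.ball_subset_closedBall
  have : Countable s := hcount.to_subtype
  calc lam * volume {x | lam < locMax f x}
      ≤ lam * ∑' b : s, volume (Metric.closedBall (b : Rn n) (4 * r b)) := by
        gcongr
        exact (measure_mono hsub).trans (measure_biUnion_le _ hcount _)
    _ = ∑' b : s, lam * volume (Metric.closedBall (b : Rn n) (4 * r b)) := ENNReal.tsum_mul_left.symm
    _ ≤ ∑' b : s, 5 ^ n * unitVol n * ∫⁻ x in Metric.ball (b : Rn n) (r b), f x := by
        refine ENNReal.tsum_le_tsum fun b => ?_
        calc lam * volume (Metric.closedBall (b : Rn n) (4 * r b))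
            ≤ ballAvg (r b) f b * (5 ^ n * (ENNReal.ofReal (r b) ^ n * unitVol n)) := by
              gcongr
              · exact (hμ b (hs b.2)).le
              · exact volume_closedBall_four_mul_le _ (hrpos _)
          _ = 5 ^ n * unitVol n * (((ENNReal.ofReal (r b))⁻¹ ^ n * ENNReal.ofReal (r b) ^ n) *
                ∫⁻ x in Metric.ball (b : Rn n) (r b), f x) := by
              rw [ballAvg]
              ring
          _ = _ := by rw [ofReal_inv_pow_mul (hrpos _), one_mul]
    _ = 5 ^ n * unitVol n * ∫⁻ x in ⋃ b ∈ s, Metric.ball b (r b), f x := by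
        rw [ENNReal.tsum_mul_left, ← lintegral_biUnion hcount
          (fun _ _ => measurableSet_ball) hdisj']
    _ ≤ 5 ^ n * unitVol n * ∫⁻ x, f x := by
        gcongr
        exact Measure.restrict_le_self

/-- The integral of `t^(σ-1)` up to a finite level. -/
lemma lintegral_rpow_Ioc {σ b : ℝ} (hσ : 0 < σ) (hb : 0 ≤ b) :
    ∫⁻ t in Set.Ioc 0 b, ENNReal.ofReal (t ^ (σ - 1)) = ENNReal.ofReal (b ^ σ / σ) := by
  have hintegrable : IntervalIntegrable (fun t : ℝ => t ^ (σ - 1)) volume 0 b :=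
    intervalIntegral.intervalIntegrable_rpow' (by linarith)
  rw [← ofReal_integral_eq_lintegral_ofReal]
  · rw [← intervalIntegral.integral_of_le hb, integral_rpow (Or.inl (by linarith)),
      sub_add_cancel, Real.zero_rpow hσ.ne', sub_zero]
  · exact (intervalIntegrable_iff_integrableOn_Ioc_of_le hb).1 hintegrable
  · refine (ae_restrict_mem measurableSet_Ioc).mono fun t ht => ?_
    exact Real.rpow_nonneg ht.1.le _

/-- The layer cake formula at a point. -/
lemma rpow_le_lintegral_layer {σ : ℝ} (hσ : 0 < σ) (a : ℝ≥0∞) :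
    a ^ σ ≤ ENNReal.ofReal σ * ∫⁻ t in Set.Ioi (0 : ℝ),
      ENNReal.ofReal (t ^ (σ - 1)) * (if ENNReal.ofReal t < a then 1 else 0) := by
  have key : ∀ b : ℝ, 0 ≤ b → ENNReal.ofReal b ≤ a → ENNReal.ofReal b ^ σ ≤
      ENNReal.ofReal σ * ∫⁻ t in Set.Ioi (0 : ℝ),
      ENNReal.ofReal (t ^ (σ - 1)) * (if ENNReal.ofReal t < a then 1 else 0) := by
    intro b hb hba
    have h1 : ENNReal.ofReal b ^ σ = ENNReal.ofReal σ *
        ∫⁻ t in Set.Ioo 0 b, ENNReal.ofReal (t ^ (σ - 1)) := by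
      rw [setLIntegral_congr (Ioo_ae_eq_Ioc (μ := volume) (a := (0 : ℝ)) (b := b)),
        lintegral_rpow_Ioc hσ hb,
        ← ENNReal.ofReal_mul hσ.le, mul_div_cancel₀ _ hσ.ne', ENNReal.ofReal_rpow_of_nonneg hb hσ.le]
    rw [h1]
    gcongr 1
    calc ∫⁻ t in Set.Ioo 0 b, ENNReal.ofReal (t ^ (σ - 1))
        = ∫⁻ t in Set.Ioo 0 b, ENNReal.ofReal (t ^ (σ - 1)) *
            (if ENNReal.ofReal t < a then 1 else 0) := by
          refine setLIntegral_congr_fun measurableSet_Ioo fun t ht => ?_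
          have : ENNReal.ofReal t < a :=
            ((ENNReal.ofReal_lt_ofReal_iff (ht.1.trans ht.2)).2 ht.2).trans_le hba
          simp [this]
      _ ≤ _ := lintegral_mono_set Set.Ioo_subset_Ioi_self
  rcases eq_or_ne a ∞ with rfl | ha
  · rw [ENNReal.top_rpow_of_pos hσ]
    refine le_of_forall_lt fun c hc => ?_
    obtain ⟨N, hN⟩ := ENNReal.exists_nat_gt (ENNReal.rpow_ne_top_of_nonneg
      (inv_nonneg.2 hσ.le) hc.ne : c ^ σ⁻¹ ≠ ∞)
    have h2 := key N (Nat.cast_nonneg N) le_top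
    refine lt_of_lt_of_le ?_ h2
    rw [ENNReal.ofReal_natCast]
    have := ENNReal.rpow_lt_rpow hN hσ
    rwa [← ENNReal.rpow_mul, inv_mul_cancel₀ hσ.ne', ENNReal.rpow_one] at this
  · have := key a.toReal ENNReal.toReal_nonneg (ENNReal.ofReal_toReal ha).le
    rwa [ENNReal.ofReal_toReal ha] at this

lemma lintegral_layer_le_rpow {σ : ℝ} (hσ : 0 < σ) (a : ℝ≥0∞) :
    ∫⁻ t in Set.Ioi (0 : ℝ), ENNReal.ofReal (t ^ (σ - 1)) * (if ENNReal.ofReal t < a then 1 else 0)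
      ≤ ENNReal.ofReal σ⁻¹ * a ^ σ := by
  rcases eq_or_ne a ∞ with rfl | ha
  · rw [ENNReal.top_rpow_of_pos hσ, ENNReal.mul_top (by simpa using hσ)]
    exact le_top
  calc ∫⁻ t in Set.Ioi (0 : ℝ), ENNReal.ofReal (t ^ (σ - 1)) *
        (if ENNReal.ofReal t < a then 1 else 0)
      ≤ ∫⁻ t in Set.Ioi (0 : ℝ), (Set.Ioc 0 a.toReal).indicator
          (fun t => ENNReal.ofReal (t ^ (σ - 1))) t := by
        refine setLIntegral_mono' measurableSet_Ioi fun t ht => ?_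
        split_ifs with h
        · rw [Set.indicator_of_mem, mul_one]
          exact ⟨ht, (ENNReal.ofReal_le_iff_le_toReal ha).1 h.le⟩
        · simp
    _ ≤ ∫⁻ t, (Set.Ioc 0 a.toReal).indicator (fun t => ENNReal.ofReal (t ^ (σ - 1))) t :=
        setLIntegral_le_lintegral _ _
    _ = ENNReal.ofReal (a.toReal ^ σ / σ) := by
        rw [lintegral_indicator measurableSet_Ioc, lintegral_rpow_Ioc hσ ENNReal.toReal_nonneg]
    _ = _ := by
        rw [div_eq_inv_mul, ENNReal.ofReal_mul (inv_nonneg.2 hσ.le), ENNReal.toReal_rpow,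
          ENNReal.ofReal_toReal (ENNReal.rpow_ne_top_of_nonneg hσ.le ha)]

lemma lt_locMax_subset {f : Rn n → ℝ≥0∞} {t : ℝ} (ht : 0 < t) :
    {x | ENNReal.ofReal t < locMax f x} ⊆ {x | ENNReal.ofReal (t / 2) <
      locMax (fun z => f z * (if ENNReal.ofReal t < 2 * unitVol n * f z then 1 else 0)) x} := by
  intro x hx
  set g : Rn n → ℝ≥0∞ := fun z => f z * (if ENNReal.ofReal t < 2 * unitVol n * f z then 1 else 0)
  set c : ℝ≥0∞ := ENNReal.ofReal (t / 2) / unitVol n with hc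
  have hfg : ∀ z, f z ≤ c + g z := by
    intro z
    by_cases h : ENNReal.ofReal t < 2 * unitVol n * f z
    · simp only [g, h, if_true, mul_one]
      exact le_add_self
    · refine le_add_right ?_
      rw [not_lt] at h
      rw [hc, ENNReal.le_div_iff_mul_le (Or.inl (unitVol_ne_zero n)) (Or.inl (unitVol_ne_top n)),
        ENNReal.ofReal_div_of_pos two_pos,
        ENNReal.le_div_iff_mul_le (Or.inl (by norm_num)) (Or.inl (by norm_num))]
      refine le_trans (le_of_eq ?_) h
      simp only [ENNReal.ofReal_ofNat]
      ring
  have hM : locMax f x ≤ ENNReal.ofReal (t / 2) + locMax g x := by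
    refine iSup_le fun μ => ?_
    calc ballAvg ((2 : ℝ)⁻¹ ^ μ) f x ≤ ballAvg ((2 : ℝ)⁻¹ ^ μ) (fun z => c + g z) x :=
          ballAvg_mono fun z _ => hfg z
      _ = ENNReal.ofReal (t / 2) + ballAvg ((2 : ℝ)⁻¹ ^ μ) g x := by
          rw [ballAvg_add measurable_const, ballAvg_const (by positivity), hc,
            ENNReal.mul_div_cancel (unitVol_ne_zero n) (unitVol_ne_top n)]
      _ ≤ _ := by
          gcongr
          exact ballAvg_le_locMax g μ x
  have h2 : ENNReal.ofReal (t / 2) + ENNReal.ofReal (t / 2) <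
      ENNReal.ofReal (t / 2) + locMax g x := by
    rw [← ENNReal.ofReal_add (by positivity) (by positivity), add_halves]
    exact lt_of_lt_of_le hx hM
  exact lt_of_add_lt_add_left h2

/-- The strong type bound for the local maximal function. -/
theorem exists_lintegral_locMax_rpow_le (n : ℕ) {s : ℝ} (hs : 1 < s) :
    ∃ C : ℝ≥0∞, C ≠ ∞ ∧ ∀ f : Rn n → ℝ≥0∞, Measurable f →
      ∫⁻ x, locMax f x ^ s ≤ C * ∫⁻ x, f x ^ s := by
  set K : ℝ≥0∞ := 2 * (5 ^ n * unitVol n) with hK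
  have hKtop : K ≠ ∞ := by
    have := unitVol_ne_top n
    finiteness
  refine ⟨ENNReal.ofReal s * (K * (ENNReal.ofReal (s - 1)⁻¹ * (2 * unitVol n) ^ (s - 1))), ?_, ?_⟩
  · have h1 : (2 * unitVol n) ^ (s - 1) ≠ ∞ :=
      ENNReal.rpow_ne_top_of_nonneg (by linarith) (ENNReal.mul_ne_top (by norm_num) (unitVol_ne_top n))
    finiteness
  intro f hf
  have hmM := measurable_locMax hf
  set I : ℝ → Rn n → ℝ≥0∞ :=
    fun t x => if ENNReal.ofReal t < 2 * unitVol n * f x then 1 else 0 with hI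
  have hmI : Measurable (fun y : ℝ × Rn n => I y.1 y.2) :=
    Measurable.ite (measurableSet_lt (by fun_prop) (by fun_prop)) measurable_const measurable_const
  have hvol : ∀ t ∈ Set.Ioi (0 : ℝ), ∫⁻ x, ENNReal.ofReal (t ^ (s - 1)) *
      (if ENNReal.ofReal t < locMax f x then 1 else 0) ≤
      K * ∫⁻ x, f x * (ENNReal.ofReal (t ^ (s - 1 - 1)) * I t x) := by
    intro t ht
    have ht' : 0 < t := ht
    have hms : MeasurableSet {x | ENNReal.ofReal t < locMax f x} :=
      measurableSet_lt measurable_const hmM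
    have e1 : ∫⁻ x, (if ENNReal.ofReal t < locMax f x then (1 : ℝ≥0∞) else 0) =
        volume {x | ENNReal.ofReal t < locMax f x} := by
      rw [← lintegral_indicator_one hms]
      congr 1
      funext x
      simp only [Set.indicator, Set.mem_ofPred_eq, Pi.one_apply]
    have hw := (mul_le_mul_right (measure_mono (μ := volume) (lt_locMax_subset (f := f) ht'))
      (ENNReal.ofReal (t / 2))).trans (weak_type_locMax _ _)
    have e2 : ENNReal.ofReal (t ^ (s - 1)) =
        2 * ENNReal.ofReal (t ^ (s - 1 - 1)) * ENNReal.ofReal (t / 2) := by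
      rw [← ENNReal.ofReal_ofNat 2, ← ENNReal.ofReal_mul (by norm_num),
        ← ENNReal.ofReal_mul (by positivity), Real.rpow_sub_one ht'.ne' (s - 1)]
      congr 1
      field_simp
    rw [lintegral_const_mul' _ _ ENNReal.ofReal_ne_top, e1, e2, mul_assoc]
    calc _ ≤ 2 * ENNReal.ofReal (t ^ (s - 1 - 1)) * (5 ^ n * unitVol n * ∫⁻ x, f x * I t x) := by
          gcongr
      _ = K * (ENNReal.ofReal (t ^ (s - 1 - 1)) * ∫⁻ x, f x * I t x) := by
          rw [hK]
          ring
      _ = _ := by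
          rw [← lintegral_const_mul' _ _ ENNReal.ofReal_ne_top]
          congr 2
          funext x
          ring
  have hm1 : Measurable (fun y : Rn n × ℝ => ENNReal.ofReal (y.2 ^ (s - 1)) *
      (if ENNReal.ofReal y.2 < locMax f y.1 then (1 : ℝ≥0∞) else 0)) := by
    refine Measurable.mul (by fun_prop) (Measurable.ite (measurableSet_lt (by fun_prop) ?_)
      measurable_const measurable_const)
    exact hmM.comp measurable_fst
  have hm2 : Measurable (fun y : ℝ × Rn n =>
      f y.2 * (ENNReal.ofReal (y.1 ^ (s - 1 - 1)) * I y.1 y.2)) :=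
    (hf.comp measurable_snd).mul (Measurable.mul (by fun_prop) hmI)
  calc ∫⁻ x, locMax f x ^ s
      ≤ ∫⁻ x, ENNReal.ofReal s * ∫⁻ t in Set.Ioi (0 : ℝ), ENNReal.ofReal (t ^ (s - 1)) *
          (if ENNReal.ofReal t < locMax f x then 1 else 0) :=
        lintegral_mono fun x => rpow_le_lintegral_layer (by linarith) _
    _ = ENNReal.ofReal s * ∫⁻ t in Set.Ioi (0 : ℝ), ∫⁻ x, ENNReal.ofReal (t ^ (s - 1)) *
          (if ENNReal.ofReal t < locMax f x then 1 else 0) := by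
        rw [lintegral_const_mul' _ _ ENNReal.ofReal_ne_top, lintegral_lintegral_swap hm1.aemeasurable]
    _ ≤ ENNReal.ofReal s * ∫⁻ t in Set.Ioi (0 : ℝ),
          K * ∫⁻ x, f x * (ENNReal.ofReal (t ^ (s - 1 - 1)) * I t x) := by
        gcongr 1
        exact setLIntegral_mono' measurableSet_Ioi hvol
    _ = ENNReal.ofReal s * (K * ∫⁻ x, f x * ∫⁻ t in Set.Ioi (0 : ℝ),
          ENNReal.ofReal (t ^ (s - 1 - 1)) * I t x) := by
        rw [lintegral_const_mul' _ _ hKtop, lintegral_lintegral_swap hm2.aemeasurable]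
        congr 3
        funext x
        rw [lintegral_const_mul]
        exact Measurable.mul (by fun_prop) (hmI.comp measurable_prodMk_right)
    _ ≤ ENNReal.ofReal s * (K * ∫⁻ x, f x * (ENNReal.ofReal (s - 1)⁻¹ *
          (2 * unitVol n * f x) ^ (s - 1))) := by
        gcongr with x
        exact lintegral_layer_le_rpow (by linarith) _
    _ = _ := by
        simp only [mul_assoc]
        congr 2
        rw [← lintegral_const_mul' _ _ (ENNReal.rpow_ne_top_of_nonneg (by linarith)
          (ENNReal.mul_ne_top (by norm_num) (unitVol_ne_top n))), ← lintegral_const_mul' _ _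
          ENNReal.ofReal_ne_top]
        congr 1
        funext x
        rw [← mul_assoc (2 : ℝ≥0∞), ENNReal.mul_rpow_of_nonneg _ _ (by linarith : 0 ≤ s - 1)]
        have : f x ^ s = f x * f x ^ (s - 1) := by
          conv_lhs => rw [show s = 1 + (s - 1) by ring,
            ENNReal.rpow_add_of_nonneg _ _ zero_le_one (by linarith), ENNReal.rpow_one]
        rw [this]
        ring

/-- The dual of the maximal inequality: sums of averages at different scales. -/
theorem exists_lintegral_tsum_ballAvg_rpow_le (n : ℕ) {s : ℝ} (hs : 1 < s) :
    ∃ C : ℝ≥0∞, C ≠ ∞ ∧ ∀ b : ℕ → Rn n → ℝ≥0∞, (∀ μ, Measurable (b μ)) →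
      ∫⁻ x, (∑' μ, ballAvg ((2 : ℝ)⁻¹ ^ μ) (b μ) x) ^ s ≤ C * ∫⁻ x, (∑' μ, b μ x) ^ s := by
  have hs0 : 0 < s := by linarith
  set s' := s / (s - 1) with hs'
  have hconj : s.HolderConjugate s' := Real.HolderConjugate.conjExponent hs
  have hs1 : 0 < s - 1 := by linarith
  have hs'0 : 0 < s' := hconj.symm.pos
  have hs'1 : 1 < s' := hconj.symm.lt
  obtain ⟨C1, hC1, hM1⟩ := exists_lintegral_locMax_rpow_le n hs
  obtain ⟨C2, hC2, hC20, hM2⟩ : ∃ C : ℝ≥0∞, C ≠ ∞ ∧ C ≠ 0 ∧ ∀ f : Rn n → ℝ≥0∞, Measurable f →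
      ∫⁻ x, locMax f x ^ s' ≤ C * ∫⁻ x, f x ^ s' := by
    obtain ⟨C, hC, hM⟩ := exists_lintegral_locMax_rpow_le n hs'1
    exact ⟨C + 1, by finiteness, by simp, fun f hf => (hM f hf).trans (by gcongr; exact le_self_add)⟩
  refine ⟨C2 ^ (s - 1), ENNReal.rpow_ne_top_of_nonneg hs1.le hC2, fun b hb => ?_⟩
  have hmB : Measurable fun x => ∑' μ, b μ x := Measurable.tsum hb
  set B : Rn n → ℝ≥0∞ := fun x => ∑' μ, b μ x with hB
  by_cases hfin : ∫⁻ x, B x ^ s = ∞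
  · rw [hfin, ENNReal.mul_top]
    · exact le_top
    · simp [hC20, hC2]
  set T : ℕ → Rn n → ℝ≥0∞ := fun N x =>
    ∑ μ ∈ Finset.range N, ballAvg ((2 : ℝ)⁻¹ ^ μ) (b μ) x with hT
  have hmT : ∀ N, Measurable (T N) := fun N =>
    Finset.measurable_fun_sum _ fun μ _ => measurable_ballAvg _ (hb μ)
  have key : ∀ N, ∫⁻ x, T N x ^ s ≤ C2 ^ (s - 1) * ∫⁻ x, B x ^ s := by
    intro N
    have hTM : ∀ x, T N x ≤ N * locMax B x := fun x => by
      calc T N x ≤ ∑ _μ ∈ Finset.range N, locMax B x := by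
            refine Finset.sum_le_sum fun μ _ => ?_
            exact (ballAvg_mono fun z _ => ENNReal.le_tsum μ).trans (ballAvg_le_locMax B μ x)
        _ = _ := by simp
    have hXfin : ∫⁻ x, T N x ^ s ≠ ∞ := by
      refine ne_top_of_le_ne_top ?_ (lintegral_mono fun x =>
        ENNReal.rpow_le_rpow (hTM x) hs0.le)
      simp_rw [ENNReal.mul_rpow_of_nonneg _ _ hs0.le]
      have hN : (N : ℝ≥0∞) ^ s ≠ ∞ := ENNReal.rpow_ne_top_of_nonneg hs0.le (ENNReal.natCast_ne_top N)
      rw [lintegral_const_mul' _ _ hN]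
      exact ENNReal.mul_ne_top hN (ne_top_of_le_ne_top (ENNReal.mul_ne_top hC1 hfin) (hM1 B hmB))
    set X := ∫⁻ x, T N x ^ s with hX
    have hmp : Measurable fun x => T N x ^ (s - 1) := (hmT N).pow_const _
    have hle : X ≤ ∫⁻ x, B x * locMax (fun z => T N z ^ (s - 1)) x := by
      calc X = ∫⁻ x, ∑ μ ∈ Finset.range N, T N x ^ (s - 1) * ballAvg ((2 : ℝ)⁻¹ ^ μ) (b μ) x := by
            refine lintegral_congr fun x => ?_
            rw [← Finset.mul_sum]
            change _ = T N x ^ (s - 1) * T N x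
            conv_lhs => rw [show s = (s - 1) + 1 by ring,
              ENNReal.rpow_add_of_nonneg _ _ hs1.le zero_le_one, ENNReal.rpow_one]
        _ = ∑ μ ∈ Finset.range N, ∫⁻ x, ballAvg ((2 : ℝ)⁻¹ ^ μ) (fun z => T N z ^ (s - 1)) x *
              b μ x := by
            rw [lintegral_finsetSum _ fun μ _ => Measurable.fun_mul hmp (measurable_ballAvg _ (hb μ))]
            exact Finset.sum_congr rfl fun μ _ => lintegral_mul_ballAvg _ (hb μ) hmp
        _ ≤ ∑ μ ∈ Finset.range N, ∫⁻ x, b μ x * locMax (fun z => T N z ^ (s - 1)) x := by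
            refine Finset.sum_le_sum fun μ _ => lintegral_mono fun x => ?_
            rw [mul_comm]
            gcongr
            exact ballAvg_le_locMax _ μ x
        _ = ∫⁻ x, ∑ μ ∈ Finset.range N, b μ x * locMax (fun z => T N z ^ (s - 1)) x :=
            (lintegral_finsetSum _ fun μ _ => Measurable.fun_mul (hb μ) (measurable_locMax hmp)).symm
        _ ≤ _ := by
            gcongr with x
            rw [← Finset.sum_mul]
            gcongr
            exact ENNReal.sum_le_tsum _
    have hpow : ∀ x, (T N x ^ (s - 1)) ^ s' = T N x ^ s := fun x => by
      rw [← ENNReal.rpow_mul, hs', mul_div_cancel₀ _ hs1.ne']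
    have hholder : X ≤ (∫⁻ x, B x ^ s) ^ (1 / s) * (C2 * X) ^ (1 / s') := by
      refine hle.trans ((ENNReal.lintegral_mul_le_Lp_mul_Lq volume hconj hmB.aemeasurable
        (measurable_locMax hmp).aemeasurable).trans ?_)
      gcongr
      refine (hM2 _ hmp).trans (le_of_eq ?_)
      simp_rw [hpow]
      rfl
    rcases eq_or_ne X 0 with hX0 | hX0
    · rw [hX0]; exact zero_le
    have h3 : X ^ (1 / s) ≤ (∫⁻ x, B x ^ s) ^ (1 / s) * C2 ^ (1 / s') := by
      have hne0 : X ^ (1 / s') ≠ 0 := by simp [hX0, hXfin]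
      have hnet : X ^ (1 / s') ≠ ∞ := ENNReal.rpow_ne_top_of_nonneg (by positivity) hXfin
      rw [← ENNReal.mul_le_mul_iff_left hne0 hnet, ← ENNReal.rpow_add _ _ hX0 hXfin]
      rw [show 1 / s + 1 / s' = 1 by simpa using hconj.inv_add_inv_eq_one, ENNReal.rpow_one]
      rw [ENNReal.mul_rpow_of_nonneg _ _ (by positivity), ← mul_assoc] at hholder
      exact hholder
    have h4 := ENNReal.rpow_le_rpow h3 hs0.le
    rw [ENNReal.mul_rpow_of_nonneg _ _ hs0.le, ← ENNReal.rpow_mul, ← ENNReal.rpow_mul,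
      ← ENNReal.rpow_mul, one_div_mul_cancel hs0.ne', ENNReal.rpow_one, ENNReal.rpow_one] at h4
    rw [mul_comm]
    convert h4 using 3
    rw [hs']
    field_simp
  have hsup : ∀ x, (∑' μ, ballAvg ((2 : ℝ)⁻¹ ^ μ) (b μ) x) ^ s = ⨆ N, T N x ^ s := fun x => by
    rw [ENNReal.tsum_eq_iSup_nat]
    exact (ENNReal.orderIsoRpow s hs0).map_iSup _
  simp_rw [hsup]
  rw [lintegral_iSup fun N => (hmT N).pow_const s]
  · exact iSup_le key
  · intro N N' h x
    exact ENNReal.rpow_le_rpow (Finset.sum_le_sum_of_subset (Finset.range_mono h)) hs0.le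

/-- The logarithmic weight `log (e + |x|)`. -/
def logWt (x : Rn n) : ℝ := Real.log (Real.exp 1 + ‖x‖)

lemma one_le_log_exp_one_add {t : ℝ} (ht : 0 ≤ t) : 1 ≤ Real.log (Real.exp 1 + t) := by
  rw [Real.le_log_iff_exp_le (by positivity)]
  linarith

lemma one_le_logWt (x : Rn n) : 1 ≤ logWt x := one_le_log_exp_one_add (norm_nonneg x)

lemma logWt_le_two_mul {x y : Rn n} (h : dist x y ≤ 2) : logWt x ≤ 2 * logWt y := by
  have he : 2 < Real.exp 1 := by have := Real.exp_one_gt_d9; linarith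
  have h1 : ‖x‖ ≤ ‖y‖ + 2 := by
    have := norm_le_norm_add_norm_sub' x y
    rw [dist_eq_norm] at h
    linarith
  rw [logWt, logWt, show 2 * Real.log (Real.exp 1 + ‖y‖) = ((2 : ℕ) : ℝ) * Real.log (Real.exp 1 + ‖y‖)
    by norm_num, ← Real.log_pow]
  refine Real.log_le_log (by positivity) ?_
  nlinarith [norm_nonneg y]

/-- Global log-Hölder continuity of a real function, with a limit value at infinity. -/
def IsLH (θ : Rn n → ℝ) (θinf : ℝ) : Prop :=
  ∃ c : ℝ, 0 ≤ c ∧ (∀ x y, |θ x - θ y| * Real.log (Real.exp 1 + (dist x y)⁻¹) ≤ c) ∧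
    ∀ x, |θ x - θinf| * logWt x ≤ c

lemma IsLH.of_le {θ θ' : Rn n → ℝ} {θinf θ'inf M : ℝ} (h : IsLH θ θinf) (hM : 0 ≤ M)
    (h1 : ∀ x y, |θ' x - θ' y| ≤ M * |θ x - θ y|) (h2 : ∀ x, |θ' x - θ'inf| ≤ M * |θ x - θinf|) :
    IsLH θ' θ'inf := by
  obtain ⟨c, hc, hx, hy⟩ := h
  refine ⟨M * c, by positivity, fun x y => ?_, fun x => ?_⟩
  · have hl := one_le_log_exp_one_add (inv_nonneg.2 (dist_nonneg (x := x) (y := y)))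
    calc _ ≤ M * |θ x - θ y| * Real.log (Real.exp 1 + (dist x y)⁻¹) := by
          gcongr
          exact h1 x y
      _ ≤ M * c := by
          rw [mul_assoc]
          exact mul_le_mul_of_nonneg_left (hx x y) hM
  · have hl := one_le_logWt x
    calc _ ≤ M * |θ x - θinf| * logWt x := by
          gcongr
          exact h2 x
      _ ≤ M * c := by
          rw [mul_assoc]
          exact mul_le_mul_of_nonneg_left (hy x) hM

lemma IsLH.affine {θ : Rn n → ℝ} {θinf : ℝ} (h : IsLH θ θinf) (a b : ℝ) :
    IsLH (fun x => a + b * θ x) (a + b * θinf) := by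
  refine h.of_le (abs_nonneg b) (fun x y => ?_) fun x => ?_ <;>
  · rw [← abs_mul]
    apply le_of_eq
    congr 1
    ring

lemma IsLH.mul {θ η : Rn n → ℝ} {θinf ηinf : ℝ} (h : IsLH θ θinf) (h' : IsLH η ηinf)
    {M : ℝ} (hM : ∀ x, |θ x| ≤ M) (hM' : ∀ x, |η x| ≤ M) (hMi : |ηinf| ≤ M) :
    IsLH (fun x => θ x * η x) (θinf * ηinf) := by
  obtain ⟨c, hc, hx, hy⟩ := h
  obtain ⟨c', hc', hx', hy'⟩ := h'
  have hM0 : 0 ≤ M := (abs_nonneg _).trans (hM 0)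
  have key : ∀ a b a' b' l : ℝ, 0 ≤ l → |a| ≤ M → |b'| ≤ M → |a - a'| * l ≤ c →
      |b - b'| * l ≤ c' → |a * b - a' * b'| * l ≤ M * (c + c') := by
    intro a b a' b' l hl ha hb h1 h2
    have h3 : |a * b - a' * b'| ≤ M * |a - a'| + M * |b - b'| := by
      rw [show a * b - a' * b' = a * (b - b') + (a - a') * b' by ring]
      refine (abs_add_le _ _).trans ?_
      rw [abs_mul, abs_mul, add_comm, mul_comm _ |b'|]
      gcongr
    calc _ ≤ (M * |a - a'| + M * |b - b'|) * l := by gcongr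
      _ = M * (|a - a'| * l + |b - b'| * l) := by ring
      _ ≤ _ := by gcongr
  refine ⟨M * (c + c'), by positivity, fun x y => ?_, fun x => ?_⟩
  · refine key _ _ _ _ _ ?_ (hM x) (hM' y) (hx x y) (hx' x y)
    linarith [one_le_log_exp_one_add (inv_nonneg.2 (dist_nonneg (x := x) (y := y)))]
  · exact key _ _ _ _ _ (by linarith [one_le_logWt x]) (hM x) hMi (hy x) (hy' x)

lemma IsLH.inv {θ : Rn n → ℝ} {θinf b : ℝ} (h : IsLH θ θinf) (hb : 0 < b) (h1 : ∀ x, b ≤ θ x)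
    (h2 : b ≤ θinf) : IsLH (fun x => (θ x)⁻¹) θinf⁻¹ := by
  have key : ∀ s t : ℝ, b ≤ s → b ≤ t → |s⁻¹ - t⁻¹| ≤ b⁻¹ * b⁻¹ * |s - t| := by
    intro s t hs ht
    have hs0 : 0 < s := hb.trans_le hs
    have ht0 : 0 < t := hb.trans_le ht
    rw [inv_sub_inv hs0.ne' ht0.ne', abs_div, abs_mul, abs_of_pos hs0, abs_of_pos ht0,
      abs_sub_comm, div_eq_mul_inv, mul_inv, mul_comm]
    gcongr
  exact h.of_le (by positivity) (fun x y => key _ _ (h1 x) (h1 y)) fun x => key _ _ (h1 x) h2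

/-- Log-Hölder control at scale `R`, both locally and at infinity. -/
lemma IsLH.abs_sub_mul_le {θ : Rn n → ℝ} {θinf : ℝ} (h : IsLH θ θinf) :
    ∃ C : ℝ, 0 ≤ C ∧ ∀ (x y : Rn n) (R : ℝ), 0 < R → R ≤ 2 → dist y x < R →
      |θ y - θ x| * (1 + |Real.log R| + logWt x) ≤ C := by
  obtain ⟨c, hc, hx, hy⟩ := h
  refine ⟨5 * c, by positivity, fun x y R hR hR2 hd => ?_⟩
  have hl := one_le_log_exp_one_add (inv_nonneg.2 (dist_nonneg (x := y) (y := x)))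
  have h0 := hx y x
  have habs := abs_nonneg (θ y - θ x)
  have h1 : |θ y - θ x| ≤ c := by nlinarith
  have h2 : |θ y - θ x| * |Real.log R| ≤ c := by
    rcases eq_or_ne (dist y x) 0 with hd0 | hd0
    · rw [dist_eq_zero.1 hd0]
      simpa using hc
    have hdpos : 0 < dist y x := lt_of_le_of_ne dist_nonneg hd0.symm
    refine le_trans (mul_le_mul_of_nonneg_left ?_ habs) h0
    rcases le_total R 1 with h | h
    · rw [abs_of_nonpos (Real.log_nonpos hR.le h), ← Real.log_inv]
      refine Real.log_le_log (by positivity) ?_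
      have : R⁻¹ ≤ (dist y x)⁻¹ := by gcongr
      linarith [Real.exp_pos 1]
    · rw [abs_of_nonneg (Real.log_nonneg h)]
      refine Real.log_le_log (by positivity) ?_
      have := Real.exp_one_gt_d9
      have := inv_pos.2 hdpos
      linarith
  have h3 : |θ y - θ x| * logWt x ≤ 3 * c := by
    have hlx := one_le_logWt x
    have h4 : logWt x ≤ 2 * logWt y := logWt_le_two_mul (by rw [dist_comm]; linarith)
    have h5 : |θ y - θ x| ≤ |θ y - θinf| + |θ x - θinf| := by
      rw [abs_sub_comm (θ x)]
      exact abs_sub_le _ _ _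
    have h6 := hy x
    have h7 := hy y
    calc _ ≤ (|θ y - θinf| + |θ x - θinf|) * logWt x := by gcongr
      _ = |θ y - θinf| * logWt x + |θ x - θinf| * logWt x := by ring
      _ ≤ |θ y - θinf| * (2 * logWt y) + |θ x - θinf| * logWt x := by gcongr
      _ ≤ _ := by linarith
  calc _ = |θ y - θ x| + |θ y - θ x| * |Real.log R| + |θ y - θ x| * logWt x := by ring
    _ ≤ _ := by linarith

/-- The range in which log-Hölder exponents may be frozen. -/
def InLogRange (K R : ℝ) (x : Rn n) (t : ℝ≥0∞) : Prop :=
  ENNReal.ofReal (Real.exp (-(K * (1 + |Real.log R| + logWt x)))) ≤ t ∧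
    t ≤ ENNReal.ofReal (Real.exp (K * (1 + |Real.log R| + logWt x)))

lemma InLogRange.ne_zero {K R : ℝ} {x : Rn n} {t : ℝ≥0∞} (h : InLogRange K R x t) : t ≠ 0 :=
  ((ENNReal.ofReal_pos.2 (Real.exp_pos _)).trans_le h.1).ne'

lemma InLogRange.ne_top {K R : ℝ} {x : Rn n} {t : ℝ≥0∞} (h : InLogRange K R x t) : t ≠ ∞ :=
  ne_top_of_le_ne_top ENNReal.ofReal_ne_top h.2

lemma InLogRange.rpow_le {K R : ℝ} {x : Rn n} {t : ℝ≥0∞} (h : InLogRange K R x t) (hK : 0 ≤ K)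
    {s C : ℝ} (hs : |s| * (1 + |Real.log R| + logWt x) ≤ C) :
    t ^ s ≤ ENNReal.ofReal (Real.exp (K * C)) := by
  set l := 1 + |Real.log R| + logWt x
  have hcalc : |s| * (K * l) ≤ K * C := by nlinarith
  rcases le_total 0 s with h0 | h0
  · calc t ^ s ≤ ENNReal.ofReal (Real.exp (K * l)) ^ s := ENNReal.rpow_le_rpow h.2 h0
      _ ≤ _ := by
        rw [ENNReal.ofReal_rpow_of_pos (Real.exp_pos _), ← Real.exp_mul]
        refine ENNReal.ofReal_le_ofReal (Real.exp_le_exp.2 ?_)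
        rw [abs_of_nonneg h0] at hcalc
        linarith
  · calc t ^ s ≤ ENNReal.ofReal (Real.exp (-(K * l))) ^ s := by
          have := rpow_neg_le_rpow_neg h.1 (neg_nonneg.2 h0)
          rwa [neg_neg] at this
      _ ≤ _ := by
        rw [ENNReal.ofReal_rpow_of_pos (Real.exp_pos _), ← Real.exp_mul]
        refine ENNReal.ofReal_le_ofReal (Real.exp_le_exp.2 ?_)
        rw [abs_of_nonpos h0] at hcalc
        linarith

lemma prod_rpow_const_eq {ι : Type*} (s : Finset ι) (M : ℝ≥0∞) (w : ι → ℝ) (hw : ∀ i, 0 ≤ w i) :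
    ∏ i ∈ s, M ^ w i = M ^ ∑ i ∈ s, w i := by
  classical
  induction s using Finset.induction_on with
  | empty => simp
  | insert i s hi ih =>
    rw [Finset.prod_insert hi, Finset.sum_insert hi, ih,
      ENNReal.rpow_add_of_nonneg _ _ (hw i) (Finset.sum_nonneg fun i _ => hw i)]

/-- Averages of geometric means with log-Hölder weights. -/
theorem exists_ballAvg_prod_rpow_le {ι : Type*} [Fintype ι] {w : ι → Rn n → ℝ} {winf : ι → ℝ}
    (hw0 : ∀ i x, 0 ≤ w i x) (hw1 : ∀ x, ∑ i, w i x = 1) (hw : ∀ i, IsLH (w i) (winf i)) {K : ℝ}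
    (hK : 0 ≤ K) :
    ∃ C : ℝ≥0∞, C ≠ ∞ ∧ ∀ (R : ℝ) (x : Rn n) (f : ι → Rn n → ℝ≥0∞) (a : ι → ℝ≥0∞),
      0 < R → R ≤ 2 → (∀ i, Measurable (f i)) → (∀ i, ballAvg R (f i) x ≤ a i) →
      (∀ i, InLogRange K R x (a i)) →
      ballAvg R (fun z => ∏ i, f i z ^ w i z) x ≤ C * ∏ i, a i ^ w i x := by
  choose c hc hcx using fun i => (hw i).abs_sub_mul_le
  set E : ℝ≥0∞ := ∏ i, ENNReal.ofReal (Real.exp (K * c i)) with hE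
  refine ⟨E * Fintype.card ι, ?_, ?_⟩
  · refine ENNReal.mul_ne_top (ENNReal.prod_ne_top fun i _ => ENNReal.ofReal_ne_top)
      (ENNReal.natCast_ne_top _)
  intro R x f a hR hR2 hf hfa ha
  set X : ℝ≥0∞ := ∏ i, a i ^ w i x with hX
  have hpt : ∀ z ∈ Metric.ball x R, ∏ i, f i z ^ w i z ≤ E * X * ∑ i, (a i)⁻¹ * f i z := by
    intro z hz
    have h1 : ∀ i, f i z ^ w i z ≤ ENNReal.ofReal (Real.exp (K * c i)) * a i ^ w i x *
        (∑ j, (a j)⁻¹ * f j z) ^ w i z := by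
      intro i
      have hi0 := (ha i).ne_zero
      have hit := (ha i).ne_top
      have h2 : f i z ≤ a i * ∑ j, (a j)⁻¹ * f j z := by
        calc f i z = a i * ((a i)⁻¹ * f i z) := by
              rw [← mul_assoc, ENNReal.mul_inv_cancel hi0 hit, one_mul]
          _ ≤ _ := by
              gcongr
              exact Finset.single_le_sum (f := fun j => (a j)⁻¹ * f j z) (fun _ _ => zero_le)
                (Finset.mem_univ i)
      calc f i z ^ w i z ≤ (a i * ∑ j, (a j)⁻¹ * f j z) ^ w i z :=
            ENNReal.rpow_le_rpow h2 (hw0 i z)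
        _ = a i ^ (w i z - w i x) * a i ^ w i x * (∑ j, (a j)⁻¹ * f j z) ^ w i z := by
            rw [ENNReal.mul_rpow_of_nonneg _ _ (hw0 i z), ← ENNReal.rpow_add _ _ hi0 hit,
              sub_add_cancel]
        _ ≤ _ := by
            gcongr
            exact (ha i).rpow_le hK (hcx i x z R hR hR2 hz)
    calc ∏ i, f i z ^ w i z ≤ ∏ i, (ENNReal.ofReal (Real.exp (K * c i)) * a i ^ w i x *
        (∑ j, (a j)⁻¹ * f j z) ^ w i z) := Finset.prod_le_prod' fun i _ => h1 i
      _ = _ := by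
        rw [Finset.prod_mul_distrib, Finset.prod_mul_distrib,
          prod_rpow_const_eq _ _ _ fun i => hw0 i z, hw1, ENNReal.rpow_one]
  calc ballAvg R (fun z => ∏ i, f i z ^ w i z) x
      ≤ ballAvg R (fun z => E * X * ∑ i, (a i)⁻¹ * f i z) x := ballAvg_mono hpt
    _ = E * X * ∑ i, (a i)⁻¹ * ballAvg R (f i) x := by
        rw [ballAvg_const_mul (Finset.measurable_fun_sum _ fun i _ => (hf i).const_mul _)]
        congr 1
        rw [ballAvg, lintegral_finsetSum _ fun i _ => (hf i).const_mul _, Finset.mul_sum]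
        refine Finset.sum_congr rfl fun i _ => ?_
        rw [← ballAvg_const_mul (hf i), ballAvg]
    _ ≤ E * X * ∑ _i : ι, 1 := by
        gcongr with i
        calc (a i)⁻¹ * ballAvg R (f i) x ≤ (a i)⁻¹ * a i := by
              gcongr
              exact hfa i
          _ ≤ 1 := ENNReal.inv_mul_le_one _
    _ = E * Fintype.card ι * X := by
        simp only [Finset.sum_const, Finset.card_univ, nsmul_eq_mul, mul_one]
        ring

/-- The polynomially decaying function `(e + |x|)^(-K)`. -/
def decay (K : ℝ) (x : Rn n) : ℝ≥0∞ := ENNReal.ofReal (Real.exp (-(K * logWt x)))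

lemma measurable_logWt : Measurable (logWt : Rn n → ℝ) := by
  unfold logWt
  fun_prop

lemma measurable_decay (K : ℝ) : Measurable (decay K : Rn n → ℝ≥0∞) := by
  have := measurable_logWt (n := n)
  unfold decay
  fun_prop

lemma decay_le_one {K : ℝ} (hK : 0 ≤ K) (x : Rn n) : decay K x ≤ 1 := by
  rw [decay, ENNReal.ofReal_le_one, Real.exp_le_one_iff]
  have := one_le_logWt x
  have : 0 ≤ K * logWt x := by positivity
  linarith

lemma decay_le_dyBr {K : ℝ} (hK : 0 ≤ K) (x : Rn n) : decay K x ≤ dyBr 0 0 x ^ (-K) := by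
  have h : decay K x = ENNReal.ofReal (Real.exp 1 + ‖x‖) ^ (-K) := by
    rw [decay, ENNReal.ofReal_rpow_of_pos (by positivity), Real.rpow_def_of_pos (by positivity),
      logWt]
    congr 2
    ring
  rw [h]
  refine rpow_neg_le_rpow_neg ?_ hK
  rw [dyBr]
  refine ENNReal.ofReal_le_ofReal ?_
  have := Real.exp_one_gt_d9
  simp only [pow_zero, zero_sub, norm_neg, one_mul]
  linarith

lemma lintegral_decay_lt_top {K : ℝ} (hK : n < K) : ∫⁻ x : Rn n, decay K x < ∞ := by
  have hK0 : 0 ≤ K := (Nat.cast_nonneg n).trans hK.le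
  refine (lintegral_mono fun x => decay_le_dyBr hK0 x).trans_lt ?_
  have := lintegral_dyBr_rpow_lt_top hK (0 : Rn n)
  simpa using this

lemma rpow_le_self_of_le_one' {h : ℝ≥0∞} (h1 : h ≤ 1) {τ : ℝ} (hτ : 1 ≤ τ) : h ^ τ ≤ h := by
  conv_rhs => rw [← ENNReal.rpow_one h]
  exact ENNReal.rpow_le_rpow_of_exponent_ge h1 hτ

/-- Exponents bounded away from one and infinity whose reciprocal is log-Hölder continuous. -/
structure LHExponent (P : Rn n → ℝ) (b d θinf : ℝ) : Prop where
  measurable : Measurable P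
  one_lt : 1 < b
  ge : ∀ x, b ≤ P x
  le : ∀ x, P x ≤ d
  inv_isLH : IsLH (fun x => (P x)⁻¹) θinf

lemma LHExponent.gt_one {P : Rn n → ℝ} {b d θinf : ℝ} (h : LHExponent P b d θinf) (x : Rn n) :
    1 < P x := h.one_lt.trans_le (h.ge x)

lemma LHExponent.pos {P : Rn n → ℝ} {b d θinf : ℝ} (h : LHExponent P b d θinf) (x : Rn n) :
    0 < P x := zero_lt_one.trans (h.gt_one x)

lemma LHExponent.one_le_hi {P : Rn n → ℝ} {b d θinf : ℝ} (h : LHExponent P b d θinf) :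
    1 < d := (h.gt_one 0).trans_le (h.le 0)

lemma tsum_mul_rpow_rpow_le (f g : ℕ → ℝ≥0∞) {φ : ℝ} (h0 : 0 ≤ φ) (h1 : φ ≤ 1) :
    ∑' μ, f μ ^ (1 - φ) * g μ ^ φ ≤ (∑' μ, f μ) ^ (1 - φ) * (∑' μ, g μ) ^ φ := by
  have := ENNReal.lintegral_mul_norm_pow_le (μ := Measure.count) (f := f) (g := g)
    (measurable_of_countable _).aemeasurable (measurable_of_countable _).aemeasurable
    (sub_nonneg.2 h1) h0 (by ring)
  simpa only [lintegral_count] using this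

lemma tsum_ballAvg_part_bound {τ : ℝ} (hτ : 1 < τ) (n : ℕ) :
    ∃ C : ℝ≥0∞, C ≠ ∞ ∧ ∀ (D : Rn n → ℝ≥0∞) (β : ℕ → Rn n → ℝ≥0∞), Measurable D →
      (∀ μ, Measurable (β μ)) → (∀ x, ∑' μ, β μ x ≤ 1) → ∫⁻ x, D x ≤ 1 →
      ∫⁻ x, ((locMax (fun z => D z ^ τ⁻¹) x + decay (n + 1) x) ^ τ +
        (∑' μ, ballAvg ((2 : ℝ)⁻¹ ^ μ) (fun z => β μ z * D z ^ τ⁻¹) x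
          + 2 * decay (n + 1) x) ^ τ) ≤ C := by
  have hτ0 : 0 < τ := by linarith
  obtain ⟨C1, hC1, hM⟩ := exists_lintegral_locMax_rpow_le n hτ
  obtain ⟨C2, hC2, hT⟩ := exists_lintegral_tsum_ballAvg_rpow_le n hτ
  set H : ℝ≥0∞ := ∫⁻ x : Rn n, decay (n + 1) x with hH
  have hHt : H ≠ ∞ := (lintegral_decay_lt_top (by linarith)).ne
  have h2t : (2 : ℝ≥0∞) ^ (τ - 1) ≠ ∞ := two_rpow_ne_top _
  have h2t' : (2 : ℝ≥0∞) ^ τ ≠ ∞ := two_rpow_ne_top _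
  refine ⟨2 ^ (τ - 1) * (C1 + H) + 2 ^ (τ - 1) * (C2 + 2 ^ τ * H), by finiteness, ?_⟩
  intro D β hD hβ hβ1 hD1
  have hmD : Measurable fun z => D z ^ τ⁻¹ := hD.pow_const _
  have hpow : ∀ z, (D z ^ τ⁻¹) ^ τ = D z := fun z => by
    rw [← ENNReal.rpow_mul, inv_mul_cancel₀ hτ0.ne', ENNReal.rpow_one]
  have hdec := measurable_decay (n := n) ((n : ℝ) + 1)
  have hdecpow : ∀ x : Rn n, decay (n + 1) x ^ τ ≤ decay (n + 1) x := fun x =>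
    rpow_le_self_of_le_one' (decay_le_one (by positivity) x) hτ.le
  have hml := measurable_locMax hmD
  have hms : Measurable fun x => ∑' μ, ballAvg ((2 : ℝ)⁻¹ ^ μ) (fun z => β μ z * D z ^ τ⁻¹) x :=
    Measurable.tsum fun μ => measurable_ballAvg _ ((hβ μ).mul hmD)
  rw [lintegral_add_left ((Measurable.fun_add hml hdec).pow_const τ)]
  gcongr ?_ + ?_
  · calc ∫⁻ x, (locMax (fun z => D z ^ τ⁻¹) x + decay (n + 1) x) ^ τ
        ≤ ∫⁻ x, 2 ^ (τ - 1) * (locMax (fun z => D z ^ τ⁻¹) x ^ τ + decay (n + 1) x) := by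
          gcongr with x
          refine (ENNReal.rpow_add_le_mul_rpow_add_rpow _ _ hτ.le).trans ?_
          gcongr
          exact hdecpow x
      _ = 2 ^ (τ - 1) * ((∫⁻ x, locMax (fun z => D z ^ τ⁻¹) x ^ τ) + H) := by
          rw [lintegral_const_mul' _ _ h2t, lintegral_add_right _ hdec]
      _ ≤ _ := by
          gcongr
          refine (hM _ hmD).trans ?_
          simp_rw [hpow]
          calc C1 * ∫⁻ x, D x ≤ C1 * 1 := by gcongr
            _ = C1 := mul_one _
  · calc ∫⁻ x, (∑' μ, ballAvg ((2 : ℝ)⁻¹ ^ μ) (fun z => β μ z * D z ^ τ⁻¹) x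
          + 2 * decay (n + 1) x) ^ τ
        ≤ ∫⁻ x, 2 ^ (τ - 1) * ((∑' μ, ballAvg ((2 : ℝ)⁻¹ ^ μ) (fun z => β μ z * D z ^ τ⁻¹) x) ^ τ
            + 2 ^ τ * decay (n + 1) x) := by
          gcongr with x
          refine (ENNReal.rpow_add_le_mul_rpow_add_rpow _ _ hτ.le).trans ?_
          rw [ENNReal.mul_rpow_of_nonneg _ _ hτ0.le]
          gcongr
          exact hdecpow x
      _ = 2 ^ (τ - 1) * ((∫⁻ x, (∑' μ, ballAvg ((2 : ℝ)⁻¹ ^ μ)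
            (fun z => β μ z * D z ^ τ⁻¹) x) ^ τ) + 2 ^ τ * H) := by
          rw [lintegral_const_mul' _ _ h2t, lintegral_add_right _ (hdec.const_mul _),
            lintegral_const_mul' _ _ h2t']
      _ ≤ _ := by
          gcongr
          refine (hT (fun μ z => β μ z * D z ^ τ⁻¹) fun μ => (hβ μ).mul hmD).trans ?_
          calc C2 * ∫⁻ x, (∑' μ, β μ x * D x ^ τ⁻¹) ^ τ ≤ C2 * ∫⁻ x, D x := by
                gcongr with x
                rw [ENNReal.tsum_mul_right]
                calc ((∑' μ, β μ x) * D x ^ τ⁻¹) ^ τ ≤ (1 * D x ^ τ⁻¹) ^ τ := by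
                      gcongr
                      exact hβ1 x
                  _ = D x := by rw [one_mul, hpow]
            _ ≤ C2 * 1 := by gcongr
            _ = C2 := mul_one _

lemma inLogRange_add_decay {A : ℝ≥0∞} {R : ℝ} (hR : 0 < R) (hR1 : R ≤ 1) (x : Rn n)
    (hA : A ≤ unitVol n + (ENNReal.ofReal R)⁻¹ ^ n) :
    InLogRange (n + 1 + (unitVol n).toReal) R x (A + ENNReal.ofReal R * decay (n + 1) x) := by
  set v := (unitVol n).toReal with hv
  have hv0 : 0 ≤ v := ENNReal.toReal_nonneg
  have hn0 : (0 : ℝ) ≤ n := Nat.cast_nonneg n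
  have hl := Real.log_nonpos hR.le hR1
  have habs : |Real.log R| = -Real.log R := abs_of_nonpos hl
  have hL := one_le_logWt x
  constructor
  · refine le_add_left ?_
    rw [decay, ← ENNReal.ofReal_mul hR.le]
    refine ENNReal.ofReal_le_ofReal ?_
    rw [← Real.exp_log hR, ← Real.exp_add, Real.exp_le_exp, Real.exp_log hR, habs]
    have h1 : (n + 1) * logWt x ≤ (n + 1 + v) * logWt x :=
      mul_le_mul_of_nonneg_right (by linarith) (by linarith)
    have h2 : 1 * (-Real.log R) ≤ (n + 1 + v) * (-Real.log R) :=
      mul_le_mul_of_nonneg_right (by linarith) (by linarith)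
    have h3 : 0 ≤ (n : ℝ) + 1 + v := by positivity
    nlinarith
  · have hinv : (ENNReal.ofReal R)⁻¹ ^ n = ENNReal.ofReal (R⁻¹ ^ n) := by
      rw [← ENNReal.ofReal_inv_of_pos hR, ENNReal.ofReal_pow (by positivity)]
    have hone : 1 ≤ R⁻¹ ^ n := one_le_pow₀ ((one_le_inv₀ hR).2 hR1)
    have hd : ENNReal.ofReal R * decay (n + 1) x ≤ 1 :=
      mul_le_one₀ (ENNReal.ofReal_le_one.2 hR1) zero_le (decay_le_one (by positivity) x)
    calc A + ENNReal.ofReal R * decay (n + 1) x ≤ unitVol n + (ENNReal.ofReal R)⁻¹ ^ n + 1 :=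
          add_le_add hA hd
      _ = ENNReal.ofReal (v + R⁻¹ ^ n + 1) := by
          rw [hinv, ENNReal.ofReal_add (by positivity) zero_le_one,
            ENNReal.ofReal_add hv0 (by positivity), hv, ENNReal.ofReal_toReal (unitVol_ne_top n),
            ENNReal.ofReal_one]
      _ ≤ _ := by
          refine ENNReal.ofReal_le_ofReal ?_
          have h1 : v + R⁻¹ ^ n + 1 ≤ (v + 2) * R⁻¹ ^ n := by nlinarith
          have h2 : R⁻¹ ^ n = Real.exp (n * |Real.log R|) := by
            rw [habs, ← Real.log_inv, Real.exp_nat_mul, Real.exp_log (by positivity)]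
          have h3 : v + 2 ≤ Real.exp (n + 1 + v) := by
            have := Real.add_one_le_exp (n + 1 + v)
            linarith
          refine h1.trans ?_
          rw [h2]
          calc (v + 2) * Real.exp (n * |Real.log R|)
              ≤ Real.exp (n + 1 + v) * Real.exp (n * |Real.log R|) := by gcongr
            _ ≤ _ := by
              rw [← Real.exp_add, Real.exp_le_exp]
              have h4 : n * |Real.log R| ≤ (n + 1 + v) * |Real.log R| :=
                mul_le_mul_of_nonneg_right (by linarith) (abs_nonneg _)
              have h5 : 0 ≤ (n + 1 + v) * logWt x := by positivity
              nlinarith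

lemma ballAvg_le_of_le_one_add {f D : Rn n → ℝ≥0∞} (hD : ∫⁻ x, D x ≤ 1)
    (h : ∀ x, f x ≤ 1 + D x) {R : ℝ} (hR : 0 < R) (x : Rn n) :
    ballAvg R f x ≤ unitVol n + (ENNReal.ofReal R)⁻¹ ^ n := by
  calc ballAvg R f x ≤ ballAvg R (fun z => 1 + D z) x := ballAvg_mono fun z _ => h z
    _ = unitVol n + ballAvg R D x := by
        rw [ballAvg_add measurable_const, ballAvg_const hR, mul_one]
    _ ≤ unitVol n + (ENNReal.ofReal R)⁻¹ ^ n * 1 := by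
        rw [ballAvg]
        gcongr
        exact (setLIntegral_le_lintegral _ _).trans hD
    _ = _ := by rw [mul_one]

lemma rpow_inv_le_one_add {τ : ℝ} (hτ : 1 ≤ τ) (t : ℝ≥0∞) : t ^ τ⁻¹ ≤ 1 + t := by
  rcases le_total t 1 with h | h
  · exact le_add_right (ENNReal.rpow_le_one h (by positivity))
  · refine le_add_left ?_
    conv_rhs => rw [← ENNReal.rpow_one t]
    exact ENNReal.rpow_le_rpow_of_exponent_le h (inv_le_one_of_one_le₀ hτ)

lemma ballAvg_mono_ae {f g : Rn n → ℝ≥0∞} (h : ∀ᵐ z, f z ≤ g z) (R : ℝ) (x : Rn n) :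
    ballAvg R f x ≤ ballAvg R g x := by
  unfold ballAvg
  gcongr 1
  exact lintegral_mono_ae (ae_restrict_of_ae h)

/-- Weights of the double interpolation between two Lebesgue exponents and two summation
exponents. -/
def interpWt (φ θ : Rn n → ℝ) (i : Bool × Bool) (x : Rn n) : ℝ :=
  (if i.1 then φ x else 1 - φ x) * (if i.2 then θ x else 1 - θ x)

lemma exists_isLH_interpWt {φ θ : Rn n → ℝ} {φinf θinf : ℝ} (hφ : IsLH φ φinf) (hθ : IsLH θ θinf)
    (hφ0 : ∀ x, 0 ≤ φ x) (hφ1 : ∀ x, φ x ≤ 1) (hθ0 : ∀ x, 0 ≤ θ x) (hθ1 : ∀ x, θ x ≤ 1)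
    (i : Bool × Bool) : ∃ winf, IsLH (interpWt φ θ i) winf := by
  have h1 : ∀ (η : Rn n → ℝ) (ηinf : ℝ), IsLH η ηinf → (∀ x, 0 ≤ η x) → (∀ x, η x ≤ 1) → ∀ b : Bool,
      ∃ c, IsLH (fun x => if b then η x else 1 - η x) c ∧
        ∀ x, |if b then η x else 1 - η x| ≤ 1 := by
    intro η ηinf hη h0 h1 b
    cases b
    · refine ⟨1 + (-1) * ηinf, ?_, fun x => ?_⟩
      · convert hη.affine 1 (-1) using 2
        simp only [Bool.false_eq_true, if_false]
        ring
      · simp only [Bool.false_eq_true, if_false]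
        rw [abs_le]
        constructor <;> linarith [h0 x, h1 x]
    · refine ⟨ηinf, by simpa using hη, fun x => ?_⟩
      simp only [if_true]
      rw [abs_le]
      constructor <;> linarith [h0 x, h1 x]
  obtain ⟨c1, hc1, hb1⟩ := h1 φ φinf hφ hφ0 hφ1 i.1
  obtain ⟨c2, hc2, hb2⟩ := h1 θ θinf hθ hθ0 hθ1 i.2
  have hM : (1 : ℝ) ≤ 1 + |c2| := by linarith [abs_nonneg c2]
  exact ⟨_, hc1.mul hc2 (M := 1 + |c2|) (fun x => (hb1 x).trans hM) (fun x => (hb2 x).trans hM)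
    (by linarith)⟩

lemma interpWt_nonneg {φ θ : Rn n → ℝ} {x : Rn n} (hφ0 : 0 ≤ φ x) (hφ1 : φ x ≤ 1)
    (hθ0 : 0 ≤ θ x) (hθ1 : θ x ≤ 1) (i : Bool × Bool) : 0 ≤ interpWt φ θ i x := by
  unfold interpWt
  refine mul_nonneg ?_ ?_ <;> split_ifs <;> linarith

lemma sum_interpWt (φ θ : Rn n → ℝ) (x : Rn n) : ∑ i, interpWt φ θ i x = 1 := by
  simp [interpWt, Fintype.sum_prod_type]
  ring

/-- Factorisation of a sequence through its mixed density. -/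
lemma le_prod_interpWt {g S : ℝ≥0∞} {P Q s t : ℝ} {φ θ : Rn n → ℝ} {x : Rn n} (hP : 0 < P)
    (hQ : 0 < Q) (hs : 0 < s) (ht : 0 < t) (hφ0 : 0 ≤ φ x) (hφ1 : φ x ≤ 1) (hθ : θ x = Q⁻¹)
    (hθ1 : θ x ≤ 1) (hφP : (1 - φ x) * s⁻¹ + φ x * t⁻¹ = P⁻¹) (hgS : g ^ Q ≤ S) (hS : S ≠ ∞) :
    g ≤ ∏ i : Bool × Bool, ((if i.2 then g ^ Q / S else 1) *
      (S ^ (P / Q)) ^ (if i.1 then t else s)⁻¹) ^ interpWt φ θ i x := by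
  rcases eq_or_ne S 0 with hS0 | hS0
  · have : g = 0 := by
      rw [hS0, nonpos_iff_eq_zero, ENNReal.rpow_eq_zero_iff_of_pos hQ] at hgS
      exact hgS
    rw [this]
    exact zero_le
  have hθ0 : 0 ≤ θ x := by rw [hθ]; positivity
  set D := S ^ (P / Q) with hD
  set β := g ^ Q / S with hβ
  have h1φ := sub_nonneg.2 hφ1
  have h1θ := sub_nonneg.2 hθ1
  have hDS : D ^ P⁻¹ * β ^ Q⁻¹ = g := by
    rw [hD, ← ENNReal.rpow_mul, show P / Q * P⁻¹ = Q⁻¹ by field_simp,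
      ← ENNReal.mul_rpow_of_nonneg _ _ (by positivity), hβ, ENNReal.mul_div_cancel hS0 hS,
      ← ENNReal.rpow_mul, mul_inv_cancel₀ hQ.ne', ENNReal.rpow_one]
  refine le_of_eq ?_
  conv_lhs => rw [← hDS]
  simp only [Fintype.prod_prod_type, Fintype.prod_bool, interpWt, if_true, Bool.false_eq_true,
    if_false, one_mul]
  rw [ENNReal.mul_rpow_of_nonneg _ _ (mul_nonneg hφ0 hθ0),
    ENNReal.mul_rpow_of_nonneg _ _ (mul_nonneg h1φ hθ0)]
  simp only [← ENNReal.rpow_mul]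
  have e1 : D ^ P⁻¹ = D ^ (t⁻¹ * (φ x * θ x)) * D ^ (t⁻¹ * (φ x * (1 - θ x))) *
      (D ^ (s⁻¹ * ((1 - φ x) * θ x)) * D ^ (s⁻¹ * ((1 - φ x) * (1 - θ x)))) := by
    rw [← ENNReal.rpow_add_of_nonneg _ _ (by positivity) (by positivity),
      ← ENNReal.rpow_add_of_nonneg _ _ (by positivity) (by positivity),
      ← ENNReal.rpow_add_of_nonneg _ _ (by positivity) (by positivity), ← hφP]
    congr 1
    ring
  have e2 : β ^ Q⁻¹ = β ^ (φ x * θ x) * β ^ ((1 - φ x) * θ x) := by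
    rw [← ENNReal.rpow_add_of_nonneg _ _ (by positivity) (by positivity), ← hθ]
    congr 1
    ring
  rw [e1, e2]
  ring

/-- Recombination of the four interpolated averages. -/
lemma interp_recombine {P Q s t : ℝ} {φ θ : Rn n → ℝ} {x : Rn n} (hP : 0 < P)
    (hQ : 0 < Q) (hs : 0 < s) (ht : 0 < t) (hφ0 : 0 ≤ φ x) (hφ1 : φ x ≤ 1) (hθ : θ x = Q⁻¹)
    (hθ1 : θ x ≤ 1) (hφP : (1 - φ x) * s⁻¹ + φ x * t⁻¹ = P⁻¹) {G : ℕ → ℝ≥0∞}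
    {a : ℕ → Bool × Bool → ℝ≥0∞} {C : ℝ≥0∞} {Y T : Bool → ℝ≥0∞}
    (hG : ∀ μ, G μ ≤ C * ∏ i, a μ i ^ interpWt φ θ i x)
    (hY : ∀ μ b, a μ (b, false) ≤ Y b) (hT : ∀ b, ∑' μ, a μ (b, true) ≤ T b) :
    (∑' μ, G μ ^ Q) ^ (P / Q) ≤
      C ^ P * ((Y false ^ s + T false ^ s) + (Y true ^ t + T true ^ t)) := by
  have hθ0 : 0 ≤ θ x := by rw [hθ]; positivity
  have h1φ := sub_nonneg.2 hφ1
  have h1θ := sub_nonneg.2 hθ1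
  have hQθ : θ x * Q = 1 := by rw [hθ, inv_mul_cancel₀ hQ.ne']
  set M : ℝ≥0∞ := (Y false ^ s + T false ^ s) + (Y true ^ t + T true ^ t) with hM
  have hYf : Y false ≤ M ^ s⁻¹ := by
    rw [ENNReal.le_rpow_inv_iff hs, hM]
    exact le_add_right le_self_add
  have hTf : T false ≤ M ^ s⁻¹ := by
    rw [ENNReal.le_rpow_inv_iff hs, hM]
    exact le_add_right le_add_self
  have hYt : Y true ≤ M ^ t⁻¹ := by
    rw [ENNReal.le_rpow_inv_iff ht, hM]
    exact le_add_left le_self_add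
  have hTt : T true ≤ M ^ t⁻¹ := by
    rw [ENNReal.le_rpow_inv_iff ht, hM]
    exact le_add_left le_add_self
  have hterm : ∀ μ, G μ ^ Q ≤ C ^ Q * (M ^ (((1 - φ x) * s⁻¹ + φ x * t⁻¹) * (Q - 1)) *
      (a μ (false, true) ^ (1 - φ x) * a μ (true, true) ^ φ x)) := by
    intro μ
    have hQ1 : (1 - θ x) * Q = Q - 1 := by rw [sub_mul, hQθ, one_mul]
    have hQ1' : 0 ≤ Q - 1 := by rw [← hQ1]; positivity
    refine (ENNReal.rpow_le_rpow (hG μ) hQ.le).trans ?_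
    rw [ENNReal.mul_rpow_of_nonneg _ _ hQ.le]
    gcongr 1
    simp only [Fintype.prod_prod_type, Fintype.prod_bool, interpWt, if_true, Bool.false_eq_true,
      if_false]
    simp only [ENNReal.mul_rpow_of_nonneg _ _ hQ.le, ← ENNReal.rpow_mul]
    rw [mul_assoc (φ x), mul_assoc (φ x), mul_assoc (1 - φ x), mul_assoc (1 - φ x), hQθ, hQ1,
      mul_one, mul_one]
    calc _ ≤ a μ (true, true) ^ φ x * (M ^ t⁻¹) ^ (φ x * (Q - 1)) *
          (a μ (false, true) ^ (1 - φ x) * (M ^ s⁻¹) ^ ((1 - φ x) * (Q - 1))) := by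
          gcongr
          · exact (hY μ true).trans hYt
          · exact (hY μ false).trans hYf
      _ = _ := by
          rw [add_mul, ENNReal.rpow_add_of_nonneg _ _ (by positivity) (by positivity),
            ← ENNReal.rpow_mul, ← ENNReal.rpow_mul, ← mul_assoc t⁻¹, ← mul_assoc s⁻¹,
            mul_comm t⁻¹, mul_comm s⁻¹]
          ring
  have hsum : ∑' μ, G μ ^ Q ≤ C ^ Q * M ^ (P⁻¹ * Q) := by
    calc ∑' μ, G μ ^ Q ≤ ∑' μ, C ^ Q * (M ^ (((1 - φ x) * s⁻¹ + φ x * t⁻¹) * (Q - 1)) *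
          (a μ (false, true) ^ (1 - φ x) * a μ (true, true) ^ φ x)) := ENNReal.tsum_le_tsum hterm
      _ = C ^ Q * (M ^ (P⁻¹ * (Q - 1)) *
          ∑' μ, a μ (false, true) ^ (1 - φ x) * a μ (true, true) ^ φ x) := by
          rw [ENNReal.tsum_mul_left, ENNReal.tsum_mul_left, hφP]
      _ ≤ C ^ Q * (M ^ (P⁻¹ * (Q - 1)) * ((M ^ s⁻¹) ^ (1 - φ x) * (M ^ t⁻¹) ^ φ x)) := by
          gcongr
          refine (tsum_mul_rpow_rpow_le _ _ hφ0 hφ1).trans ?_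
          gcongr
          · exact (hT false).trans hTf
          · exact (hT true).trans hTt
      _ = C ^ Q * M ^ (P⁻¹ * Q) := by
          have hQ1 : 0 ≤ Q - 1 := by
            have : (1 - θ x) * Q = Q - 1 := by rw [sub_mul, hQθ, one_mul]
            rw [← this]; positivity
          rw [← ENNReal.rpow_mul, ← ENNReal.rpow_mul,
            ← ENNReal.rpow_add_of_nonneg _ _ (by positivity) (by positivity),
            ← ENNReal.rpow_add_of_nonneg _ _ (by positivity) (by positivity)]
          congr 2
          rw [← mul_comm (1 - φ x), ← mul_comm (φ x), hφP]
          ring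
  calc (∑' μ, G μ ^ Q) ^ (P / Q) ≤ (C ^ Q * M ^ (P⁻¹ * Q)) ^ (P / Q) :=
        ENNReal.rpow_le_rpow hsum (by positivity)
    _ = C ^ P * M := by
        rw [ENNReal.mul_rpow_of_nonneg _ _ (by positivity), ← ENNReal.rpow_mul, ← ENNReal.rpow_mul,
          mul_div_cancel₀ _ hQ.ne', show P⁻¹ * Q * (P / Q) = 1 by field_simp, ENNReal.rpow_one]

lemma tsum_two_inv_pow_mul (c : ℝ≥0∞) :
    ∑' μ : ℕ, ENNReal.ofReal ((2 : ℝ)⁻¹ ^ μ) * c = 2 * c := by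
  rw [ENNReal.tsum_mul_right]
  congr 1
  have h : ∀ μ : ℕ, ENNReal.ofReal ((2 : ℝ)⁻¹ ^ μ) = (2 : ℝ≥0∞)⁻¹ ^ μ := fun μ => by
    rw [ENNReal.ofReal_pow (by norm_num), ENNReal.ofReal_inv_of_pos two_pos, ENNReal.ofReal_ofNat]
  simp_rw [h]
  rw [ENNReal.tsum_geometric, ENNReal.one_sub_inv_two, inv_inv]

/-- Boundedness of local averages at varying scales in the mixed modular. -/
theorem exists_modular_ballAvg_le {P Q : Rn n → ℝ} {bP dP tP bQ dQ tQ : ℝ}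
    (hP : LHExponent P bP dP tP) (hQ : LHExponent Q bQ dQ tQ) :
    ∃ C : ℝ≥0∞, C ≠ ∞ ∧ ∀ g : ℕ → Rn n → ℝ≥0∞, (∀ μ, Measurable (g μ)) →
      ∫⁻ x, (∑' μ, g μ x ^ Q x) ^ (P x / Q x) ≤ 1 →
      ∫⁻ x, (∑' μ, ballAvg ((2 : ℝ)⁻¹ ^ μ) (g μ) x ^ Q x) ^ (P x / Q x) ≤ C := by
  set s : ℝ := (1 + bP) / 2 with hs
  set t : ℝ := dP + 1 with ht
  have hbP := hP.one_lt
  have hs1 : 1 < s := by rw [hs]; linarith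
  have hsb : s < bP := by rw [hs]; linarith
  have hbd : bP ≤ dP := (hP.ge 0).trans (hP.le 0)
  have ht1 : 1 < t := by rw [ht]; linarith
  have hst : t⁻¹ < s⁻¹ := by
    refine inv_strictAnti₀ (by linarith) ?_
    rw [ht]; linarith
  set κ := s⁻¹ - t⁻¹ with hκ
  have hκ0 : 0 < κ := sub_pos.2 hst
  set φ : Rn n → ℝ := fun x => κ⁻¹ * s⁻¹ + (-κ⁻¹) * (P x)⁻¹ with hφ
  set θ : Rn n → ℝ := fun x => (Q x)⁻¹ with hθ
  have hφeq : ∀ x, φ x = (s⁻¹ - (P x)⁻¹) / κ := fun x => by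
    rw [hφ]; field_simp; ring
  have hφ0 : ∀ x, 0 ≤ φ x := fun x => by
    rw [hφeq]
    refine div_nonneg (sub_nonneg.2 (inv_anti₀ (by linarith) ?_)) hκ0.le
    linarith [hP.ge x]
  have hφ1 : ∀ x, φ x ≤ 1 := fun x => by
    rw [hφeq, div_le_one hκ0, hκ]
    have : t⁻¹ ≤ (P x)⁻¹ := inv_anti₀ (hP.pos x) (by rw [ht]; linarith [hP.le x])
    linarith
  have hφP : ∀ x, (1 - φ x) * s⁻¹ + φ x * t⁻¹ = (P x)⁻¹ := fun x => by
    have : φ x * κ = s⁻¹ - (P x)⁻¹ := by rw [hφeq, div_mul_cancel₀ _ hκ0.ne']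
    rw [hκ] at this
    linarith
  have hθ0 : ∀ x, 0 ≤ θ x := fun x => inv_nonneg.2 (hQ.pos x).le
  have hθ1 : ∀ x, θ x ≤ 1 := fun x => inv_le_one_of_one_le₀ (hQ.gt_one x).le
  have hw0 : ∀ i x, 0 ≤ interpWt φ θ i x := fun i x =>
    interpWt_nonneg (hφ0 x) (hφ1 x) (hθ0 x) (hθ1 x) i
  choose winf hwLH using exists_isLH_interpWt (hP.inv_isLH.affine (κ⁻¹ * s⁻¹) (-κ⁻¹))
    hQ.inv_isLH hφ0 hφ1 hθ0 hθ1
  obtain ⟨C0, hC0, hV⟩ := exists_ballAvg_prod_rpow_le hw0 (sum_interpWt φ θ) hwLH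
    (K := n + 1 + (unitVol n).toReal) (by positivity)
  obtain ⟨Cs, hCs, hIs⟩ := tsum_ballAvg_part_bound hs1 n
  obtain ⟨Ct, hCt, hIt⟩ := tsum_ballAvg_part_bound ht1 n
  refine ⟨(C0 + 1) ^ dP * (Cs + Ct), ?_, fun g hg hg1 => ?_⟩
  · have : (C0 + 1) ^ dP ≠ ∞ := ENNReal.rpow_ne_top_of_nonneg (by linarith) (by finiteness)
    finiteness
  have hPm := hP.measurable
  have hQm := hQ.measurable
  have hgQ : ∀ μ, Measurable fun x => g μ x ^ Q x := fun μ => (hg μ).pow hQm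
  set S : Rn n → ℝ≥0∞ := fun x => ∑' μ, g μ x ^ Q x with hS
  have hSm : Measurable S := Measurable.tsum hgQ
  set D : Rn n → ℝ≥0∞ := fun x => S x ^ (P x / Q x) with hD
  have hDm : Measurable D := hSm.pow (hPm.div hQm)
  set β : ℕ → Rn n → ℝ≥0∞ := fun μ x => g μ x ^ Q x / S x with hβ
  have hβm : ∀ μ, Measurable (β μ) := fun μ => (hgQ μ).div hSm
  have hβ1 : ∀ x, ∑' μ, β μ x ≤ 1 := fun x => by
    simp only [hβ, div_eq_mul_inv]
    rw [ENNReal.tsum_mul_right]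
    exact ENNReal.mul_inv_le_one _
  have hβle : ∀ μ x, β μ x ≤ 1 := fun μ x => (ENNReal.le_tsum μ).trans (hβ1 x)
  set τ : Bool → ℝ := fun b => if b then t else s with hτ
  have hτ1 : ∀ b, 1 ≤ τ b := fun b => by
    cases b
    · simpa [hτ] using hs1.le
    · simpa [hτ] using ht1.le
  set f : ℕ → Bool × Bool → Rn n → ℝ≥0∞ := fun μ i z =>
    (if i.2 then β μ z else 1) * D z ^ (τ i.1)⁻¹ with hf
  have hfm : ∀ μ i, Measurable (f μ i) := fun μ i => by
    rcases i with ⟨i, j⟩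
    cases j
    · simpa [hf] using hDm.pow_const _
    · simpa [hf] using Measurable.fun_mul (hβm μ) (hDm.pow_const _)
  have hfle : ∀ μ i z, f μ i z ≤ 1 + D z := fun μ i z => by
    refine le_trans ?_ (rpow_inv_le_one_add (hτ1 i.1) (D z))
    calc f μ i z ≤ 1 * D z ^ (τ i.1)⁻¹ := by
          simp only [hf]
          gcongr
          split_ifs
          · exact hβle μ z
          · exact le_rfl
      _ = _ := one_mul _
  have hSfin : ∀ᵐ x, S x ≠ ∞ := by
    have : ∀ᵐ x, D x < ∞ := ae_lt_top hDm (ne_top_of_le_ne_top ENNReal.one_ne_top hg1)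
    filter_upwards [this] with x hx hxS
    simp only [hD] at hx
    rw [hxS, ENNReal.top_rpow_of_pos (div_pos (hP.pos x) (hQ.pos x))] at hx
    exact lt_irrefl _ hx
  set ε : ℕ → Rn n → ℝ≥0∞ := fun μ x => ENNReal.ofReal ((2 : ℝ)⁻¹ ^ μ) * decay (n + 1) x with hε
  have hεle : ∀ μ x, ε μ x ≤ decay (n + 1) x := fun μ x => by
    calc ε μ x ≤ 1 * decay (n + 1) x := by
          simp only [hε]
          gcongr
          exact ENNReal.ofReal_le_one.2 (pow_le_one₀ (by norm_num) (by norm_num))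
      _ = _ := one_mul _
  set a : ℕ → Rn n → Bool × Bool → ℝ≥0∞ := fun μ x i =>
    ballAvg ((2 : ℝ)⁻¹ ^ μ) (f μ i) x + ε μ x with ha
  have hR0 : ∀ μ : ℕ, (0 : ℝ) < 2⁻¹ ^ μ := fun μ => by positivity
  have hR1 : ∀ μ : ℕ, (2 : ℝ)⁻¹ ^ μ ≤ 1 := fun μ => pow_le_one₀ (by norm_num) (by norm_num)
  have hG : ∀ μ x, ballAvg ((2 : ℝ)⁻¹ ^ μ) (g μ) x ≤ C0 * ∏ i, a μ x i ^ interpWt φ θ i x := by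
    intro μ x
    refine le_trans (ballAvg_mono_ae ?_ _ x) (hV _ x (f μ) (a μ x) (hR0 μ) ((hR1 μ).trans one_le_two)
      (hfm μ) (fun i => le_self_add) fun i => ?_)
    · filter_upwards [hSfin] with z hz
      exact le_prod_interpWt (hP.pos z) (hQ.pos z) (by linarith) (by linarith) (hφ0 z) (hφ1 z)
        rfl (hθ1 z) (hφP z) (ENNReal.le_tsum (f := fun μ => g μ z ^ Q z) μ) hz
    · exact inLogRange_add_decay (hR0 μ) (hR1 μ) x
        (ballAvg_le_of_le_one_add hg1 (hfle μ i) (hR0 μ) x)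
  set Y : Rn n → Bool → ℝ≥0∞ := fun x b => locMax (fun z => D z ^ (τ b)⁻¹) x + decay (n + 1) x
    with hY
  set T : Rn n → Bool → ℝ≥0∞ := fun x b =>
    ∑' μ, ballAvg ((2 : ℝ)⁻¹ ^ μ) (fun z => β μ z * D z ^ (τ b)⁻¹) x + 2 * decay (n + 1) x with hT
  have haY : ∀ x μ b, a μ x (b, false) ≤ Y x b := fun x μ b => by
    simp only [ha, hY]
    refine add_le_add ?_ (hεle μ x)
    simp only [hf, Bool.false_eq_true, if_false, one_mul]
    exact ballAvg_le_locMax (fun z => D z ^ (τ b)⁻¹) μ x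
  have haT : ∀ x b, ∑' μ, a μ x (b, true) ≤ T x b := fun x b => by
    simp only [ha, hT]
    rw [ENNReal.tsum_add]
    simp only [hε, tsum_two_inv_pow_mul, hf, if_true]
    exact le_rfl
  calc ∫⁻ x, (∑' μ, ballAvg ((2 : ℝ)⁻¹ ^ μ) (g μ) x ^ Q x) ^ (P x / Q x)
      ≤ ∫⁻ x, (C0 + 1) ^ dP * (((Y x false ^ s + T x false ^ s) + (Y x true ^ t + T x true ^ t))) := by
        refine lintegral_mono fun x => ?_
        refine (interp_recombine (hP.pos x) (hQ.pos x) (by linarith) (by linarith) (hφ0 x) (hφ1 x)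
          rfl (hθ1 x) (hφP x) (fun μ => hG μ x) (haY x) (haT x)).trans ?_
        gcongr
        calc C0 ^ P x ≤ (C0 + 1) ^ P x := ENNReal.rpow_le_rpow le_self_add (hP.pos x).le
          _ ≤ _ := ENNReal.rpow_le_rpow_of_exponent_le le_add_self (hP.le x)
    _ ≤ _ := by
        rw [lintegral_const_mul' _ _
          (ENNReal.rpow_ne_top_of_nonneg (by linarith) (by finiteness))]
        gcongr
        have hm : Measurable fun x => Y x false ^ s + T x false ^ s := by
          have h1 : Measurable fun x => Y x false :=
            (measurable_locMax (hDm.pow_const _)).add (measurable_decay _)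
          have h2 : Measurable fun x => T x false :=
            (Measurable.tsum fun μ => measurable_ballAvg _ ((hβm μ).mul (hDm.pow_const _))).add
              ((measurable_decay _).const_mul _)
          exact (h1.pow_const _).add (h2.pow_const _)
        rw [lintegral_add_left hm]
        exact add_le_add (hIs D β hDm hβm hβ1 hg1) (hIt D β hDm hβm hβ1 hg1)

lemma add_rpow_le_two_rpow_mul {p d : ℝ} (hp : 0 ≤ p) (hpd : p ≤ d) (a b : ℝ≥0∞) :
    (a + b) ^ p ≤ 2 ^ d * (a ^ p + b ^ p) := by
  calc (a + b) ^ p ≤ (2 * max a b) ^ p := by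
        gcongr
        rw [two_mul]
        exact add_le_add (le_max_left _ _) (le_max_right _ _)
    _ = 2 ^ p * (max a b) ^ p := ENNReal.mul_rpow_of_nonneg _ _ hp
    _ ≤ 2 ^ d * (a ^ p + b ^ p) := by
        gcongr
        · norm_num
        · rcases le_total a b with h | h
          · rw [max_eq_right h]; exact le_add_self
          · rw [max_eq_left h]; exact le_self_add

/-- The `ℓ^q` norm of a nonnegative sequence, for a real exponent `q`. -/
def lqSum (q : ℝ) (a : ℕ → ℝ≥0∞) : ℝ≥0∞ := (∑' j, a j ^ q) ^ q⁻¹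

lemma lqSum_rpow {q : ℝ} (hq : 0 < q) (a : ℕ → ℝ≥0∞) : lqSum q a ^ q = ∑' j, a j ^ q := by
  rw [lqSum, ← ENNReal.rpow_mul, inv_mul_cancel₀ hq.ne', ENNReal.rpow_one]

lemma lqSum_rpow_eq {q : ℝ} (a : ℕ → ℝ≥0∞) (p : ℝ) :
    lqSum q a ^ p = (∑' j, a j ^ q) ^ (p / q) := by
  rw [lqSum, ← ENNReal.rpow_mul, div_eq_inv_mul]

lemma lqSum_mono {q : ℝ} (hq : 0 ≤ q) {a b : ℕ → ℝ≥0∞} (h : ∀ j, a j ≤ b j) :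
    lqSum q a ≤ lqSum q b := by
  unfold lqSum
  gcongr with j
  exact h j

lemma lqSum_const_mul {q : ℝ} (hq : 0 < q) (c : ℝ≥0∞) (a : ℕ → ℝ≥0∞) :
    lqSum q (fun j => c * a j) = c * lqSum q a := by
  simp only [lqSum, ENNReal.mul_rpow_of_nonneg _ _ hq.le]
  rw [ENNReal.tsum_mul_left, ENNReal.mul_rpow_of_nonneg _ _ (inv_nonneg.2 hq.le),
    ← ENNReal.rpow_mul, mul_inv_cancel₀ hq.ne', ENNReal.rpow_one]

lemma le_lqSum {q : ℝ} (hq : 0 < q) (a : ℕ → ℝ≥0∞) (j : ℕ) : a j ≤ lqSum q a := by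
  calc a j = (a j ^ q) ^ q⁻¹ := by
        rw [← ENNReal.rpow_mul, mul_inv_cancel₀ hq.ne', ENNReal.rpow_one]
    _ ≤ _ := by
        unfold lqSum
        gcongr
        exact ENNReal.le_tsum j

lemma lqSum_shift_le {q : ℝ} (hq : 0 < q) (a : ℕ → ℝ≥0∞) (s : ℕ) :
    lqSum q (fun j => a (j + s)) ≤ lqSum q a := by
  unfold lqSum
  gcongr ?_ ^ _
  exact ENNReal.tsum_comp_le_tsum_of_injective (add_left_injective s) fun j => a j ^ q

lemma lqSum_le_tsum {q : ℝ} (hq : 1 ≤ q) (a : ℕ → ℝ≥0∞) : lqSum q a ≤ ∑' j, a j := by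
  have hq0 : 0 < q := by linarith
  calc lqSum q a ≤ ((∑' j, a j) ^ q) ^ q⁻¹ := by
        unfold lqSum
        gcongr
        calc ∑' j, a j ^ q ≤ ∑' j, a j * (∑' j, a j) ^ (q - 1) := by
              gcongr with j
              calc a j ^ q = a j ^ (1 + (q - 1)) := by ring_nf
                _ = a j * a j ^ (q - 1) := by
                  rw [ENNReal.rpow_add_of_nonneg _ _ zero_le_one (by linarith), ENNReal.rpow_one]
                _ ≤ _ := by
                  gcongr
                  exact ENNReal.le_tsum j
          _ = (∑' j, a j) ^ (1 + (q - 1)) := by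
              rw [ENNReal.tsum_mul_right,
                ENNReal.rpow_add_of_nonneg _ _ zero_le_one (by linarith), ENNReal.rpow_one]
          _ = _ := by ring_nf
    _ = _ := by rw [← ENNReal.rpow_mul, mul_inv_cancel₀ hq0.ne', ENNReal.rpow_one]

lemma lqSum_tsum_le {q : ℝ} (hq : 1 ≤ q) (a : ℕ → ℕ → ℝ≥0∞) :
    lqSum q (fun j => ∑' e, a e j) ≤ ∑' e, lqSum q (a e) := by
  have hq0 : 0 < q := by linarith
  set N : ℕ → ℝ≥0∞ := fun e => lqSum q (a e) with hN
  set W : ℝ≥0∞ := ∑' e, N e with hW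
  rcases eq_or_ne W ∞ with hWt | hWt
  · rw [hWt]; exact le_top
  have hNt : ∀ e, N e ≠ ∞ := fun e => ne_top_of_le_ne_top hWt (ENNReal.le_tsum e)
  have hfac : ∀ e j, a e j = N e * (a e j / N e) := fun e j => by
    rcases eq_or_ne (N e) 0 with h0 | h0
    · have : a e j = 0 := le_antisymm ((le_lqSum hq0 (a e) j).trans h0.le) zero_le
      rw [this, h0, zero_mul]
    · rw [ENNReal.mul_div_cancel h0 (hNt e)]
  have hb : ∀ e, ∑' j, (a e j / N e) ^ q ≤ 1 := fun e => by
    simp_rw [ENNReal.div_rpow_of_nonneg _ _ hq0.le, div_eq_mul_inv]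
    rw [ENNReal.tsum_mul_right, ← lqSum_rpow hq0]
    exact ENNReal.mul_inv_le_one _
  have key : ∑' j, (∑' e, a e j) ^ q ≤ W ^ q := by
    calc ∑' j, (∑' e, a e j) ^ q ≤ ∑' j, W ^ (q - 1) * ∑' e, N e * (a e j / N e) ^ q := by
          gcongr with j
          calc (∑' e, a e j) ^ q = (∑' e, N e * (a e j / N e)) ^ q := by simp_rw [← hfac]
            _ ≤ _ := tsum_mul_rpow_le N (fun e => a e j / N e) hq
      _ = W ^ (q - 1) * ∑' e, N e * ∑' j, (a e j / N e) ^ q := by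
          rw [ENNReal.tsum_mul_left, ENNReal.tsum_comm]
          simp_rw [ENNReal.tsum_mul_left]
      _ ≤ W ^ (q - 1) * ∑' e, N e * 1 := by
          gcongr with e
          exact hb e
      _ = W ^ ((q - 1) + 1) := by
          simp only [mul_one]
          rw [ENNReal.rpow_add_of_nonneg _ _ (by linarith) zero_le_one, ENNReal.rpow_one]
      _ = W ^ q := by ring_nf
  calc lqSum q (fun j => ∑' e, a e j) ≤ (W ^ q) ^ q⁻¹ := by
        unfold lqSum
        gcongr
    _ = W := by rw [← ENNReal.rpow_mul, mul_inv_cancel₀ hq0.ne', ENNReal.rpow_one]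

lemma lqSum_add_le {q : ℝ} (hq : 1 ≤ q) (a b : ℕ → ℝ≥0∞) :
    lqSum q (fun j => a j + b j) ≤ lqSum q a + lqSum q b := by
  have hq0 : 0 < q := by linarith
  have h := lqSum_tsum_le hq fun e j => if e = 0 then a j else if e = 1 then b j else 0
  have hz : lqSum q (fun _ => 0) = 0 := by simp [lqSum, hq0]
  rw [tsum_eq_sum (s := Finset.range 2), Finset.sum_range_succ, Finset.sum_range_one] at h
  · convert h using 2
    · funext j
      rw [tsum_eq_sum (s := Finset.range 2), Finset.sum_range_succ, Finset.sum_range_one]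
      · simp
      · intro e he
        have : e ≠ 0 ∧ e ≠ 1 := by simp at he; omega
        simp [this]
    · simp
    · simp
  · intro e he
    have : e ≠ 0 ∧ e ≠ 1 := by simp at he; omega
    simp [this, hz]

/-- Countable convex combinations in a modular with variable exponent at least one. -/
lemma lintegral_tsum_mul_rpow_le (ν : Measure (Rn n)) {P : Rn n → ℝ} {d : ℝ} (hPm : Measurable P)
    (hP1 : ∀ x, 1 ≤ P x) (hPd : ∀ x, P x ≤ d) (w : ℕ → ℝ≥0∞) {F : ℕ → Rn n → ℝ≥0∞}
    (hF : ∀ e, Measurable (F e)) {C : ℝ≥0∞} (hC : ∀ e, ∫⁻ x, F e x ^ P x ∂ν ≤ C) :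
    ∫⁻ x, (∑' e, w e * F e x) ^ P x ∂ν ≤ (1 + ∑' e, w e) ^ d * C := by
  set W : ℝ≥0∞ := ∑' e, w e with hW
  have hd1 : 1 ≤ d := (hP1 0).trans (hPd 0)
  have hm : ∀ e, Measurable fun x => F e x ^ P x := fun e => (hF e).pow hPm
  calc ∫⁻ x, (∑' e, w e * F e x) ^ P x ∂ν
      ≤ ∫⁻ x, (1 + W) ^ (d - 1) * ∑' e, w e * F e x ^ P x ∂ν := by
        gcongr with x
        refine (tsum_mul_rpow_le w (fun e => F e x) (hP1 x)).trans ?_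
        gcongr
        calc W ^ (P x - 1) ≤ (1 + W) ^ (P x - 1) := by
              gcongr
              · linarith [hP1 x]
              · exact le_add_self
          _ ≤ (1 + W) ^ (d - 1) :=
              ENNReal.rpow_le_rpow_of_exponent_le le_self_add (by linarith [hPd x])
    _ = (1 + W) ^ (d - 1) * ∑' e, w e * ∫⁻ x, F e x ^ P x ∂ν := by
        rw [lintegral_const_mul _ (Measurable.tsum fun e => (hm e).const_mul _),
          lintegral_tsum fun e => ((hm e).const_mul _).aemeasurable]
        simp_rw [lintegral_const_mul _ (hm _)]
    _ ≤ (1 + W) ^ (d - 1) * ∑' e, w e * C := by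
        gcongr with e
        exact hC e
    _ = (1 + W) ^ (d - 1) * W * C := by rw [ENNReal.tsum_mul_right, mul_assoc]
    _ ≤ (1 + W) ^ (d - 1) * (1 + W) * C := by
        gcongr
        exact le_add_self
    _ = (1 + W) ^ ((d - 1) + 1) * C := by
        rw [ENNReal.rpow_add_of_nonneg _ _ (by linarith) zero_le_one, ENNReal.rpow_one]
    _ = _ := by ring_nf

lemma rpow_le_mul_rpow_add_decay {f : ℝ≥0∞} (hf : f ≤ 1) {α β c M : ℝ} (hα : 1 ≤ α) (hM : 0 ≤ M)
    {y : Rn n} (h : |α - β| * logWt y ≤ c) :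
    f ^ α ≤ ENNReal.ofReal (Real.exp (M * c)) * f ^ β + decay M y := by
  rcases le_total f (decay M y) with hd | hd
  · exact le_add_left ((rpow_le_self_of_le_one' hf hα).trans hd)
  · refine le_add_right ?_
    have hd0 : 0 < decay M y := ENNReal.ofReal_pos.2 (Real.exp_pos _)
    have hf0 : f ≠ 0 := (hd0.trans_le hd).ne'
    have hft : f ≠ ∞ := ne_top_of_le_ne_top ENNReal.one_ne_top hf
    calc f ^ α = f ^ (α - β) * f ^ β := by
          rw [← ENNReal.rpow_add _ _ hf0 hft, sub_add_cancel]
      _ ≤ _ := by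
        gcongr
        calc f ^ (α - β) ≤ f ^ (-|α - β|) :=
              ENNReal.rpow_le_rpow_of_exponent_ge hf (neg_abs_le _)
          _ ≤ decay M y ^ (-|α - β|) := rpow_neg_le_rpow_neg hd (abs_nonneg _)
          _ = ENNReal.ofReal (Real.exp (M * (|α - β| * logWt y))) := by
              rw [decay, ENNReal.ofReal_rpow_of_pos (Real.exp_pos _), ← Real.exp_mul]
              congr 2
              ring
          _ ≤ _ := by gcongr

/-- Exponents bounded away from one and infinity whose reciprocal is log-Hölder continuous, with
bounds on the limit value at infinity. -/
structure LHExponentAt (P : Rn n → ℝ) (b d θinf : ℝ) : Prop extends LHExponent P b d θinf where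
  inf_ge : d⁻¹ ≤ θinf
  inf_le : θinf ≤ b⁻¹

namespace LHExponentAt

variable {P : Rn n → ℝ} {b d θinf : ℝ}

lemma inf_pos (h : LHExponentAt P b d θinf) : 0 < θinf :=
  (inv_pos.2 (zero_lt_one.trans h.one_le_hi)).trans_le h.inf_ge

lemma inf_le_one (h : LHExponentAt P b d θinf) : θinf ≤ 1 :=
  h.inf_le.trans (inv_le_one_of_one_le₀ h.one_lt.le)

lemma one_le_inv_inf (h : LHExponentAt P b d θinf) : 1 ≤ θinf⁻¹ :=
  (one_le_inv₀ h.inf_pos).2 h.inf_le_one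

lemma isLH (h : LHExponentAt P b d θinf) : IsLH P θinf⁻¹ := by
  have hd : 0 < d := zero_lt_one.trans h.one_le_hi
  have := h.inv_isLH.inv (b := d⁻¹) (inv_pos.2 hd)
    (fun x => inv_anti₀ (h.pos x) (h.le x)) h.inf_ge
  simpa only [inv_inv] using this

lemma exists_rpow_le_add_decay (h : LHExponentAt P b d θinf) : ∃ K : ℝ≥0∞, K ≠ ∞ ∧
    ∀ (f : ℝ≥0∞) (y : Rn n), f ≤ 1 → f ^ P y ≤ K * f ^ θinf⁻¹ + decay (n + 1) y ∧
      f ^ θinf⁻¹ ≤ K * f ^ P y + decay (n + 1) y := by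
  obtain ⟨c, -, -, hc⟩ := h.isLH
  refine ⟨ENNReal.ofReal (Real.exp ((n + 1) * c)), ENNReal.ofReal_ne_top, fun f y hf => ⟨?_, ?_⟩⟩
  · exact rpow_le_mul_rpow_add_decay hf (h.gt_one y).le (by positivity) (hc y)
  · refine rpow_le_mul_rpow_add_decay hf h.one_le_inv_inf (by positivity) ?_
    rw [abs_sub_comm]
    exact hc y

end LHExponentAt

lemma exists_split_le_rpow_add {P : Rn n → ℝ} (hP : ∀ x, 1 ≤ P x) {f : Rn n → ℝ≥0∞}
    (hf : Measurable f) : ∃ f1 f2 : Rn n → ℝ≥0∞, Measurable f1 ∧ Measurable f2 ∧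
      (∀ x, f x = f1 x + f2 x) ∧ (∀ x, f1 x ≤ f x ^ P x) ∧ (∀ x, f2 x ≤ 1) ∧ ∀ x, f2 x ≤ f x := by
  have hs : MeasurableSet {x | f x ≤ 1} := measurableSet_le hf measurable_const
  refine ⟨fun x => if f x ≤ 1 then 0 else f x, fun x => if f x ≤ 1 then f x else 0,
    Measurable.ite hs measurable_const hf, Measurable.ite hs hf measurable_const,
    fun x => ?_, fun x => ?_, fun x => ?_, fun x => ?_⟩ <;> dsimp only
  · split_ifs <;> simp
  · split_ifs with h
    · exact zero_le
    · conv_lhs => rw [← ENNReal.rpow_one (f x)]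
      exact ENNReal.rpow_le_rpow_of_exponent_le (not_le.1 h).le (hP x)
  · split_ifs with h
    · exact h
    · exact zero_le
  · split_ifs with h
    · exact le_rfl
    · exact zero_le

lemma inv_ofReal_pow_le_one {R : ℝ} (hR : 1 ≤ R) (n : ℕ) : (ENNReal.ofReal R)⁻¹ ^ n ≤ 1 :=
  pow_le_one₀ zero_le (ENNReal.inv_le_one.2 (ENNReal.one_le_ofReal.2 hR))

/-- Averages over large balls are uniformly bounded in the modular. -/
theorem LHExponentAt.exists_modular_ballAvg_le {P : Rn n → ℝ} {b d θinf : ℝ}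
    (h : LHExponentAt P b d θinf) : ∃ C : ℝ≥0∞, C ≠ ∞ ∧ ∀ (R : ℝ) (f : Rn n → ℝ≥0∞), 1 ≤ R →
      Measurable f → ∫⁻ x, f x ^ P x ≤ 1 → ∫⁻ x, ballAvg R f x ^ P x ≤ C := by
  obtain ⟨K, hK, hconv⟩ := h.exists_rpow_le_add_decay
  set v := unitVol n with hv
  have hvt : v ≠ ∞ := unitVol_ne_top n
  set H : ℝ≥0∞ := ∫⁻ x : Rn n, decay (n + 1) x with hH
  have hHt : H ≠ ∞ := (lintegral_decay_lt_top (by linarith)).ne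
  have hd0 : 0 ≤ d := (zero_lt_one.trans h.one_le_hi).le
  have hθ := h.one_le_inv_inf
  have hv1 : v ^ (θinf⁻¹ - 1) ≠ ∞ := ENNReal.rpow_ne_top_of_nonneg (by linarith) hvt
  have hv2 : (1 + v) ^ d ≠ ∞ := ENNReal.rpow_ne_top_of_nonneg hd0 (by finiteness)
  have h2d : (2 : ℝ≥0∞) ^ d ≠ ∞ := two_rpow_ne_top _
  refine ⟨2 ^ d * (v + (1 + v) ^ d * (K * (v ^ (θinf⁻¹ - 1) * (v * (K + H))) + H)),
    by finiteness, fun R f hR hf hf1 => ?_⟩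
  have hR0 : 0 < R := by linarith
  have hPm := h.measurable
  obtain ⟨f1, f2, hm1, hm2, hadd, hle1, hle2, hle2'⟩ :=
    exists_split_le_rpow_add (fun x => (h.gt_one x).le) hf
  have hint1 : ∫⁻ x, f1 x ≤ 1 := (lintegral_mono hle1).trans hf1
  have hA1 : ∀ x, ballAvg R f1 x ≤ 1 := fun x => by
    calc ballAvg R f1 x ≤ 1 * ∫⁻ z, f1 z := by
          unfold ballAvg
          gcongr
          · exact inv_ofReal_pow_le_one hR n
          · exact Measure.restrict_le_self
      _ ≤ 1 := by rw [one_mul]; exact hint1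
  have hA2 : ∀ x, ballAvg R f2 x ≤ v := fun x => by
    calc ballAvg R f2 x ≤ ballAvg R (fun _ => 1) x := ballAvg_mono fun z _ => hle2 z
      _ = v := by rw [ballAvg_const hR0, mul_one]
  have hmA1 := measurable_ballAvg R hm1
  have hmA2 := measurable_ballAvg R hm2
  have hv10 : 1 + v ≠ 0 := by simp
  have hv1t : 1 + v ≠ ∞ := by finiteness
  have hlow : ∫⁻ x, f2 x ^ θinf⁻¹ ≤ K + H := by
    calc ∫⁻ x, f2 x ^ θinf⁻¹ ≤ ∫⁻ x, (K * f x ^ P x + decay (n + 1) x) := by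
          gcongr with x
          refine (hconv (f2 x) x (hle2 x)).2.trans ?_
          gcongr
          · exact (h.pos x).le
          · exact hle2' x
      _ = K * (∫⁻ x, f x ^ P x) + H := by
          rw [lintegral_add_right _ (measurable_decay _), lintegral_const_mul _ (hf.pow hPm)]
      _ ≤ K * 1 + H := by gcongr
      _ = K + H := by rw [mul_one]
  have hpt : ∀ x, ballAvg R f x ^ P x ≤ 2 ^ d * (ballAvg R f1 x +
      (1 + v) ^ d * (K * (v ^ (θinf⁻¹ - 1) * ballAvg R (fun z => f2 z ^ θinf⁻¹) x)
        + decay (n + 1) x)) := fun x => by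
    have e : ballAvg R f x = ballAvg R f1 x + ballAvg R f2 x := by
      rw [← ballAvg_add hm1]
      exact ballAvg_congr fun z _ => hadd z
    rw [e]
    refine (add_rpow_le_two_rpow_mul (h.pos x).le (h.le x) _ _).trans ?_
    gcongr
    · exact rpow_le_self_of_le_one' (hA1 x) (h.gt_one x).le
    · have hle : ballAvg R f2 x / (1 + v) ≤ 1 := by
        rw [ENNReal.div_le_iff hv10 hv1t, one_mul]
        exact (hA2 x).trans le_add_self
      calc ballAvg R f2 x ^ P x = ((1 + v) * (ballAvg R f2 x / (1 + v))) ^ P x := by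
            rw [ENNReal.mul_div_cancel hv10 hv1t]
        _ = (1 + v) ^ P x * (ballAvg R f2 x / (1 + v)) ^ P x :=
            ENNReal.mul_rpow_of_nonneg _ _ (h.pos x).le
        _ ≤ (1 + v) ^ d * (K * (ballAvg R f2 x / (1 + v)) ^ θinf⁻¹ + decay (n + 1) x) := by
            gcongr
            · exact le_self_add
            · exact h.le x
            · exact (hconv _ x hle).1
        _ ≤ _ := by
            gcongr
            refine le_trans ?_ (ballAvg_rpow_le hR0 hm2 hθ x)
            gcongr
            calc ballAvg R f2 x / (1 + v) ≤ ballAvg R f2 x / 1 := by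
                  gcongr
                  exact le_self_add
              _ = _ := div_one _
  have hm3 := measurable_ballAvg R (hm2.pow_const θinf⁻¹)
  calc ∫⁻ x, ballAvg R f x ^ P x ≤ _ := lintegral_mono hpt
    _ = 2 ^ d * ((∫⁻ x, ballAvg R f1 x) + (1 + v) ^ d * (K * (v ^ (θinf⁻¹ - 1) *
          ∫⁻ x, ballAvg R (fun z => f2 z ^ θinf⁻¹) x) + H)) := by
        rw [lintegral_const_mul' _ _ h2d, lintegral_add_left hmA1, lintegral_const_mul' _ _ hv2,
          lintegral_add_right _ (measurable_decay _), lintegral_const_mul' _ _ hK,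
          lintegral_const_mul' _ _ hv1]
    _ = 2 ^ d * (v * (∫⁻ x, f1 x) + (1 + v) ^ d * (K * (v ^ (θinf⁻¹ - 1) *
          (v * ∫⁻ x, f2 x ^ θinf⁻¹)) + H)) := by
        rw [lintegral_ballAvg hR0 hm1, lintegral_ballAvg hR0 (hm2.pow_const _)]
    _ ≤ 2 ^ d * (v * 1 + (1 + v) ^ d * (K * (v ^ (θinf⁻¹ - 1) * (v * (K + H))) + H)) := by
        gcongr
    _ = _ := by rw [mul_one]

/-- The reciprocal of the norm of the indicator function of a ball, up to constants. -/
def ballScale (P : Rn n → ℝ) (θinf : ℝ) (x : Rn n) (R : ℝ) : ℝ≥0∞ :=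
  ENNReal.ofReal R ^ (-(n * if R ≤ 1 then (P x)⁻¹ else θinf))

lemma ofReal_rpow_ne_zero {R : ℝ} (hR : 0 < R) (s : ℝ) : ENNReal.ofReal R ^ s ≠ 0 := by
  rw [ENNReal.ofReal_rpow_of_pos hR]
  simpa using Real.rpow_pos_of_pos hR s

lemma ofReal_rpow_ne_top {R : ℝ} (hR : 0 < R) (s : ℝ) : ENNReal.ofReal R ^ s ≠ ∞ := by
  rw [ENNReal.ofReal_rpow_of_pos hR]
  exact ENNReal.ofReal_ne_top

lemma ofReal_rpow_add {R : ℝ} (hR : 0 < R) (s t : ℝ) :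
    ENNReal.ofReal R ^ (s + t) = ENNReal.ofReal R ^ s * ENNReal.ofReal R ^ t :=
  ENNReal.rpow_add _ _ (by simpa using hR) ENNReal.ofReal_ne_top

lemma ofReal_inv_pow_eq (R : ℝ) : (ENNReal.ofReal R)⁻¹ ^ n = ENNReal.ofReal R ^ (-(n : ℝ)) := by
  rw [ENNReal.rpow_neg, ENNReal.rpow_natCast, ENNReal.inv_pow]

lemma inLogRange_ofReal_rpow {R : ℝ} (hR : 0 < R) (x : Rn n) {s K : ℝ} (hs : |s| ≤ K) :
    InLogRange K R x (ENNReal.ofReal R ^ s) := by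
  have e : ENNReal.ofReal R ^ s = ENNReal.ofReal (Real.exp (Real.log R * s)) := by
    rw [ENNReal.ofReal_rpow_of_pos hR, Real.rpow_def_of_pos hR]
  have hL := one_le_logWt x
  have h1 : |Real.log R * s| ≤ K * (1 + |Real.log R| + logWt x) := by
    rw [abs_mul, mul_comm]
    have := abs_nonneg (Real.log R)
    exact mul_le_mul hs (by linarith) this ((abs_nonneg s).trans hs)
  rw [abs_le] at h1
  rw [InLogRange, e]
  exact ⟨ENNReal.ofReal_le_ofReal (Real.exp_le_exp.2 h1.1),
    ENNReal.ofReal_le_ofReal (Real.exp_le_exp.2 h1.2)⟩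

lemma le_add_rpow_one_sub_mul {lam : ℝ≥0∞} (h0 : lam ≠ 0) (ht : lam ≠ ∞) {p : ℝ} (hp : 1 ≤ p)
    (t : ℝ≥0∞) : t ≤ lam + lam ^ (1 - p) * t ^ p := by
  rcases le_total t lam with h | h
  · exact le_add_right h
  · refine le_add_left ?_
    rcases eq_or_ne t ∞ with rfl | htt
    · rw [ENNReal.top_rpow_of_pos (by linarith), ENNReal.mul_top]
      exact (ENNReal.rpow_pos (pos_iff_ne_zero.2 h0) ht).ne'
    · have ht0 : t ≠ 0 := ((pos_iff_ne_zero.2 h0).trans_le h).ne'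
      calc t = t ^ (1 - p) * t ^ p := by
            rw [← ENNReal.rpow_add _ _ ht0 htt, sub_add_cancel, ENNReal.rpow_one]
        _ ≤ lam ^ (1 - p) * t ^ p := by
            have := rpow_neg_le_rpow_neg h (t := p - 1) (by linarith)
            rw [neg_sub] at this
            exact mul_le_mul_left this _

/-- Averages over a ball are bounded by the reciprocal norm of its indicator function. -/
theorem LHExponentAt.exists_ballAvg_le_ballScale {P : Rn n → ℝ} {b d θinf : ℝ}
    (h : LHExponentAt P b d θinf) : ∃ C : ℝ≥0∞, C ≠ ∞ ∧ ∀ (x : Rn n) (R : ℝ) (f : Rn n → ℝ≥0∞),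
      0 < R → Measurable f → ∫⁻ z in Metric.ball x R, f z ^ P z ≤ 1 →
      ballAvg R f x ≤ C * ballScale P θinf x R := by
  obtain ⟨K, hK, hconv⟩ := h.exists_rpow_le_add_decay
  obtain ⟨c0, hc0, hosc⟩ := h.isLH.abs_sub_mul_le
  set C0 : ℝ≥0∞ := ENNReal.ofReal (Real.exp (n * c0)) with hC0
  set v := unitVol n with hv
  have hvt : v ≠ ∞ := unitVol_ne_top n
  set H : ℝ≥0∞ := ∫⁻ x : Rn n, decay (n + 1) x with hH
  have hHt : H ≠ ∞ := (lintegral_decay_lt_top (by linarith)).ne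
  have hθ := h.one_le_inv_inf
  have hθ0 := h.inf_pos
  have hPm := h.measurable
  have hv1 : v ^ (θinf⁻¹ - 1) ≠ ∞ := ENNReal.rpow_ne_top_of_nonneg (by linarith) hvt
  set C1 : ℝ≥0∞ := (v ^ (θinf⁻¹ - 1) * (K + H)) ^ θinf with hC1
  have hC1t : C1 ≠ ∞ := ENNReal.rpow_ne_top_of_nonneg hθ0.le (by finiteness)
  refine ⟨(v + C0) + (1 + C1), by finiteness, fun x R f hR hf hf1 => ?_⟩
  rw [ballScale]
  split_ifs with hR1
  · rw [add_mul]
    refine le_add_right ?_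
    set lam := ENNReal.ofReal R ^ (-(n * (P x)⁻¹)) with hlam
    have hl0 : lam ≠ 0 := ofReal_rpow_ne_zero hR _
    have hlt : lam ≠ ∞ := ofReal_rpow_ne_top hR _
    have hPx := h.pos x
    have hlog : InLogRange n R x lam := by
      refine inLogRange_ofReal_rpow hR x ?_
      rw [abs_neg, abs_of_nonneg (by positivity)]
      exact mul_le_of_le_one_right (Nat.cast_nonneg n) (inv_le_one_of_one_le₀ (h.gt_one x).le)
    have hpt : ∀ z ∈ Metric.ball x R, f z ≤ lam + lam ^ (1 - P x) * C0 * f z ^ P z := by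
      intro z hz
      refine (le_add_rpow_one_sub_mul hl0 hlt (h.gt_one z).le (f z)).trans ?_
      gcongr
      calc lam ^ (1 - P z) = lam ^ (1 - P x) * lam ^ (P x - P z) := by
            rw [← ENNReal.rpow_add _ _ hl0 hlt]
            congr 1
            ring
        _ ≤ _ := by
            gcongr
            refine hlog.rpow_le (Nat.cast_nonneg n) ?_
            rw [abs_sub_comm]
            exact hosc x z R hR (by linarith) hz
    have hc : lam ^ (1 - P x) * C0 ≠ ∞ :=
      ENNReal.mul_ne_top (ENNReal.rpow_ne_top_of_ne_zero hl0 hlt) ENNReal.ofReal_ne_top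
    calc ballAvg R f x ≤ ballAvg R (fun z => lam + lam ^ (1 - P x) * C0 * f z ^ P z) x :=
          ballAvg_mono hpt
      _ = v * lam + lam ^ (1 - P x) * C0 * ((ENNReal.ofReal R)⁻¹ ^ n *
            ∫⁻ z in Metric.ball x R, f z ^ P z) := by
          rw [ballAvg_add measurable_const, ballAvg_const hR,
            ballAvg_const_mul (hf.pow hPm), ballAvg]
      _ ≤ v * lam + lam ^ (1 - P x) * C0 * ((ENNReal.ofReal R)⁻¹ ^ n * 1) := by gcongr
      _ = v * lam + C0 * (lam ^ (1 - P x) * (ENNReal.ofReal R)⁻¹ ^ n) := by ring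
      _ = v * lam + C0 * lam := by
          congr 2
          rw [ofReal_inv_pow_eq, hlam, ← ENNReal.rpow_mul, ← ofReal_rpow_add hR]
          congr 1
          field_simp
          ring
      _ = _ := by ring
  · have hR1' : 1 ≤ R := (not_le.1 hR1).le
    rw [add_mul]
    refine le_add_left ?_
    rw [add_mul, one_mul]
    obtain ⟨f1, f2, hm1, hm2, hadd, hle1, hle2, hle2'⟩ :=
      exists_split_le_rpow_add (fun x => (h.gt_one x).le) hf
    have e : ballAvg R f x = ballAvg R f1 x + ballAvg R f2 x := by
      rw [← ballAvg_add hm1]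
      exact ballAvg_congr fun z _ => hadd z
    rw [e]
    gcongr ?_ + ?_
    · calc ballAvg R f1 x ≤ (ENNReal.ofReal R)⁻¹ ^ n * 1 := by
            unfold ballAvg
            gcongr
            exact (lintegral_mono hle1).trans hf1
        _ ≤ _ := by
            rw [mul_one, ofReal_inv_pow_eq]
            refine ENNReal.rpow_le_rpow_of_exponent_le (ENNReal.one_le_ofReal.2 hR1') ?_
            exact neg_le_neg (mul_le_of_le_one_right (Nat.cast_nonneg n) h.inf_le_one)
    · have hlow : ∫⁻ z in Metric.ball x R, f2 z ^ θinf⁻¹ ≤ K + H := by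
        calc ∫⁻ z in Metric.ball x R, f2 z ^ θinf⁻¹
            ≤ ∫⁻ z in Metric.ball x R, (K * f z ^ P z + decay (n + 1) z) := by
              gcongr with z
              refine (hconv (f2 z) z (hle2 z)).2.trans ?_
              gcongr
              · exact (h.pos z).le
              · exact hle2' z
          _ = K * (∫⁻ z in Metric.ball x R, f z ^ P z) +
                ∫⁻ z in Metric.ball x R, decay (n + 1) z := by
              rw [lintegral_add_right _ (measurable_decay _), lintegral_const_mul _ (hf.pow hPm)]
          _ ≤ K * 1 + H := by
              gcongr
              exact setLIntegral_le_lintegral _ _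
          _ = K + H := by rw [mul_one]
      calc ballAvg R f2 x = (ballAvg R f2 x ^ θinf⁻¹) ^ θinf := by
            rw [← ENNReal.rpow_mul, inv_mul_cancel₀ hθ0.ne', ENNReal.rpow_one]
        _ ≤ (v ^ (θinf⁻¹ - 1) * ((ENNReal.ofReal R)⁻¹ ^ n * (K + H))) ^ θinf := by
            gcongr
            refine (ballAvg_rpow_le hR hm2 hθ x).trans ?_
            rw [ballAvg]
            gcongr
        _ = (v ^ (θinf⁻¹ - 1) * (K + H) * (ENNReal.ofReal R)⁻¹ ^ n) ^ θinf := by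
            congr 1
            ring
        _ = C1 * ENNReal.ofReal R ^ (-(n * θinf)) := by
            rw [ENNReal.mul_rpow_of_nonneg _ _ hθ0.le, ofReal_inv_pow_eq, ← ENNReal.rpow_mul,
              neg_mul]

/-- The normalized indicator function of a ball has bounded modular. -/
theorem LHExponentAt.exists_lintegral_ballScale_le {P : Rn n → ℝ} {b d θinf : ℝ}
    (h : LHExponentAt P b d θinf) : ∃ C : ℝ≥0∞, C ≠ ∞ ∧ ∀ (x : Rn n) (R : ℝ), 0 < R →
      ∫⁻ z in Metric.ball x R, ballScale P θinf x R ^ P z ≤ C := by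
  obtain ⟨K, hK, hconv⟩ := h.exists_rpow_le_add_decay
  obtain ⟨c0, hc0, hosc⟩ := h.isLH.abs_sub_mul_le
  set C0 : ℝ≥0∞ := ENNReal.ofReal (Real.exp (n * c0)) with hC0
  set v := unitVol n with hv
  have hvt : v ≠ ∞ := unitVol_ne_top n
  set H : ℝ≥0∞ := ∫⁻ x : Rn n, decay (n + 1) x with hH
  have hHt : H ≠ ∞ := (lintegral_decay_lt_top (by linarith)).ne
  refine ⟨C0 * v + (K * v + H), by finiteness, fun x R hR => ?_⟩
  have hcancel : (ENNReal.ofReal R)⁻¹ ^ n * volume (Metric.ball x R) = v := by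
    rw [volume_ball_eq x hR, ← mul_assoc, ofReal_inv_pow_mul hR, one_mul]
  rw [ballScale]
  split_ifs with hR1
  · refine le_add_right ?_
    set lam := ENNReal.ofReal R ^ (-(n * (P x)⁻¹)) with hlam
    have hl0 : lam ≠ 0 := ofReal_rpow_ne_zero hR _
    have hlt : lam ≠ ∞ := ofReal_rpow_ne_top hR _
    have hPx := h.pos x
    have hlog : InLogRange n R x lam := by
      refine inLogRange_ofReal_rpow hR x ?_
      rw [abs_neg, abs_of_nonneg (by positivity)]
      exact mul_le_of_le_one_right (Nat.cast_nonneg n) (inv_le_one_of_one_le₀ (h.gt_one x).le)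
    calc ∫⁻ z in Metric.ball x R, lam ^ P z
        ≤ ∫⁻ z in Metric.ball x R, C0 * (ENNReal.ofReal R)⁻¹ ^ n := by
          refine setLIntegral_mono' measurableSet_ball fun z hz => ?_
          calc lam ^ P z = lam ^ (P z - P x) * lam ^ P x := by
                rw [← ENNReal.rpow_add _ _ hl0 hlt, sub_add_cancel]
            _ ≤ C0 * lam ^ P x := by
                gcongr
                exact hlog.rpow_le (Nat.cast_nonneg n) (hosc x z R hR (by linarith) hz)
            _ = _ := by
                rw [ofReal_inv_pow_eq, hlam, ← ENNReal.rpow_mul]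
                congr 2
                field_simp
      _ = C0 * v := by
          rw [lintegral_const, Measure.restrict_apply_univ, mul_assoc, hcancel]
  · refine le_add_left ?_
    have hR1' : 1 ≤ R := (not_le.1 hR1).le
    set lam := ENNReal.ofReal R ^ (-(n * θinf)) with hlam
    have hθ0 := h.inf_pos
    have hl1 : lam ≤ 1 := by
      calc lam ≤ ENNReal.ofReal R ^ (0 : ℝ) :=
            ENNReal.rpow_le_rpow_of_exponent_le (ENNReal.one_le_ofReal.2 hR1')
              (by rw [neg_nonpos]; positivity)
        _ = 1 := ENNReal.rpow_zero
    calc ∫⁻ z in Metric.ball x R, lam ^ P z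
        ≤ ∫⁻ z in Metric.ball x R, (K * (ENNReal.ofReal R)⁻¹ ^ n + decay (n + 1) z) := by
          gcongr with z
          refine (hconv lam z hl1).1.trans_eq ?_
          rw [ofReal_inv_pow_eq, hlam, ← ENNReal.rpow_mul]
          congr 3
          field_simp
      _ = K * v + ∫⁻ z in Metric.ball x R, decay (n + 1) z := by
          rw [lintegral_add_right _ (measurable_decay _), lintegral_const,
            Measure.restrict_apply_univ, mul_assoc, hcancel]
      _ ≤ K * v + H := by
          gcongr
          exact setLIntegral_le_lintegral _ _

/-- Boundedness of a Morrey-type modular with a variable scaling exponent. -/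
def MorreyModLe (P κ : Rn n → ℝ) (C : ℝ≥0∞) (G : Rn n → ℝ≥0∞) : Prop :=
  ∀ (x : Rn n) (ρ : ℝ), 0 < ρ →
    ∫⁻ z in Metric.ball x ρ, (ENNReal.ofReal ρ ^ (-κ x) * G z) ^ P z ≤ C

/-- The scaling exponent `n (1/p - 1/u)` of a Morrey space. -/
def morreyExp (P U : Rn n → ℝ) (x : Rn n) : ℝ := n * ((P x)⁻¹ - (U x)⁻¹)

lemma ballAvg_le_two_pow_mul {R : ℝ} (f : Rn n → ℝ≥0∞) {x x0 : Rn n}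
    (hx : x ∈ Metric.ball x0 R) : ballAvg R f x ≤ 2 ^ n * ballAvg (2 * R) f x0 := by
  have e : (ENNReal.ofReal R)⁻¹ ^ n = 2 ^ n * (ENNReal.ofReal (2 * R))⁻¹ ^ n := by
    rw [ENNReal.ofReal_mul two_pos.le, ENNReal.ofReal_ofNat, ← mul_pow,
      ENNReal.mul_inv (Or.inl two_ne_zero) (Or.inl ENNReal.ofNat_ne_top), ← mul_assoc,
      ENNReal.mul_inv_cancel two_ne_zero ENNReal.ofNat_ne_top, one_mul]
  rw [ballAvg, ballAvg, e, mul_assoc]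
  gcongr
  refine Metric.ball_subset_ball' ?_
  rw [Metric.mem_ball] at hx
  linarith

lemma LHExponentAt.exists_ballAvg_le_of_morreyModLe {P : Rn n → ℝ} {b d θinf : ℝ}
    (h : LHExponentAt P b d θinf) : ∃ C : ℝ≥0∞, C ≠ ∞ ∧ ∀ (κ : Rn n → ℝ) (G : Rn n → ℝ≥0∞)
      (x : Rn n) (R : ℝ), Measurable G → MorreyModLe P κ 1 G → 0 < R →
      ballAvg R G x ≤ C * (ENNReal.ofReal R ^ κ x * ballScale P θinf x R) := by
  obtain ⟨C, hC, hb⟩ := h.exists_ballAvg_le_ballScale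
  refine ⟨C, hC, fun κ G x R hG hM hR => ?_⟩
  have := hb x R (fun z => ENNReal.ofReal R ^ (-κ x) * G z) hR (hG.const_mul _) (hM x R hR)
  rw [ballAvg_const_mul hG] at this
  calc ballAvg R G x = ENNReal.ofReal R ^ κ x * (ENNReal.ofReal R ^ (-κ x) * ballAvg R G x) := by
        rw [← mul_assoc, ← ofReal_rpow_add hR, add_neg_cancel, ENNReal.rpow_zero, one_mul]
    _ ≤ ENNReal.ofReal R ^ κ x * (C * ballScale P θinf x R) := by gcongr
    _ = _ := by ring

lemma tsum_ite_mul_two_pow_rpow_le {ρ e : ℝ} (hρ : 0 < ρ) (he : 0 ≤ e) :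
    ∑' μ : ℕ, (if ρ * 2 ^ μ < 1 then ENNReal.ofReal (ρ * 2 ^ μ) ^ e else 0) ≤
      ∑' k : ℕ, (2 : ℝ≥0∞) ^ (-((k : ℝ) * e)) := by
  classical
  have hex : ∃ N : ℕ, 1 ≤ ρ * 2 ^ N := by
    obtain ⟨N, hN⟩ := pow_unbounded_of_one_lt ρ⁻¹ (one_lt_two (α := ℝ))
    exact ⟨N, by rw [← inv_le_iff_one_le_mul₀' hρ]; exact hN.le⟩
  set N := Nat.find hex with hN
  have hbig : ∀ μ, N ≤ μ → 1 ≤ ρ * 2 ^ μ := fun μ hμ =>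
    (Nat.find_spec hex).trans (by gcongr; norm_num)
  rw [tsum_eq_sum (s := Finset.range N) fun μ hμ => if_neg (not_lt.2 (hbig μ (by simpa using hμ)))]
  rw [← Finset.sum_range_reflect]
  refine le_trans (Finset.sum_le_sum fun k hk => ?_)
    (ENNReal.sum_le_tsum (f := fun k : ℕ => (2 : ℝ≥0∞) ^ (-((k : ℝ) * e))) (Finset.range N))
  rw [Finset.mem_range] at hk
  have hlt : ρ * 2 ^ (N - 1) < 1 := not_le.1 (Nat.find_min hex (by omega))
  have heq : ρ * 2 ^ (N - 1) = ρ * 2 ^ (N - 1 - k) * 2 ^ k := by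
    rw [mul_assoc, ← pow_add]
    congr 2
    omega
  have hle : ρ * 2 ^ (N - 1 - k) ≤ (2 : ℝ) ^ (-(k : ℝ)) := by
    rw [Real.rpow_neg two_pos.le, Real.rpow_natCast, ← one_div, le_div_iff₀ (by positivity),
      ← heq]
    exact hlt.le
  split_ifs
  · calc ENNReal.ofReal (ρ * 2 ^ (N - 1 - k)) ^ e ≤ ENNReal.ofReal ((2 : ℝ) ^ (-(k : ℝ))) ^ e := by
          gcongr
      _ = _ := by rw [ofReal_two_rpow, ← ENNReal.rpow_mul, neg_mul]
  · exact zero_le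

section

variable {P U : Rn n → ℝ} {b d θinf dU : ℝ}

lemma morreyExp_le (h : LHExponentAt P b d θinf) (hU : ∀ x, P x ≤ U x) (x : Rn n) :
    morreyExp P U x ≤ n := by
  refine mul_le_of_le_one_right (Nat.cast_nonneg n) ?_
  have h1 := inv_le_one_of_one_le₀ (h.gt_one x).le
  have h2 : 0 ≤ (U x)⁻¹ := inv_nonneg.2 ((h.pos x).le.trans (hU x))
  linarith

lemma ofReal_rpow_neg_morreyExp_le (h : LHExponentAt P b d θinf) (hU : ∀ x, P x ≤ U x) (x : Rn n)
    {ρ : ℝ} (hρ : 0 < ρ) : ENNReal.ofReal ρ ^ (-morreyExp P U x) ≤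
      2 ^ (n : ℝ) * ENNReal.ofReal (2 * ρ) ^ (-morreyExp P U x) := by
  have h1 : (1 : ℝ≥0∞) ≤ 2 ^ (n : ℝ) * 2 ^ (-morreyExp P U x) := by
    rw [← two_rpow_add, ← ENNReal.rpow_zero (x := 2)]
    exact two_rpow_mono (by linarith [morreyExp_le h hU x])
  rw [ENNReal.ofReal_mul two_pos.le, ENNReal.ofReal_ofNat,
    ENNReal.mul_rpow_of_ne_zero two_ne_zero (by simpa using hρ), ← mul_assoc]
  exact le_mul_of_one_le_left zero_le h1

lemma rpow_morreyExp_mul_ballScale_le (h : LHExponentAt P b d θinf) (x : Rn n)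
    {R : ℝ} (hR : 0 < R) (hR2 : R ≤ 2) :
    ENNReal.ofReal R ^ morreyExp P U x * ballScale P θinf x R ≤
      2 ^ (n : ℝ) * ENNReal.ofReal R ^ (-(n * (U x)⁻¹)) := by
  have hn0 : (0 : ℝ) ≤ n := Nat.cast_nonneg n
  rw [ballScale, ← ofReal_rpow_add hR]
  split_ifs with hR1
  · have e : morreyExp P U x + -(n * (P x)⁻¹) = -(n * (U x)⁻¹) := by
      rw [morreyExp]; ring
    rw [e]
    exact le_mul_of_one_le_left zero_le (by
      rw [← ENNReal.rpow_zero (x := 2)]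
      exact two_rpow_mono hn0)
  · have hR1' : 1 ≤ R := (not_le.1 hR1).le
    have e : morreyExp P U x + -(n * θinf) = (n * ((P x)⁻¹ - θinf)) + -(n * (U x)⁻¹) := by
      rw [morreyExp]; ring
    rw [e, ofReal_rpow_add hR]
    gcongr
    have h1 := inv_le_one_of_one_le₀ (h.gt_one x).le
    have h2 := h.inf_pos
    calc ENNReal.ofReal R ^ (n * ((P x)⁻¹ - θinf)) ≤ ENNReal.ofReal R ^ (n : ℝ) :=
          ENNReal.rpow_le_rpow_of_exponent_le (ENNReal.one_le_ofReal.2 hR1')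
            (mul_le_of_le_one_right hn0 (by linarith))
      _ ≤ 2 ^ (n : ℝ) := by
          gcongr
          rw [← ENNReal.ofReal_ofNat]
          exact ENNReal.ofReal_le_ofReal hR2

end

lemma MorreyModLe.mono {P κ : Rn n → ℝ} {C C' : ℝ≥0∞} {G G' : Rn n → ℝ≥0∞}
    (hP : ∀ x, 0 ≤ P x) (h : MorreyModLe P κ C G) (hG : ∀ x, G' x ≤ G x) (hC : C ≤ C') :
    MorreyModLe P κ C' G' := fun x ρ hρ => by
  refine le_trans (lintegral_mono fun z => ?_) ((h x ρ hρ).trans hC)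
  have := hP z
  have := hG z
  dsimp only
  gcongr

lemma mul_rpow_le_one_add_rpow_mul {p d : ℝ} (hp : 0 ≤ p) (hpd : p ≤ d) (c a : ℝ≥0∞) :
    (c * a) ^ p ≤ (1 + c) ^ d * a ^ p := by
  rw [ENNReal.mul_rpow_of_nonneg _ _ hp]
  gcongr
  exact (ENNReal.rpow_le_rpow le_add_self hp).trans
    (ENNReal.rpow_le_rpow_of_exponent_le le_self_add hpd)

lemma MorreyModLe.lintegral_indicator_le {P κ : Rn n → ℝ} {C : ℝ≥0∞} {G : Rn n → ℝ≥0∞}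
    (h : MorreyModLe P κ C G) (hP : ∀ x, 0 < P x) (x : Rn n) {ρ : ℝ} (hρ : 0 < ρ) :
    ∫⁻ z, ((Metric.ball x ρ).indicator (fun z => ENNReal.ofReal ρ ^ (-κ x) * G z) z) ^ P z ≤ C := by
  refine le_trans (le_of_eq ?_) (h x ρ hρ)
  rw [← lintegral_indicator measurableSet_ball]
  congr 1
  funext z
  by_cases hz : z ∈ Metric.ball x ρ
  · simp only [Set.indicator_of_mem hz]
  · simp only [Set.indicator_of_notMem hz, ENNReal.zero_rpow_of_pos (hP z)]

lemma measurable_lqSum_rpow {P Q : Rn n → ℝ} (hP : Measurable P) (hQ : Measurable Q)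
    {g : ℕ → Rn n → ℝ≥0∞} (hg : ∀ μ, Measurable (g μ)) :
    Measurable fun x => lqSum (Q x) (fun μ => g μ x) ^ P x :=
  ((Measurable.tsum fun μ => (hg μ).pow hQ).pow hQ.inv).pow hP

section

variable {P U : Rn n → ℝ} {b d θinf dU : ℝ}

/-- The contribution of a large ball to a small ball centred at the same point. -/
lemma rpow_neg_morreyExp_mul_le (h : LHExponentAt P b d θinf) (hU : ∀ x, P x ≤ U x)
    (hUd : ∀ x, U x ≤ dU) (x : Rn n) {ρ : ℝ} (hρ : 0 < ρ) (μ : ℕ) (hμ : ρ * 2 ^ μ < 1) :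
    ENNReal.ofReal ρ ^ (-morreyExp P U x) *
      (ENNReal.ofReal (2 * (2 : ℝ)⁻¹ ^ μ) ^ morreyExp P U x *
        ballScale P θinf x (2 * (2 : ℝ)⁻¹ ^ μ)) ≤
      2 ^ (n : ℝ) * (ballScale P θinf x ρ * ENNReal.ofReal (ρ * 2 ^ μ) ^ (n * dU⁻¹)) := by
  have hr : (0 : ℝ) < (2 : ℝ)⁻¹ ^ μ := by positivity
  have hr1 : (2 : ℝ)⁻¹ ^ μ ≤ 1 := pow_le_one₀ (by norm_num) (by norm_num)
  have hn0 : (0 : ℝ) ≤ n := Nat.cast_nonneg n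
  have hUpos : 0 < U x := (h.pos x).trans_le (hU x)
  have hρ1 : ρ ≤ 1 := by
    have : (1 : ℝ) ≤ 2 ^ μ := one_le_pow₀ one_le_two
    nlinarith
  have hu0 : 0 ≤ n * (U x)⁻¹ := by positivity
  have e1 : ENNReal.ofReal (2 * (2 : ℝ)⁻¹ ^ μ) ^ (-(n * (U x)⁻¹)) ≤
      ENNReal.ofReal ((2 : ℝ)⁻¹ ^ μ) ^ (-(n * (U x)⁻¹)) :=
    rpow_neg_le_rpow_neg (ENNReal.ofReal_le_ofReal (by linarith)) hu0
  have e2 : ENNReal.ofReal ((2 : ℝ)⁻¹ ^ μ) ^ (-(n * (U x)⁻¹)) =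
      ENNReal.ofReal (2 ^ μ) ^ (n * (U x)⁻¹) := by
    rw [inv_pow, ENNReal.ofReal_inv_of_pos (by positivity), ENNReal.inv_rpow, ← ENNReal.rpow_neg,
      neg_neg]
  have e3 : ENNReal.ofReal ρ ^ (-morreyExp P U x) =
      ENNReal.ofReal ρ ^ (-(n * (P x)⁻¹)) * ENNReal.ofReal ρ ^ (n * (U x)⁻¹) := by
    rw [← ofReal_rpow_add hρ, morreyExp]
    ring_nf
  have e4 : ENNReal.ofReal (ρ * 2 ^ μ) ^ (n * (U x)⁻¹) ≤
      ENNReal.ofReal (ρ * 2 ^ μ) ^ (n * dU⁻¹) := by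
    refine ENNReal.rpow_le_rpow_of_exponent_ge (ENNReal.ofReal_le_one.2 hμ.le) ?_
    gcongr
    exact hUd x
  calc _ ≤ ENNReal.ofReal ρ ^ (-morreyExp P U x) *
        (2 ^ (n : ℝ) * ENNReal.ofReal (2 ^ μ) ^ (n * (U x)⁻¹)) := by
        rw [← e2]
        refine mul_le_mul' le_rfl ?_
        refine (rpow_morreyExp_mul_ballScale_le h x (by positivity) (by linarith)).trans ?_
        exact mul_le_mul' le_rfl e1
    _ = 2 ^ (n : ℝ) * (ENNReal.ofReal ρ ^ (-(n * (P x)⁻¹)) *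
          ENNReal.ofReal (ρ * 2 ^ μ) ^ (n * (U x)⁻¹)) := by
        rw [e3, ENNReal.ofReal_mul hρ.le, ENNReal.mul_rpow_of_nonneg _ _ hu0]
        ring
    _ ≤ _ := by
        rw [ballScale, if_pos hρ1]
        exact mul_le_mul' le_rfl (mul_le_mul' le_rfl e4)

theorem exists_morreyModLe_lqSum_ballAvg (hn : 0 < n) (hP : LHExponentAt P b d θinf)
    {Q : Rn n → ℝ} {bQ dQ tQ : ℝ} (hQ : LHExponent Q bQ dQ tQ) (hU : ∀ x, P x ≤ U x)
    (hUd : ∀ x, U x ≤ dU) :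
    ∃ C : ℝ≥0∞, C ≠ ∞ ∧ ∀ (g : ℕ → Rn n → ℝ≥0∞) (G : Rn n → ℝ≥0∞), (∀ μ, Measurable (g μ)) →
      Measurable G → (∀ x, lqSum (Q x) (fun μ => g μ x) ≤ G x) →
      MorreyModLe P (morreyExp P U) 1 G →
      MorreyModLe P (morreyExp P U) C
        (fun x => lqSum (Q x) (fun μ => ballAvg ((2 : ℝ)⁻¹ ^ μ) (g μ) x)) := by
  obtain ⟨CA, hCA, hA⟩ := exists_modular_ballAvg_le hP.toLHExponent hQ
  obtain ⟨C1, hC1, hB⟩ := hP.exists_ballAvg_le_of_morreyModLe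
  obtain ⟨CS, hCS, hS⟩ := hP.exists_lintegral_ballScale_le
  have hdU : 0 < dU := (hP.pos 0).trans_le ((hU 0).trans (hUd 0))
  have he : 0 < n * dU⁻¹ := mul_pos (Nat.cast_pos.2 hn) (inv_pos.2 hdU)
  set S : ℝ≥0∞ := ∑' k : ℕ, (2 : ℝ≥0∞) ^ (-((k : ℝ) * (n * dU⁻¹))) with hSdef
  have hSt : S ≠ ∞ := tsum_two_rpow_ne_top he
  set K : ℝ≥0∞ := 2 ^ n * C1 * 2 ^ (n : ℝ) * S with hK
  have hKt : K ≠ ∞ := by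
    rw [hK]
    exact ENNReal.mul_ne_top (ENNReal.mul_ne_top (ENNReal.mul_ne_top (by finiteness) hC1)
      (two_rpow_ne_top _)) hSt
  have hd0 : 0 ≤ d := (zero_lt_one.trans hP.one_le_hi).le
  refine ⟨2 ^ d * ((1 + 2 ^ (n : ℝ)) ^ d * CA + (1 + K) ^ d * CS), ?_, ?_⟩
  · refine ENNReal.mul_ne_top (two_rpow_ne_top _) (ENNReal.add_ne_top.2 ⟨ENNReal.mul_ne_top
      (ENNReal.rpow_ne_top_of_nonneg hd0 ?_) hCA,
      ENNReal.mul_ne_top (ENNReal.rpow_ne_top_of_nonneg hd0 (by finiteness)) hCS⟩)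
    exact ENNReal.add_ne_top.2 ⟨ENNReal.one_ne_top, two_rpow_ne_top _⟩
  intro g G hg hG hgG hM x0 ρ hρ
  set κ := morreyExp P U with hκ
  set h : ℕ → Rn n → ℝ≥0∞ := fun μ => (Metric.ball x0 (2 * ρ)).indicator
    (fun z => ENNReal.ofReal (2 * ρ) ^ (-κ x0) * g μ z) with hh
  have hhm : ∀ μ, Measurable (h μ) := fun μ => ((hg μ).const_mul _).indicator measurableSet_ball
  have hmod : ∫⁻ x, (∑' μ, ballAvg ((2 : ℝ)⁻¹ ^ μ) (h μ) x ^ Q x) ^ (P x / Q x) ≤ CA := by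
    refine hA h hhm (le_trans (lintegral_mono fun z => ?_)
      (hM.lintegral_indicator_le hP.pos x0 (ρ := 2 * ρ) (by positivity)))
    rw [← lqSum_rpow_eq]
    refine ENNReal.rpow_le_rpow ?_ (hP.pos z).le
    by_cases hz : z ∈ Metric.ball x0 (2 * ρ)
    · simp only [hh, Set.indicator_of_mem hz]
      rw [lqSum_const_mul (hQ.pos z)]
      gcongr
      exact hgG z
    · simp only [hh, Set.indicator_of_notMem hz]
      simp [lqSum, hQ.pos z]
  have hpt : ∀ x ∈ Metric.ball x0 ρ, ENNReal.ofReal ρ ^ (-κ x0) *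
      lqSum (Q x) (fun μ => ballAvg ((2 : ℝ)⁻¹ ^ μ) (g μ) x) ≤
      2 ^ (n : ℝ) * lqSum (Q x) (fun μ => ballAvg ((2 : ℝ)⁻¹ ^ μ) (h μ) x) +
        K * ballScale P θinf x0 ρ := by
    intro x hx
    have hQ0 := hQ.pos x
    have hQ1 := (hQ.gt_one x).le
    set t : ℕ → ℝ≥0∞ := fun μ => 2 ^ n * C1 * 2 ^ (n : ℝ) * ballScale P θinf x0 ρ *
      (if ρ * 2 ^ μ < 1 then ENNReal.ofReal (ρ * 2 ^ μ) ^ (n * dU⁻¹) else 0) with ht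
    have hterm : ∀ μ, ENNReal.ofReal ρ ^ (-κ x0) * ballAvg ((2 : ℝ)⁻¹ ^ μ) (g μ) x ≤
        2 ^ (n : ℝ) * ballAvg ((2 : ℝ)⁻¹ ^ μ) (h μ) x + t μ := by
      intro μ
      have hr : (0 : ℝ) < (2 : ℝ)⁻¹ ^ μ := by positivity
      have hinv : ρ * 2 ^ μ < 1 ↔ ρ < (2 : ℝ)⁻¹ ^ μ := by
        rw [inv_pow, ← one_div, lt_div_iff₀ (by positivity)]
      by_cases hc : ρ * 2 ^ μ < 1
      · refine le_add_left ?_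
        have hlt := hinv.1 hc
        have h1 : ballAvg ((2 : ℝ)⁻¹ ^ μ) (g μ) x ≤ 2 ^ n * (C1 *
            (ENNReal.ofReal (2 * (2 : ℝ)⁻¹ ^ μ) ^ κ x0 *
              ballScale P θinf x0 (2 * (2 : ℝ)⁻¹ ^ μ))) := by
          refine (ballAvg_le_two_pow_mul _ (Metric.ball_subset_ball hlt.le hx)).trans ?_
          gcongr
          refine le_trans (ballAvg_mono fun z _ => ?_)
            (hB κ G x0 (2 * (2 : ℝ)⁻¹ ^ μ) hG hM (by positivity))
          exact (le_lqSum (hQ.pos z) (fun μ => g μ z) μ).trans (hgG z)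
        have h2 := rpow_neg_morreyExp_mul_le hP hU hUd x0 hρ μ hc
        calc _ ≤ ENNReal.ofReal ρ ^ (-κ x0) * (2 ^ n * (C1 *
              (ENNReal.ofReal (2 * (2 : ℝ)⁻¹ ^ μ) ^ κ x0 *
                ballScale P θinf x0 (2 * (2 : ℝ)⁻¹ ^ μ)))) := by gcongr
          _ = 2 ^ n * C1 * (ENNReal.ofReal ρ ^ (-κ x0) *
              (ENNReal.ofReal (2 * (2 : ℝ)⁻¹ ^ μ) ^ κ x0 *
                ballScale P θinf x0 (2 * (2 : ℝ)⁻¹ ^ μ))) := by ring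
          _ ≤ 2 ^ n * C1 * (2 ^ (n : ℝ) * (ballScale P θinf x0 ρ *
              ENNReal.ofReal (ρ * 2 ^ μ) ^ (n * dU⁻¹))) := mul_le_mul' le_rfl h2
          _ = t μ := by
              simp only [ht, if_pos hc]
              ring
      · refine le_add_right ?_
        have hle : (2 : ℝ)⁻¹ ^ μ ≤ ρ := not_lt.1 fun hlt => hc (hinv.2 hlt)
        calc _ ≤ (2 ^ (n : ℝ) * ENNReal.ofReal (2 * ρ) ^ (-κ x0)) *
              ballAvg ((2 : ℝ)⁻¹ ^ μ) (g μ) x := by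
              exact mul_le_mul' (ofReal_rpow_neg_morreyExp_le hP hU x0 hρ) le_rfl
          _ = 2 ^ (n : ℝ) * ballAvg ((2 : ℝ)⁻¹ ^ μ)
              (fun z => ENNReal.ofReal (2 * ρ) ^ (-κ x0) * g μ z) x := by
              rw [ballAvg_const_mul (hg μ), mul_assoc]
          _ = _ := by
              rw [ballAvg_indicator hx (τ := 2 * ρ) (by linarith)]
    rw [← lqSum_const_mul hQ0]
    refine (lqSum_mono hQ0.le hterm).trans ((lqSum_add_le hQ1 _ _).trans ?_)
    rw [lqSum_const_mul hQ0]
    refine add_le_add le_rfl ?_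
    refine (lqSum_le_tsum hQ1 _).trans ?_
    simp only [ht]
    rw [ENNReal.tsum_mul_left, hK]
    calc _ ≤ 2 ^ n * C1 * 2 ^ (n : ℝ) * ballScale P θinf x0 ρ * S := by
          exact mul_le_mul' le_rfl (tsum_ite_mul_two_pow_rpow_le hρ he.le)
      _ = _ := by ring
  have hmeas := measurable_lqSum_rpow hP.measurable hQ.measurable
    fun μ => measurable_ballAvg ((2 : ℝ)⁻¹ ^ μ) (hhm μ)
  have hmod' : ∫⁻ x, lqSum (Q x) (fun μ => ballAvg ((2 : ℝ)⁻¹ ^ μ) (h μ) x) ^ P x ≤ CA := by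
    simpa only [lqSum_rpow_eq] using hmod
  calc _ ≤ ∫⁻ x in Metric.ball x0 ρ, 2 ^ d * ((1 + 2 ^ (n : ℝ)) ^ d *
        lqSum (Q x) (fun μ => ballAvg ((2 : ℝ)⁻¹ ^ μ) (h μ) x) ^ P x +
        (1 + K) ^ d * ballScale P θinf x0 ρ ^ P x) := by
        refine setLIntegral_mono' measurableSet_ball fun x hx => ?_
        refine (ENNReal.rpow_le_rpow (hpt x hx) (hP.pos x).le).trans
          ((add_rpow_le_two_rpow_mul (hP.pos x).le (hP.le x) _ _).trans ?_)
        exact mul_le_mul' le_rfl (add_le_add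
          (mul_rpow_le_one_add_rpow_mul (hP.pos x).le (hP.le x) _ _)
          (mul_rpow_le_one_add_rpow_mul (hP.pos x).le (hP.le x) _ _))
    _ = 2 ^ d * ((1 + 2 ^ (n : ℝ)) ^ d * (∫⁻ x in Metric.ball x0 ρ,
        lqSum (Q x) (fun μ => ballAvg ((2 : ℝ)⁻¹ ^ μ) (h μ) x) ^ P x) +
        (1 + K) ^ d * ∫⁻ x in Metric.ball x0 ρ, ballScale P θinf x0 ρ ^ P x) := by
        have hm2 : Measurable fun x => ballScale P θinf x0 ρ ^ P x :=
          measurable_const.pow hP.measurable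
        rw [lintegral_const_mul _ ((hmeas.const_mul _).fun_add (hm2.const_mul _)),
          lintegral_add_left (hmeas.const_mul _), lintegral_const_mul _ hmeas,
          lintegral_const_mul _ hm2]
    _ ≤ _ := by
        exact mul_le_mul' le_rfl (add_le_add
          (mul_le_mul' le_rfl ((setLIntegral_le_lintegral _ _).trans hmod'))
          (mul_le_mul' le_rfl (hS x0 ρ hρ)))

end

section

variable {P U : Rn n → ℝ} {b d θinf dU c' : ℝ}

lemma rpow_neg_morreyExp_mul_rpow_le_ballScale (h : LHExponentAt P b d θinf) (hU : ∀ x, P x ≤ U x)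
    (hc0 : 0 ≤ c') (x : Rn n) (hc : morreyExp P U x - n * θinf ≤ c') {ρ T : ℝ} (hρ : 0 < ρ)
    (hT : 1 ≤ T) (hρT : ρ ≤ T) :
    ENNReal.ofReal ρ ^ (-morreyExp P U x) *
      ENNReal.ofReal T ^ (morreyExp P U x - n * θinf - c') ≤ ballScale P θinf x ρ := by
  set e := morreyExp P U x - n * θinf with he
  have hT1 : 1 ≤ ENNReal.ofReal T := ENNReal.one_le_ofReal.2 hT
  have hTe : ENNReal.ofReal T ^ (e - c') ≤ 1 := by
    rw [← ENNReal.rpow_zero (x := ENNReal.ofReal T)]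
    exact ENNReal.rpow_le_rpow_of_exponent_le hT1 (by linarith)
  rw [ballScale]
  split_ifs with hρ1
  · calc _ ≤ ENNReal.ofReal ρ ^ (-morreyExp P U x) * 1 := mul_le_mul' le_rfl hTe
      _ ≤ _ := by
        rw [mul_one]
        refine ENNReal.rpow_le_rpow_of_exponent_ge (ENNReal.ofReal_le_one.2 hρ1) ?_
        have h1 : 0 ≤ n * (U x)⁻¹ :=
          mul_nonneg (Nat.cast_nonneg n) (inv_nonneg.2 ((h.pos x).le.trans (hU x)))
        rw [morreyExp, mul_sub]
        linarith
  · have hρ1' : 1 ≤ ENNReal.ofReal ρ := ENNReal.one_le_ofReal.2 (not_le.1 hρ1).le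
    have h2 : ENNReal.ofReal T ^ (e - c') ≤ ENNReal.ofReal ρ ^ e := by
      rcases le_total 0 e with h0 | h0
      · refine hTe.trans ?_
        rw [← ENNReal.rpow_zero (x := ENNReal.ofReal ρ)]
        exact ENNReal.rpow_le_rpow_of_exponent_le hρ1' h0
      · calc ENNReal.ofReal T ^ (e - c') ≤ ENNReal.ofReal T ^ e :=
              ENNReal.rpow_le_rpow_of_exponent_le hT1 (by linarith)
          _ ≤ _ := by
              have := rpow_neg_le_rpow_neg (ENNReal.ofReal_le_ofReal hρT) (neg_nonneg.2 h0)
              rwa [neg_neg] at this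
    calc _ ≤ ENNReal.ofReal ρ ^ (-morreyExp P U x) * ENNReal.ofReal ρ ^ e :=
          mul_le_mul' le_rfl h2
      _ = _ := by
          rw [← ofReal_rpow_add hρ, he]
          ring_nf

theorem exists_morreyModLe_ballAvg (hP : LHExponentAt P b d θinf) (hU : ∀ x, P x ≤ U x)
    (hc0 : 0 ≤ c') (hc : ∀ x, morreyExp P U x - n * θinf ≤ c') :
    ∃ C : ℝ≥0∞, C ≠ ∞ ∧ ∀ G : Rn n → ℝ≥0∞, Measurable G → MorreyModLe P (morreyExp P U) 1 G →
      ∀ R : ℝ, 1 ≤ R → MorreyModLe P (morreyExp P U) C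
        (fun x => ENNReal.ofReal R ^ (-c') * ballAvg R G x) := by
  obtain ⟨CA, hCA, hA⟩ := hP.exists_modular_ballAvg_le
  obtain ⟨C1, hC1, hB⟩ := hP.exists_ballAvg_le_of_morreyModLe
  obtain ⟨CS, hCS, hS⟩ := hP.exists_lintegral_ballScale_le
  have hd0 : 0 ≤ d := (zero_lt_one.trans hP.one_le_hi).le
  set K : ℝ≥0∞ := 2 ^ n * C1 * 2 ^ c' with hK
  have hKt : K ≠ ∞ :=
    ENNReal.mul_ne_top (ENNReal.mul_ne_top (by finiteness) hC1) (two_rpow_ne_top _)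
  refine ⟨(1 + 2 ^ (n : ℝ)) ^ d * CA + (1 + K) ^ d * CS, ?_, ?_⟩
  · refine ENNReal.add_ne_top.2 ⟨ENNReal.mul_ne_top
      (ENNReal.rpow_ne_top_of_nonneg hd0 ?_) hCA,
      ENNReal.mul_ne_top (ENNReal.rpow_ne_top_of_nonneg hd0 (by finiteness)) hCS⟩
    exact ENNReal.add_ne_top.2 ⟨ENNReal.one_ne_top, two_rpow_ne_top _⟩
  intro G hG hM R hR x0 ρ hρ
  set κ := morreyExp P U with hκ
  have hR0 : 0 < R := zero_lt_one.trans_le hR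
  rcases le_or_gt R ρ with hRρ | hRρ
  · refine le_add_right ?_
    set h : Rn n → ℝ≥0∞ := (Metric.ball x0 (2 * ρ)).indicator
      (fun z => ENNReal.ofReal (2 * ρ) ^ (-κ x0) * G z) with hh
    have hhm : Measurable h := (hG.const_mul _).indicator measurableSet_ball
    have hmod := hA R h hR hhm
      (hM.lintegral_indicator_le hP.pos x0 (ρ := 2 * ρ) (by positivity))
    have hmeas : Measurable fun x => ballAvg R h x ^ P x :=
      (measurable_ballAvg R hhm).pow hP.measurable
    calc _ ≤ ∫⁻ x in Metric.ball x0 ρ, (1 + 2 ^ (n : ℝ)) ^ d * ballAvg R h x ^ P x := by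
          refine setLIntegral_mono' measurableSet_ball fun x hx => ?_
          refine le_trans (ENNReal.rpow_le_rpow ?_ (hP.pos x).le)
            (mul_rpow_le_one_add_rpow_mul (hP.pos x).le (hP.le x) _ _)
          have hRc : ENNReal.ofReal R ^ (-c') ≤ 1 := by
            rw [← ENNReal.rpow_zero (x := ENNReal.ofReal R)]
            exact ENNReal.rpow_le_rpow_of_exponent_le (ENNReal.one_le_ofReal.2 hR) (by linarith)
          calc _ ≤ (2 ^ (n : ℝ) * ENNReal.ofReal (2 * ρ) ^ (-κ x0)) * (1 * ballAvg R G x) :=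
                mul_le_mul' (ofReal_rpow_neg_morreyExp_le hP hU x0 hρ)
                  (mul_le_mul' hRc le_rfl)
            _ = 2 ^ (n : ℝ) *
                ballAvg R (fun z => ENNReal.ofReal (2 * ρ) ^ (-κ x0) * G z) x := by
                rw [ballAvg_const_mul hG, one_mul, mul_assoc]
            _ = _ := by
                rw [ballAvg_indicator hx (τ := 2 * ρ) (by linarith)]
      _ = (1 + 2 ^ (n : ℝ)) ^ d * ∫⁻ x in Metric.ball x0 ρ, ballAvg R h x ^ P x :=
          lintegral_const_mul _ hmeas
      _ ≤ _ := mul_le_mul' le_rfl ((setLIntegral_le_lintegral _ _).trans hmod)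
  · refine le_add_left ?_
    have hm2 : Measurable fun x => ballScale P θinf x0 ρ ^ P x :=
      measurable_const.pow hP.measurable
    have hT : 0 < 2 * R := by positivity
    calc _ ≤ ∫⁻ x in Metric.ball x0 ρ, (1 + K) ^ d * ballScale P θinf x0 ρ ^ P x := by
          refine setLIntegral_mono' measurableSet_ball fun x hx => ?_
          refine le_trans (ENNReal.rpow_le_rpow ?_ (hP.pos x).le)
            (mul_rpow_le_one_add_rpow_mul (hP.pos x).le (hP.le x) _ _)
          have h1 : ballAvg R G x ≤ 2 ^ n * (C1 *
              (ENNReal.ofReal (2 * R) ^ κ x0 * ballScale P θinf x0 (2 * R))) :=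
            (ballAvg_le_two_pow_mul _ (Metric.ball_subset_ball hRρ.le hx)).trans
              (mul_le_mul' le_rfl (hB κ G x0 (2 * R) hG hM hT))
          have h2 : ENNReal.ofReal R ^ (-c') = 2 ^ c' * ENNReal.ofReal (2 * R) ^ (-c') := by
            rw [ENNReal.ofReal_mul two_pos.le, ENNReal.ofReal_ofNat,
              ENNReal.mul_rpow_of_ne_zero two_ne_zero (by simpa using hR0), ← mul_assoc,
              ← two_rpow_add, add_neg_cancel, ENNReal.rpow_zero, one_mul]
          have h3 : ballScale P θinf x0 (2 * R) = ENNReal.ofReal (2 * R) ^ (-(n * θinf)) := by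
            rw [ballScale, if_neg (by linarith)]
          have h4 := rpow_neg_morreyExp_mul_rpow_le_ballScale hP hU hc0 x0 (hc x0) hρ
            (T := 2 * R) (by linarith) (by linarith)
          have h5 : ENNReal.ofReal (2 * R) ^ (κ x0 - n * θinf - c') = ENNReal.ofReal (2 * R) ^ κ x0 *
              ENNReal.ofReal (2 * R) ^ (-(n * θinf)) * ENNReal.ofReal (2 * R) ^ (-c') := by
            rw [← ofReal_rpow_add hT, ← ofReal_rpow_add hT]
            ring_nf
          calc _ ≤ ENNReal.ofReal ρ ^ (-κ x0) * (ENNReal.ofReal R ^ (-c') * (2 ^ n * (C1 *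
                (ENNReal.ofReal (2 * R) ^ κ x0 * ballScale P θinf x0 (2 * R))))) :=
                mul_le_mul' le_rfl (mul_le_mul' le_rfl h1)
            _ = K * (ENNReal.ofReal ρ ^ (-κ x0) *
                  ENNReal.ofReal (2 * R) ^ (κ x0 - n * θinf - c')) := by
                rw [h2, h3, h5, hK]
                ring
            _ ≤ _ := mul_le_mul' le_rfl h4
      _ = (1 + K) ^ d * ∫⁻ x in Metric.ball x0 ρ, ballScale P θinf x0 ρ ^ P x :=
          lintegral_const_mul _ hm2
      _ ≤ _ := mul_le_mul' le_rfl (hS x0 ρ hρ)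

end

lemma MorreyModLe.tsum {P κ : Rn n → ℝ} {d : ℝ} {C : ℝ≥0∞} (hPm : Measurable P)
    (hP1 : ∀ x, 1 ≤ P x) (hPd : ∀ x, P x ≤ d) (w : ℕ → ℝ≥0∞) {F : ℕ → Rn n → ℝ≥0∞}
    (hF : ∀ e, Measurable (F e)) (hC : ∀ e, MorreyModLe P κ C (F e)) :
    MorreyModLe P κ ((1 + ∑' e, w e) ^ d * C) (fun x => ∑' e, w e * F e x) := fun x ρ hρ => by
  have := lintegral_tsum_mul_rpow_le (volume.restrict (Metric.ball x ρ)) hPm hP1 hPd w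
    (F := fun e z => ENNReal.ofReal ρ ^ (-κ x) * F e z) (fun e => (hF e).const_mul _)
    (fun e => hC e x ρ hρ)
  refine le_trans (le_of_eq ?_) this
  congr 1
  funext z
  rw [← ENNReal.tsum_mul_left]
  simp only [mul_left_comm]

lemma MorreyModLe.add {P κ : Rn n → ℝ} {d : ℝ} {C C' : ℝ≥0∞} (hPm : Measurable P)
    (hP0 : ∀ x, 0 ≤ P x) (hPd : ∀ x, P x ≤ d) {F F' : Rn n → ℝ≥0∞} (hF : Measurable F)
    (hC : MorreyModLe P κ C F) (hF' : Measurable F') (hC' : MorreyModLe P κ C' F') :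
    MorreyModLe P κ (2 ^ d * (C + C')) (fun x => F x + F' x) := fun x ρ hρ => by
  have hm := ((hF.const_mul (ENNReal.ofReal ρ ^ (-κ x))).pow hPm)
  have hm' := ((hF'.const_mul (ENNReal.ofReal ρ ^ (-κ x))).pow hPm)
  calc _ ≤ ∫⁻ z in Metric.ball x ρ, 2 ^ d * ((ENNReal.ofReal ρ ^ (-κ x) * F z) ^ P z +
        (ENNReal.ofReal ρ ^ (-κ x) * F' z) ^ P z) := by
        refine lintegral_mono fun z => ?_
        dsimp only
        rw [mul_add]
        exact add_rpow_le_two_rpow_mul (hP0 z) (hPd z) _ _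
    _ = 2 ^ d * ((∫⁻ z in Metric.ball x ρ, (ENNReal.ofReal ρ ^ (-κ x) * F z) ^ P z) +
        ∫⁻ z in Metric.ball x ρ, (ENNReal.ofReal ρ ^ (-κ x) * F' z) ^ P z) := by
        rw [lintegral_const_mul _ (hm.fun_add hm'), lintegral_add_left hm]
    _ ≤ _ := mul_le_mul' le_rfl (add_le_add (hC x ρ hρ) (hC' x ρ hρ))

lemma MorreyModLe.const_mul {P κ : Rn n → ℝ} {d : ℝ} {C : ℝ≥0∞}
    (hP0 : ∀ x, 0 ≤ P x) (hPd : ∀ x, P x ≤ d) {c : ℝ≥0∞} (hc : c ≠ ∞) {F : Rn n → ℝ≥0∞}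
    (hC : MorreyModLe P κ C F) :
    MorreyModLe P κ ((1 + c) ^ d * C) (fun x => c * F x) := fun x ρ hρ => by
  calc _ ≤ ∫⁻ z in Metric.ball x ρ, (1 + c) ^ d * (ENNReal.ofReal ρ ^ (-κ x) * F z) ^ P z := by
        refine lintegral_mono fun z => ?_
        dsimp only
        rw [mul_left_comm]
        exact mul_rpow_le_one_add_rpow_mul (hP0 z) (hPd z) _ _
    _ = (1 + c) ^ d * ∫⁻ z in Metric.ball x ρ, (ENNReal.ofReal ρ ^ (-κ x) * F z) ^ P z :=
        lintegral_const_mul' _ _ (ENNReal.rpow_ne_top_of_nonneg ((hP0 x).trans (hPd x))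
          (ENNReal.add_ne_top.2 ⟨ENNReal.one_ne_top, hc⟩))
    _ ≤ _ := mul_le_mul' le_rfl (hC x ρ hρ)

lemma measurable_lqSum {Q : Rn n → ℝ} (hQ : Measurable Q) {g : ℕ → Rn n → ℝ≥0∞}
    (hg : ∀ μ, Measurable (g μ)) : Measurable fun x => lqSum (Q x) (fun μ => g μ x) :=
  (Measurable.tsum fun μ => (hg μ).pow hQ).pow hQ.inv

lemma lqSum_le_sum_add_shift {q : ℝ} (hq : 1 ≤ q) (a : ℕ → ℝ≥0∞) (i : ℕ) :
    lqSum q a ≤ (∑ j ∈ Finset.range i, a j) + lqSum q (fun μ => a (μ + i)) := by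
  have hq0 : 0 < q := by linarith
  have e : a = fun j => (if j < i then a j else 0) + (if j < i then 0 else a j) := by
    funext j
    split_ifs <;> simp
  rw [e]
  refine (lqSum_add_le hq _ _).trans (add_le_add ?_ ?_)
  · refine (lqSum_le_tsum hq _).trans ?_
    rw [tsum_eq_sum (s := Finset.range i) fun j hj => if_neg (by simpa using hj)]
    refine Finset.sum_le_sum fun j hj => ?_
    rw [if_pos (Finset.mem_range.1 hj)]
    simp [Finset.mem_range.1 hj]
  · unfold lqSum
    gcongr ?_ ^ _
    rw [← ENNReal.summable.sum_add_tsum_nat_add' (k := i), Finset.sum_eq_zero, zero_add]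
    · simp
    · intro j hj
      simp [Finset.mem_range.1 hj, hq0]

/-- The radius `2^{i-j}`. -/
def dyRad (j i : ℕ) : ℝ := 2 ^ i * (2 : ℝ)⁻¹ ^ j

lemma dyRad_add_left (μ i : ℕ) : dyRad (μ + i) i = (2 : ℝ)⁻¹ ^ μ := by
  rw [dyRad, pow_add, mul_left_comm, ← mul_pow]
  norm_num

lemma dyRad_add_right (j l : ℕ) : dyRad j (j + l) = 2 ^ l := by
  rw [dyRad, pow_add, mul_right_comm, ← mul_pow]
  norm_num

lemma ofReal_two_pow (l : ℕ) : ENNReal.ofReal (2 ^ l) = 2 ^ l := by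
  rw [ENNReal.ofReal_pow two_pos.le, ENNReal.ofReal_ofNat]

lemma inv_ofReal_dyRad_pow (j i : ℕ) :
    (ENNReal.ofReal (dyRad j i))⁻¹ ^ n = 2 ^ ((j : ℝ) * n) * 2 ^ (-((i : ℝ) * n)) := by
  have e : dyRad j i = (2 : ℝ) ^ ((i : ℝ) - j) := by
    rw [dyRad, Real.rpow_sub two_pos, Real.rpow_natCast, Real.rpow_natCast, inv_pow, div_eq_mul_inv]
  rw [e, ofReal_two_rpow, ← ENNReal.rpow_neg, ← ENNReal.rpow_natCast, ← ENNReal.rpow_mul,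
    ← two_rpow_add]
  ring_nf

lemma two_rpow_mul_dyBr_rpow_neg_le {m : ℝ} (hm : 0 ≤ m) (j : ℕ) (x z : Rn n) :
    (2 : ℝ≥0∞) ^ ((j : ℝ) * n) * dyBr j x z ^ (-m) ≤
      ∑' i : ℕ, 2 ^ m * 2 ^ (-((i : ℝ) * (m - n))) *
        ((ENNReal.ofReal (dyRad j i))⁻¹ ^ n * nearInd (dyRad j i) x z) := by
  classical
  have hex : ∃ i : ℕ, 2 ^ j * ‖x - z‖ < 2 ^ i := pow_unbounded_of_one_lt _ one_lt_two
  set i := Nat.find hex with hi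
  have h1 : 2 ^ j * ‖x - z‖ < 2 ^ i := Nat.find_spec hex
  have h2 : (2 : ℝ) ^ ((i : ℝ) - 1) ≤ 1 + 2 ^ j * ‖x - z‖ := by
    have hnn : 0 ≤ 2 ^ j * ‖x - z‖ := by positivity
    rcases Nat.eq_zero_or_pos i with h0 | h0
    · rw [h0, Nat.cast_zero]
      have : (2 : ℝ) ^ ((0 : ℝ) - 1) ≤ 1 := Real.rpow_le_one_of_one_le_of_nonpos one_le_two (by norm_num)
      linarith
    · have h3 : (2 : ℝ) ^ (i - 1) ≤ 2 ^ j * ‖x - z‖ := not_lt.1 (Nat.find_min hex (by omega))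
      have h4 : (2 : ℝ) ^ ((i : ℝ) - 1) = 2 ^ (i - 1) := by
        rw [← Real.rpow_natCast, Nat.cast_sub h0, Nat.cast_one]
      rw [h4]
      linarith
  have h3 : dyBr j x z ^ (-m) ≤ 2 ^ m * 2 ^ (-((i : ℝ) * m)) := by
    have h4 : (2 : ℝ≥0∞) ^ ((i : ℝ) - 1) ≤ dyBr j x z := by
      rw [← ofReal_two_rpow]
      exact ENNReal.ofReal_le_ofReal h2
    refine (rpow_neg_le_rpow_neg h4 hm).trans (le_of_eq ?_)
    rw [← ENNReal.rpow_mul, ← two_rpow_add]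
    ring_nf
  have hmem : nearInd (dyRad j i) x z = 1 := by
    rw [nearInd, Set.indicator_of_mem, Pi.one_apply]
    rw [Metric.mem_ball, dist_comm, dist_eq_norm, dyRad, inv_pow, ← div_eq_mul_inv,
      lt_div_iff₀ (by positivity), mul_comm]
    exact h1
  refine le_trans ?_ (ENNReal.le_tsum i)
  rw [hmem, mul_one, inv_ofReal_dyRad_pow]
  calc _ ≤ (2 : ℝ≥0∞) ^ ((j : ℝ) * n) * (2 ^ m * 2 ^ (-((i : ℝ) * m))) := mul_le_mul' le_rfl h3
    _ = _ := by
      have : (2 : ℝ≥0∞) ^ (-((i : ℝ) * m)) =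
          2 ^ (-((i : ℝ) * (m - n))) * 2 ^ (-((i : ℝ) * n)) := by
        rw [← two_rpow_add]
        ring_nf
      rw [this]
      ring

lemma lintegral_dyBr_rpow_neg_mul_le {m : ℝ} (hm : 0 ≤ m) (j : ℕ) (x : Rn n) {F : Rn n → ℝ≥0∞}
    (hF : Measurable F) :
    ∫⁻ z, (2 : ℝ≥0∞) ^ ((j : ℝ) * n) * dyBr j x z ^ (-m) * F z ≤
      2 ^ m * ∑' i : ℕ, 2 ^ (-((i : ℝ) * (m - n))) * ballAvg (dyRad j i) F x := by
  have hnm : ∀ i, Measurable (nearInd (dyRad j i) x) :=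
    fun i => measurable_one.indicator measurableSet_ball
  calc _ ≤ ∫⁻ z, ∑' i : ℕ, (2 ^ m * 2 ^ (-((i : ℝ) * (m - n))) *
        ((ENNReal.ofReal (dyRad j i))⁻¹ ^ n)) * (nearInd (dyRad j i) x z * F z) := by
        refine lintegral_mono fun z => ?_
        dsimp only
        refine (mul_le_mul' (two_rpow_mul_dyBr_rpow_neg_le hm j x z) le_rfl).trans (le_of_eq ?_)
        rw [← ENNReal.tsum_mul_right]
        refine tsum_congr fun i => ?_
        ring
    _ = _ := by
        rw [lintegral_tsum fun i => (((hnm i).fun_mul hF).const_mul _).aemeasurable,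
          ← ENNReal.tsum_mul_left]
        refine tsum_congr fun i => ?_
        rw [lintegral_const_mul _ ((hnm i).fun_mul hF), ballAvg_eq]
        simp only [mul_assoc]

section

variable {P U : Rn n → ℝ} {b d θinf dU c' : ℝ}

lemma lqSum_levelSum_le {q m : ℝ} (hq : 1 ≤ q) (hm : 0 ≤ m) {g : ℕ → Rn n → ℝ≥0∞}
    (hg : ∀ j, Measurable (g j)) (x : Rn n) :
    lqSum q (fun j => levelSum g 1 m j x) ≤ 2 ^ m * ∑' K : ℕ, 2 ^ (-((K : ℝ) * 1)) *
      ∑' i : ℕ, 2 ^ (-((i : ℝ) * (m - n))) *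
        lqSum q (fun j => ballAvg (dyRad j i) (g (j + K)) x) := by
  have hq0 : 0 < q := by linarith
  have h1 : ∀ j, levelSum g 1 m j x ≤ 2 ^ m * ∑' K : ℕ, 2 ^ (-((K : ℝ) * 1)) *
      ∑' i : ℕ, 2 ^ (-((i : ℝ) * (m - n))) * ballAvg (dyRad j i) (g (j + K)) x := by
    intro j
    rw [levelSum, ← ENNReal.tsum_mul_left]
    refine ENNReal.tsum_le_tsum fun K => ?_
    rw [mul_left_comm]
    exact mul_le_mul' le_rfl (lintegral_dyBr_rpow_neg_mul_le hm j x (hg (j + K)))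
  refine (lqSum_mono hq0.le h1).trans ?_
  rw [lqSum_const_mul hq0]
  refine mul_le_mul' le_rfl ((lqSum_tsum_le hq _).trans (ENNReal.tsum_le_tsum fun K => ?_))
  rw [lqSum_const_mul hq0]
  refine mul_le_mul' le_rfl ((lqSum_tsum_le hq _).trans (ENNReal.tsum_le_tsum fun i => ?_))
  rw [lqSum_const_mul hq0]

lemma two_rpow_mul_sum_ballAvg_le (hc0 : 0 ≤ c') {ε : ℝ} (hε : 0 ≤ ε) (i : ℕ) (G : Rn n → ℝ≥0∞)
    (x : Rn n) :
    (2 : ℝ≥0∞) ^ (-((i : ℝ) * (c' + 2 * ε))) *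
      ∑ j ∈ Finset.range i, ballAvg (dyRad j i) G x ≤
    2 ^ (-((i : ℝ) * ε)) * ∑' l : ℕ, 2 ^ (-((l : ℝ) * ε)) *
      (ENNReal.ofReal (2 ^ l) ^ (-c') * ballAvg (2 ^ l) G x) := by
  rw [← Finset.sum_range_reflect, Finset.mul_sum]
  calc _ ≤ ∑ k ∈ Finset.range i, (2 : ℝ≥0∞) ^ (-((i : ℝ) * ε)) *
        (2 ^ (-(((k + 1 : ℕ) : ℝ) * ε)) *
          (ENNReal.ofReal (2 ^ (k + 1)) ^ (-c') * ballAvg (2 ^ (k + 1)) G x)) := by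
        refine Finset.sum_le_sum fun k hk => ?_
        rw [Finset.mem_range] at hk
        have e1 : dyRad (i - 1 - k) i = 2 ^ (k + 1) := by
          have : i = (i - 1 - k) + (k + 1) := by omega
          conv_lhs => rw [this]
          rw [show (i - 1 - k + (k + 1) - 1 - k) = i - 1 - k by omega, dyRad_add_right]
        have hk' : ((k + 1 : ℕ) : ℝ) ≤ i := by exact_mod_cast hk
        have e2 : ENNReal.ofReal (2 ^ (k + 1)) ^ (-c') = 2 ^ (-(((k + 1 : ℕ) : ℝ) * c')) := by
          rw [ofReal_two_pow, ← ENNReal.rpow_natCast, ← ENNReal.rpow_mul]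
          ring_nf
        rw [e1, e2, ← mul_assoc, ← mul_assoc]
        refine mul_le_mul' ?_ le_rfl
        rw [← two_rpow_add, ← two_rpow_add]
        refine two_rpow_mono ?_
        nlinarith [mul_le_mul_of_nonneg_right hk' hc0, mul_le_mul_of_nonneg_right hk' hε]
    _ ≤ _ := by
        rw [← Finset.mul_sum]
        refine mul_le_mul' le_rfl ?_
        refine le_trans (ENNReal.sum_le_tsum (f := fun k : ℕ => 2 ^ (-(((k + 1 : ℕ) : ℝ) * ε)) *
          (ENNReal.ofReal (2 ^ (k + 1)) ^ (-c') * ballAvg (2 ^ (k + 1)) G x)) _) ?_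
        exact ENNReal.tsum_comp_le_tsum_of_injective (add_left_injective 1) fun l : ℕ =>
          2 ^ (-((l : ℝ) * ε)) * (ENNReal.ofReal (2 ^ l) ^ (-c') * ballAvg (2 ^ l) G x)

theorem exists_morreyModLe_levelSum (hn : 0 < n) (hP : LHExponentAt P b d θinf)
    {Q : Rn n → ℝ} {bQ dQ tQ m : ℝ} (hQ : LHExponent Q bQ dQ tQ) (hU : ∀ x, P x ≤ U x)
    (hUd : ∀ x, U x ≤ dU) (hc0 : 0 ≤ c') (hc : ∀ x, morreyExp P U x - n * θinf ≤ c')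
    (hm : n + c' < m) :
    ∃ C : ℝ≥0∞, C ≠ ∞ ∧ ∀ (g : ℕ → Rn n → ℝ≥0∞) (G : Rn n → ℝ≥0∞), (∀ μ, Measurable (g μ)) →
      Measurable G → (∀ x, lqSum (Q x) (fun μ => g μ x) ≤ G x) →
      MorreyModLe P (morreyExp P U) 1 G →
      MorreyModLe P (morreyExp P U) C (fun x => lqSum (Q x) (fun j => levelSum g 1 m j x)) := by
  obtain ⟨CB, hCB, hB⟩ := exists_morreyModLe_lqSum_ballAvg hn hP hQ hU hUd
  obtain ⟨CC, hCC, hCt⟩ := exists_morreyModLe_ballAvg hP hU hc0 hc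
  have hd0 : 0 ≤ d := (zero_lt_one.trans hP.one_le_hi).le
  have hP0 : ∀ x, 0 ≤ P x := fun x => (hP.pos x).le
  have hP1 : ∀ x, 1 ≤ P x := fun x => (hP.gt_one x).le
  set ε : ℝ := (m - n - c') / 2 with hε
  have hε0 : 0 < ε := by rw [hε]; linarith
  have hδ : m - n = c' + 2 * ε := by rw [hε]; ring
  have hm0 : 0 ≤ m := by
    have : (0 : ℝ) ≤ n := Nat.cast_nonneg n
    linarith
  have hS1 := tsum_two_rpow_ne_top one_pos
  have hSε := tsum_two_rpow_ne_top hε0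
  set S1 : ℝ≥0∞ := ∑' i : ℕ, (2 : ℝ≥0∞) ^ (-((i : ℝ) * 1)) with hS1def
  set Sε : ℝ≥0∞ := ∑' i : ℕ, (2 : ℝ≥0∞) ^ (-((i : ℝ) * ε)) with hSεdef
  have hfin : ∀ a : ℝ≥0∞, a ≠ ∞ → (1 + a) ^ d ≠ ∞ := fun a ha =>
    ENNReal.rpow_ne_top_of_nonneg hd0 (ENNReal.add_ne_top.2 ⟨ENNReal.one_ne_top, ha⟩)
  refine ⟨(1 + 2 ^ m) ^ d * ((1 + S1) ^ d * ((1 + Sε) ^ d *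
    (2 ^ d * (CB + (1 + Sε) ^ d * CC)))), ?_, ?_⟩
  · exact ENNReal.mul_ne_top (hfin _ (two_rpow_ne_top _)) (ENNReal.mul_ne_top (hfin _ hS1)
      (ENNReal.mul_ne_top (hfin _ hSε) (ENNReal.mul_ne_top (two_rpow_ne_top _)
        (ENNReal.add_ne_top.2 ⟨hCB, ENNReal.mul_ne_top (hfin _ hSε) hCC⟩))))
  intro g G hg hG hgG hM
  set κ := morreyExp P U with hκ
  set Y : ℕ → Rn n → ℝ≥0∞ := fun l x => ENNReal.ofReal (2 ^ l) ^ (-c') * ballAvg (2 ^ l) G x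
    with hY
  have hYm : ∀ l, Measurable (Y l) := fun l => (measurable_ballAvg _ hG).const_mul _
  set Z : Rn n → ℝ≥0∞ := fun x => ∑' l : ℕ, 2 ^ (-((l : ℝ) * ε)) * Y l x with hZ
  have hZm : Measurable Z := Measurable.tsum fun l => (hYm l).const_mul _
  have hZM : MorreyModLe P κ ((1 + Sε) ^ d * CC) Z :=
    MorreyModLe.tsum hP.measurable hP1 hP.le _ hYm fun l =>
      hCt G hG hM (2 ^ l) (one_le_pow₀ one_le_two)
  set N : ℕ → ℕ → Rn n → ℝ≥0∞ := fun K i x =>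
    lqSum (Q x) (fun μ => ballAvg ((2 : ℝ)⁻¹ ^ μ) (g (μ + (i + K))) x) with hN
  have hNm : ∀ K i, Measurable (N K i) := fun K i =>
    measurable_lqSum hQ.measurable fun μ => measurable_ballAvg _ (hg _)
  have hNM : ∀ K i, MorreyModLe P κ CB (N K i) := fun K i =>
    hB (fun μ => g (μ + (i + K))) G (fun μ => hg _) hG
      (fun x => (lqSum_shift_le (hQ.pos x) (fun μ => g μ x) (i + K)).trans (hgG x)) hM
  have hNZm : ∀ K i, Measurable fun x => N K i x + Z x := fun K i => (hNm K i).fun_add hZm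
  have hIm : ∀ K, Measurable fun x => ∑' i : ℕ, 2 ^ (-((i : ℝ) * ε)) * (N K i x + Z x) :=
    fun K => Measurable.tsum fun i => (hNZm K i).const_mul _
  have hmain := MorreyModLe.const_mul hP0 hP.le (two_rpow_ne_top m)
    (MorreyModLe.tsum hP.measurable hP1 hP.le (fun K : ℕ => (2 : ℝ≥0∞) ^ (-((K : ℝ) * 1))) hIm
      fun K => MorreyModLe.tsum hP.measurable hP1 hP.le
        (fun i : ℕ => (2 : ℝ≥0∞) ^ (-((i : ℝ) * ε))) (hNZm K) fun i =>
        MorreyModLe.add hP.measurable hP0 hP.le (hNm K i) (hNM K i) hZm hZM)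
  refine hmain.mono hP0 (fun x => ?_) le_rfl
  have hQ1 : 1 ≤ Q x := (hQ.gt_one x).le
  refine (lqSum_levelSum_le hQ1 hm0 hg x).trans (mul_le_mul' le_rfl (ENNReal.tsum_le_tsum fun K =>
    mul_le_mul' le_rfl (ENNReal.tsum_le_tsum fun i => ?_)))
  have hsplit := lqSum_le_sum_add_shift hQ1 (fun j => ballAvg (dyRad j i) (g (j + K)) x) i
  have hNe : lqSum (Q x) (fun μ => ballAvg (dyRad (μ + i) i) (g (μ + i + K)) x) = N K i x := by
    simp only [hN, dyRad_add_left, add_assoc]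
  rw [hNe] at hsplit
  have hsum : ∑ j ∈ Finset.range i, ballAvg (dyRad j i) (g (j + K)) x ≤
      ∑ j ∈ Finset.range i, ballAvg (dyRad j i) G x :=
    Finset.sum_le_sum fun j _ => ballAvg_mono fun z _ =>
      (le_lqSum (hQ.pos z) (fun μ => g μ z) (j + K)).trans (hgG z)
  have hw : (2 : ℝ≥0∞) ^ (-((i : ℝ) * (c' + 2 * ε))) ≤ 2 ^ (-((i : ℝ) * ε)) := by
    refine two_rpow_mono ?_
    have : (0 : ℝ) ≤ i := Nat.cast_nonneg i
    nlinarith [mul_nonneg this hc0, mul_nonneg this hε0.le]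
  rw [hδ]
  calc _ ≤ (2 : ℝ≥0∞) ^ (-((i : ℝ) * (c' + 2 * ε))) *
        ((∑ j ∈ Finset.range i, ballAvg (dyRad j i) G x) + N K i x) :=
        mul_le_mul' le_rfl (hsplit.trans (add_le_add hsum le_rfl))
    _ ≤ 2 ^ (-((i : ℝ) * ε)) * Z x + 2 ^ (-((i : ℝ) * ε)) * N K i x := by
        rw [mul_add]
        exact add_le_add (two_rpow_mul_sum_ballAvg_le hc0 hε0.le i G x) (mul_le_mul' hw le_rfl)
    _ = _ := by ring

end

lemma lqNorm_rpow_eq {q : ℝ≥0∞} (hq0 : q ≠ 0) (hqt : q ≠ ∞) {r : ℝ} (hr : 0 < r) (a : ℕ → ℝ≥0∞) :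
    lqNorm q a ^ r = lqSum (q.toReal / r) (fun j => a j ^ r) := by
  have hq := ENNReal.toReal_pos hq0 hqt
  rw [lqNorm, if_neg hqt, lqSum, ← ENNReal.rpow_mul]
  simp only [← ENNReal.rpow_mul]
  rw [mul_div_cancel₀ _ hr.ne', inv_div, one_div, inv_mul_eq_div]

lemma modularVE_eq {p : Rn n → ℝ≥0∞} (hp : ∀ x, p x ≠ ∞) (g : Rn n → ℝ≥0∞) :
    modularVE p g = ∫⁻ x, g x ^ (p x).toReal := by
  simp only [modularVE, phiVE, if_neg (hp _)]

section

variable {p u : Rn n → ℝ≥0∞} {r : ℝ}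

lemma ofReal_rpow_morreyExp_rpow (x : Rn n) {ρ : ℝ} (hρ : 0 < ρ) :
    ENNReal.ofReal ρ ^ (-morreyExp (fun x => (p x).toReal / r) (fun x => (u x).toReal / r) x) =
      ENNReal.ofReal (ρ ^ ((n : ℝ) * ((u x)⁻¹.toReal - (p x)⁻¹.toReal))) ^ r := by
  rw [← ENNReal.ofReal_rpow_of_pos hρ, ← ENNReal.rpow_mul, morreyExp, inv_div, inv_div,
    ENNReal.toReal_inv, ENNReal.toReal_inv]
  congr 1
  ring

lemma ofReal_real_rpow_ne_zero {ρ : ℝ} (hρ : 0 < ρ) (s : ℝ) : ENNReal.ofReal (ρ ^ s) ≠ 0 := by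
  simpa using Real.rpow_pos_of_pos hρ s

lemma morreyModLe_of_morreyNorm_lt (hpt : ∀ x, p x ≠ ∞) (hr : 0 < r)
    {F : Rn n → ℝ≥0∞} {Λ : ℝ≥0∞} (h : morreyNorm p u F < Λ) :
    MorreyModLe (fun x => (p x).toReal / r)
      (morreyExp (fun x => (p x).toReal / r) (fun x => (u x).toReal / r)) 1
      (fun x => (F x / Λ) ^ r) := by
  intro x ρ hρ
  simp only [ofReal_rpow_morreyExp_rpow x hρ]
  set t := ENNReal.ofReal (ρ ^ ((n : ℝ) * ((u x)⁻¹.toReal - (p x)⁻¹.toReal))) with ht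
  have ht0 : t ≠ 0 := ofReal_real_rpow_ne_zero hρ _
  have htt : t ≠ ∞ := ENNReal.ofReal_ne_top
  have h1 : t * vLpNorm p ((Metric.ball x ρ).indicator F) < Λ :=
    lt_of_le_of_lt (le_iSup_of_le x (le_iSup_of_le ρ (le_iSup (fun _ : 0 < ρ =>
      t * vLpNorm p ((Metric.ball x ρ).indicator F)) hρ))) h
  have h2 : vLpNorm p ((Metric.ball x ρ).indicator F) < Λ / t := by
    rw [ENNReal.lt_div_iff_mul_lt (Or.inl ht0) (Or.inl htt), mul_comm]
    exact h1
  obtain ⟨lam, hlam, hlt⟩ := sInf_lt_iff.1 h2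
  refine le_trans ?_ hlam
  rw [modularVE_eq hpt, ← lintegral_indicator measurableSet_ball]
  refine lintegral_mono fun z => ?_
  dsimp only
  by_cases hz : z ∈ Metric.ball x ρ
  · rw [Set.indicator_of_mem hz, Set.indicator_of_mem hz,
      ← ENNReal.mul_rpow_of_nonneg _ _ hr.le, ← ENNReal.rpow_mul, mul_div_cancel₀ _ hr.ne']
    refine ENNReal.rpow_le_rpow ?_ ENNReal.toReal_nonneg
    calc t * (F z / Λ) = F z / (Λ / t) := by
          rw [div_eq_mul_inv, div_eq_mul_inv, ENNReal.inv_div (Or.inl htt) (Or.inl ht0),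
            div_eq_mul_inv]
          ring
      _ ≤ F z / lam := ENNReal.div_le_div_left hlt.le _
  · rw [Set.indicator_of_notMem hz]
    exact zero_le

lemma morreyNorm_le_of_morreyModLe (hp0 : ∀ x, p x ≠ 0) (hpt : ∀ x, p x ≠ ∞) (hr : 0 < r)
    (hP1 : ∀ x, 1 ≤ (p x).toReal / r) {F : Rn n → ℝ≥0∞} {Λ C : ℝ≥0∞}
    (hC : C ≠ ∞) (h : MorreyModLe (fun x => (p x).toReal / r)
      (morreyExp (fun x => (p x).toReal / r) (fun x => (u x).toReal / r)) C
      (fun x => (F x / Λ) ^ r)) :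
    morreyNorm p u F ≤ (1 + C) ^ r⁻¹ * Λ := by
  refine iSup_le fun x => iSup_le fun ρ => iSup_le fun hρ => ?_
  have h0 := h x ρ hρ
  simp only [ofReal_rpow_morreyExp_rpow x hρ] at h0
  set t := ENNReal.ofReal (ρ ^ ((n : ℝ) * ((u x)⁻¹.toReal - (p x)⁻¹.toReal))) with ht
  have ht0 : t ≠ 0 := ofReal_real_rpow_ne_zero hρ _
  have htt : t ≠ ∞ := ENNReal.ofReal_ne_top
  have hC1 : 1 ≤ 1 + C := le_self_add
  have hC1t : 1 + C ≠ ∞ := ENNReal.add_ne_top.2 ⟨ENNReal.one_ne_top, hC⟩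
  have hC10 : 1 + C ≠ 0 := (zero_lt_one.trans_le hC1).ne'
  set K := (1 + C) ^ r⁻¹ with hK
  have hK0 : K ≠ 0 := (ENNReal.rpow_pos (zero_lt_one.trans_le hC1) hC1t).ne'
  have hKt : K ≠ ∞ := ENNReal.rpow_ne_top_of_nonneg (inv_nonneg.2 hr.le) hC1t
  have hKr : K ^ r = 1 + C := by
    rw [hK, ← ENNReal.rpow_mul, inv_mul_cancel₀ hr.ne', ENNReal.rpow_one]
  suffices hmem : vLpNorm p ((Metric.ball x ρ).indicator F) ≤ K * Λ / t from
    (mul_le_mul' le_rfl hmem).trans ENNReal.mul_div_le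
  refine sInf_le ?_
  change modularVE p _ ≤ 1
  rw [modularVE_eq hpt]
  calc _ ≤ ∫⁻ z in Metric.ball x ρ, (1 + C)⁻¹ * (t ^ r * (F z / Λ) ^ r) ^ ((p z).toReal / r) := by
        rw [← lintegral_indicator measurableSet_ball]
        refine lintegral_mono fun z => ?_
        dsimp only
        by_cases hz : z ∈ Metric.ball x ρ
        · rw [Set.indicator_of_mem hz, Set.indicator_of_mem hz]
          have e1 : F z / (K * Λ / t) = K⁻¹ * (t * (F z / Λ)) := by
            rw [div_eq_mul_inv, ENNReal.inv_div (Or.inl htt) (Or.inl ht0), div_eq_mul_inv,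
              ENNReal.mul_inv (Or.inl hK0) (Or.inl hKt), div_eq_mul_inv]
            ring
          have e2 : (p z).toReal = r * ((p z).toReal / r) := (mul_div_cancel₀ _ hr.ne').symm
          rw [e1]
          conv_lhs => rw [e2]
          rw [ENNReal.rpow_mul, ENNReal.mul_rpow_of_nonneg _ _ hr.le,
            ENNReal.mul_rpow_of_nonneg _ _ hr.le, ENNReal.inv_rpow, hKr,
            ENNReal.mul_rpow_of_nonneg _ _ (zero_le_one.trans (hP1 z))]
          refine mul_le_mul' ?_ le_rfl
          calc (1 + C)⁻¹ ^ ((p z).toReal / r) ≤ (1 + C)⁻¹ ^ (1 : ℝ) :=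
                ENNReal.rpow_le_rpow_of_exponent_ge (ENNReal.inv_le_one.2 hC1) (hP1 z)
            _ = _ := ENNReal.rpow_one _
        · rw [Set.indicator_of_notMem hz, ENNReal.zero_div,
            ENNReal.zero_rpow_of_pos (ENNReal.toReal_pos (hp0 z) (hpt z))]
          exact zero_le
    _ = (1 + C)⁻¹ * ∫⁻ z in Metric.ball x ρ, (t ^ r * (F z / Λ) ^ r) ^ ((p z).toReal / r) :=
        lintegral_const_mul' _ _ (ENNReal.inv_ne_top.2 hC10)
    _ ≤ (1 + C)⁻¹ * (1 + C) := mul_le_mul' le_rfl (h0.trans le_add_self)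
    _ = 1 := ENNReal.inv_mul_cancel hC10 hC1t

end

lemma levelSum_const_mul {c : ℝ≥0∞} (hc : c ≠ ∞) (F : ℕ → Rn n → ℝ≥0∞) (s t : ℝ) (j : ℕ) (x : Rn n) :
    levelSum (fun l z => c * F l z) s t j x = c * levelSum F s t j x := by
  rw [levelSum, levelSum, ← ENNReal.tsum_mul_left]
  refine tsum_congr fun K => ?_
  rw [mul_left_comm, ← lintegral_const_mul' _ _ hc]
  simp only [mul_left_comm]

lemma continuous_of_locLogHolder {g : Rn n → ℝ} (h : LocLogHolder g) : Continuous g := by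
  obtain ⟨c, hc, h⟩ := h
  rw [Metric.continuous_iff]
  intro x ε hε
  refine ⟨Real.exp (-(c / ε)), Real.exp_pos _, fun y hy => ?_⟩
  rcases eq_or_ne y x with rfl | hne
  · rwa [dist_self]
  · rw [Real.dist_eq]
    refine (h y x).trans_lt ?_
    have hd : 0 < dist y x := dist_pos.2 hne
    have h1 : Real.exp (c / ε) < (dist y x)⁻¹ := by
      rw [lt_inv_comm₀ (Real.exp_pos _) hd, ← Real.exp_neg]
      exact hy
    have h2 : c / ε < Real.log (Real.exp 1 + (dist y x)⁻¹) := by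
      rw [Real.lt_log_iff_exp_lt (by positivity)]
      linarith [Real.exp_pos 1]
    rw [div_lt_iff₀ ((div_pos hc hε).trans h2)]
    rwa [div_lt_iff₀' hε] at h2

lemma forall_mem_Icc_of_ae {g : Rn n → ℝ} (hg : Continuous g) {a b : ℝ}
    (h : ∀ᵐ x : Rn n, g x ∈ Set.Icc a b) (x : Rn n) : g x ∈ Set.Icc a b := by
  have h1 : IsClosed (g ⁻¹' Set.Icc a b) := isClosed_Icc.preimage hg
  have h2 : Dense (g ⁻¹' Set.Icc a b) := Measure.dense_of_ae h
  have h3 := h2.closure_eq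
  rw [h1.closure_eq] at h3
  exact (Set.eq_univ_iff_forall.1 h3) x

lemma isLH_of_locLogHolder {g : Rn n → ℝ} {ginf c : ℝ} (h : LocLogHolder g)
    (hd : LogDecay g ginf c) : IsLH g ginf := by
  obtain ⟨c1, hc1, h⟩ := h
  refine ⟨max c1 c, hc1.le.trans (le_max_left _ _), fun x y => ?_, fun x => ?_⟩
  · have hl := one_le_log_exp_one_add (inv_nonneg.2 (dist_nonneg (x := x) (y := y)))
    refine le_trans ?_ (le_max_left _ _)
    exact (le_div_iff₀ (zero_lt_one.trans_le hl)).1 (h x y)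
  · refine le_trans ?_ (le_max_right _ _)
    exact (le_div_iff₀ (zero_lt_one.trans_le (one_le_logWt x))).1 (hd x)

lemma logDecay_mem_Icc (hn : 0 < n) {g : Rn n → ℝ} {ginf c a b : ℝ} (hd : LogDecay g ginf c)
    (h : ∀ x, g x ∈ Set.Icc a b) : ginf ∈ Set.Icc a b := by
  have : Nonempty (Fin n) := ⟨⟨0, hn⟩⟩
  have hc0 : 0 ≤ c := by
    have := (abs_nonneg _).trans (hd 0)
    rwa [norm_zero, add_zero, Real.log_exp, div_one] at this
  have key : ∀ ε > 0, ∃ x, |g x - ginf| < ε := by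
    intro ε hε
    obtain ⟨x, hx⟩ := NormedSpace.exists_lt_norm ℝ (Rn n) (Real.exp (c / ε))
    refine ⟨x, (hd x).trans_lt ?_⟩
    have h2 : c / ε < Real.log (Real.exp 1 + ‖x‖) := by
      rw [Real.lt_log_iff_exp_lt (by positivity)]
      linarith [Real.exp_pos 1]
    rw [div_lt_iff₀ ((div_nonneg hc0 hε.le).trans_lt h2)]
    rwa [div_lt_iff₀' hε] at h2
  constructor
  · by_contra! hlt
    obtain ⟨x, hx⟩ := key (a - ginf) (by linarith)
    have := (abs_lt.1 hx).2
    linarith [(h x).1]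
  · by_contra! hlt
    obtain ⟨x, hx⟩ := key (ginf - b) (by linarith)
    have := (abs_lt.1 hx).1
    linarith [(h x).2]

lemma exponent_bounds {p : Rn n → ℝ≥0∞} (hp : LocLogHolder fun x => (p x)⁻¹.toReal)
    {m M : ℝ≥0∞} (hm0 : m ≠ 0) (hM : M ≠ ∞) (h : ∀ᵐ x : Rn n, m ≤ p x ∧ p x ≤ M) (x : Rn n) :
    p x ≠ 0 ∧ p x ≠ ∞ ∧ m.toReal ≤ (p x).toReal ∧ (p x).toReal ≤ M.toReal := by
  obtain ⟨x0, h0, h0'⟩ := h.exists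
  have hmM : m ≤ M := h0.trans h0'
  have hmt : m ≠ ∞ := ne_top_of_le_ne_top hM hmM
  have hM0 : M ≠ 0 := ((pos_iff_ne_zero.2 hm0).trans_le hmM).ne'
  have hmp := ENNReal.toReal_pos hm0 hmt
  have hMp := ENNReal.toReal_pos hM0 hM
  have key : (p x)⁻¹.toReal ∈ Set.Icc M.toReal⁻¹ m.toReal⁻¹ := by
    refine forall_mem_Icc_of_ae (g := fun x => (p x)⁻¹.toReal) (continuous_of_locLogHolder hp) ?_ x
    filter_upwards [h] with y hy
    rw [← ENNReal.toReal_inv, ← ENNReal.toReal_inv]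
    exact ⟨ENNReal.toReal_mono (ENNReal.inv_ne_top.2 ((pos_iff_ne_zero.2 hm0).trans_le hy.1).ne')
        (ENNReal.inv_le_inv.2 hy.2),
      ENNReal.toReal_mono (ENNReal.inv_ne_top.2 hm0) (ENNReal.inv_le_inv.2 hy.1)⟩
  rw [ENNReal.toReal_inv] at key
  have hpos : 0 < (p x).toReal := inv_pos.1 ((inv_pos.2 hMp).trans_le key.1)
  obtain ⟨h1, h2⟩ := ENNReal.toReal_pos_iff.1 hpos
  exact ⟨h1.ne', h2.ne, (inv_le_inv₀ hpos hmp).1 key.2, (inv_le_inv₀ hMp hpos).1 key.1⟩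

lemma lhExponentAt_toReal_div (hn : 0 < n) {p : Rn n → ℝ≥0∞} {pinvInf : ℝ}
    (hp : IsPLogWith p pinvInf) {s M r : ℝ} (hr : 0 < r) (hrs : r < s)
    (h : ∀ x, s ≤ (p x).toReal ∧ (p x).toReal ≤ M) :
    LHExponentAt (fun x => (p x).toReal / r) (s / r) (M / r) (r * pinvInf) := by
  obtain ⟨⟨hpm, -, -⟩, hloc, c, -, hdec⟩ := hp
  have hs : 0 < s := hr.trans hrs
  have hmem : pinvInf ∈ Set.Icc M⁻¹ s⁻¹ := by
    refine logDecay_mem_Icc hn hdec fun x => ?_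
    obtain ⟨h1, h2⟩ := h x
    rw [ENNReal.toReal_inv]
    exact ⟨inv_anti₀ (hs.trans_le h1) h2, inv_anti₀ hs h1⟩
  refine ⟨⟨hpm.ennreal_toReal.div_const r, (one_lt_div hr).2 hrs,
    fun x => div_le_div_of_nonneg_right (h x).1 hr.le,
    fun x => div_le_div_of_nonneg_right (h x).2 hr.le, ?_⟩, ?_, ?_⟩
  · have := (isLH_of_locLogHolder hloc hdec).affine 0 r
    simp only [zero_add] at this
    convert this using 2 with x
    rw [inv_div, ENNReal.toReal_inv, div_eq_mul_inv]
  · rw [inv_div, div_eq_mul_inv]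
    exact mul_le_mul_of_nonneg_left hmem.1 hr.le
  · rw [inv_div, div_eq_mul_inv]
    exact mul_le_mul_of_nonneg_left hmem.2 hr.le

lemma exists_rpow_exponent {ν s c A : ℝ} (hν : 0 < ν) (hs : 0 < s) (hA : ν * (1 / s + c) < A) :
    ∃ r, 0 < r ∧ r < s ∧ ν + ν * r * c < A * r := by
  have h1 : 1 / s < A / ν - c := by
    rw [lt_sub_iff_add_lt, lt_div_iff₀ hν]
    linarith
  obtain ⟨t, ht1, ht2⟩ := exists_between h1
  have ht0 : 0 < t := (one_div_pos.2 hs).trans ht1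
  refine ⟨t⁻¹, inv_pos.2 ht0, ?_, ?_⟩
  · rw [one_div] at ht1
    exact (inv_lt_comm₀ hs ht0).1 ht1
  · rw [lt_sub_iff_add_lt, lt_div_iff₀ hν] at ht2
    rw [← sub_pos]
    have e : A * t⁻¹ - (ν + ν * t⁻¹ * c) = (A - (t + c) * ν) * t⁻¹ := by
      field_simp
    rw [e]
    exact mul_pos (sub_pos.2 ht2) (inv_pos.2 ht0)

lemma morreyExp_toReal_div_sub_le (hn : 0 < n) {p u : Rn n → ℝ≥0∞} {s r : ℝ} (hs : 0 < s)
    (hp : ∀ x, s ≤ (p x).toReal) (hr : 0 < r) (pinvInf : ℝ) (x : Rn n) :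
    morreyExp (fun x => (p x).toReal / r) (fun x => (u x).toReal / r) x - n * (r * pinvInf) ≤
      n * r * cpu p u pinvInf := by
  have hb : BddAbove (Set.range fun x : Rn n => (p x)⁻¹.toReal - (u x)⁻¹.toReal) := by
    refine ⟨s⁻¹, ?_⟩
    rintro _ ⟨y, rfl⟩
    have : (p y)⁻¹.toReal ≤ s⁻¹ := by
      rw [ENNReal.toReal_inv]
      exact inv_anti₀ hs (hp y)
    have := ENNReal.toReal_nonneg (a := (u y)⁻¹)
    dsimp only
    linarith
  have h1 := le_ciSup hb x
  have h2 : (p x)⁻¹.toReal - (u x)⁻¹.toReal - pinvInf ≤ cpu p u pinvInf :=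
    (sub_le_sub_right h1 _).trans (le_max_right _ _)
  rw [morreyExp, inv_div, inv_div, div_eq_mul_inv, div_eq_mul_inv, ← ENNReal.toReal_inv,
    ← ENNReal.toReal_inv]
  have hnr : (0 : ℝ) ≤ n * r := by positivity
  calc _ = n * r * ((p x)⁻¹.toReal - (u x)⁻¹.toReal - pinvInf) := by ring
    _ ≤ _ := mul_le_mul_of_nonneg_left h2 hnr

lemma le_mul_of_forall_gt_imp_le_mul {A B K : ℝ≥0∞} (hK0 : K ≠ 0) (hK : K ≠ ∞)
    (h : ∀ L, B < L → L ≠ ∞ → A ≤ K * L) : A ≤ K * B := by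
  rcases eq_or_ne B ∞ with rfl | hB
  · rw [ENNReal.mul_top hK0]
    exact le_top
  rw [mul_comm, ← ENNReal.div_le_iff hK0 hK]
  refine le_of_forall_gt_imp_ge_of_dense fun L hL => ?_
  rcases eq_or_ne L ∞ with rfl | hLt
  · exact le_top
  rw [ENNReal.div_le_iff hK0 hK, mul_comm]
  exact h L hL hLt

/-- Pointwise control of the powers of a sequence by level sums passes to the Morrey norms. -/
theorem exists_morreySeqNorm_le (hn : 0 < n) {p q u : Rn n → ℝ≥0∞} {pinvInf qinvInf : ℝ}
    (hp : IsPLogWith p pinvInf) (hq : IsPLogWith q qinvInf)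
    (hpu : ∀ x, p x ≤ u x) {U : ℝ≥0∞} (huU : ∀ x, u x ≤ U) (hU : U ≠ ∞)
    {s M r m : ℝ} (hr : 0 < r) (hrs : r < s)
    (hps : ∀ x, s ≤ (p x).toReal) (hqs : ∀ x, s ≤ (q x).toReal ∧ (q x).toReal ≤ M)
    (hm : n + n * r * cpu p u pinvInf < m) {C0 : ℝ≥0∞} (hC0 : C0 ≠ ∞) :
    ∃ K : ℝ≥0∞, K ≠ 0 ∧ K ≠ ∞ ∧ ∀ h H : ℕ → Rn n → ℝ≥0∞, (∀ j, Measurable (h j)) →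
      (∀ j x, H j x ^ r ≤ C0 * levelSum (fun l z => h l z ^ r) 1 m j x) →
      morreySeqNorm p u q H ≤ K * morreySeqNorm p u q h := by
  have hs : 0 < s := hr.trans hrs
  have hne : ∀ {e : ℝ≥0∞}, s ≤ e.toReal → e ≠ 0 ∧ e ≠ ∞ := fun he =>
    ⟨(ENNReal.toReal_pos_iff.1 (hs.trans_le he)).1.ne', (ENNReal.toReal_pos_iff.1 (hs.trans_le he)).2.ne⟩
  have hut : ∀ x, u x ≠ ∞ := fun x => ne_top_of_le_ne_top hU (huU x)
  have hpu' : ∀ x, (p x).toReal ≤ (u x).toReal := fun x => ENNReal.toReal_mono (hut x) (hpu x)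
  have huU' : ∀ x, (u x).toReal ≤ U.toReal := fun x => ENNReal.toReal_mono hU (huU x)
  have hP := lhExponentAt_toReal_div hn hp hr hrs fun x => ⟨hps x, (hpu' x).trans (huU' x)⟩
  have hQ := (lhExponentAt_toReal_div hn hq hr hrs hqs).toLHExponent
  have hc0 : 0 ≤ n * r * cpu p u pinvInf :=
    mul_nonneg (by positivity) (le_max_left _ _)
  obtain ⟨C1, hC1, hmain⟩ := exists_morreyModLe_levelSum hn hP hQ
    (U := fun x => (u x).toReal / r) (dU := U.toReal / r)
    (fun x => div_le_div_of_nonneg_right (hpu' x) hr.le)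
    (fun x => div_le_div_of_nonneg_right (huU' x) hr.le) hc0
    (morreyExp_toReal_div_sub_le hn hs hps hr pinvInf) hm
  have hP0 : ∀ x, 0 ≤ (p x).toReal / r := fun x => (hP.pos x).le
  have hUr : 0 ≤ U.toReal / r := div_nonneg ENNReal.toReal_nonneg hr.le
  have h1C0 : 1 + C0 ≠ ∞ := ENNReal.add_ne_top.2 ⟨ENNReal.one_ne_top, hC0⟩
  have hC2 : (1 + C0) ^ (U.toReal / r) * C1 ≠ ∞ :=
    ENNReal.mul_ne_top (ENNReal.rpow_ne_top_of_nonneg hUr h1C0) hC1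
  set C2 := (1 + C0) ^ (U.toReal / r) * C1 with hC2d
  have h1C2 : 1 + C2 ≠ ∞ := ENNReal.add_ne_top.2 ⟨ENNReal.one_ne_top, hC2⟩
  have hK0 : (1 + C2) ^ r⁻¹ ≠ 0 := (ENNReal.rpow_pos (zero_lt_one.trans_le le_self_add) h1C2).ne'
  have hKt : (1 + C2) ^ r⁻¹ ≠ ∞ := ENNReal.rpow_ne_top_of_nonneg (inv_nonneg.2 hr.le) h1C2
  refine ⟨(1 + C2) ^ r⁻¹, hK0, hKt, fun h H hh hH => ?_⟩
  refine le_mul_of_forall_gt_imp_le_mul hK0 hKt fun L hL hLt => ?_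
  have hL0 : L ≠ 0 := (zero_le.trans_lt hL).ne'
  have hLr : L⁻¹ ^ r ≠ ∞ := ENNReal.rpow_ne_top_of_nonneg hr.le (ENNReal.inv_ne_top.2 hL0)
  have hdiv : ∀ (a : ℕ → Rn n → ℝ≥0∞) (x : Rn n), (lqNorm (q x) (fun j => a j x) / L) ^ r =
      lqSum ((q x).toReal / r) (fun j => L⁻¹ ^ r * a j x ^ r) := by
    intro a x
    obtain ⟨hq0, hqt⟩ := hne (hqs x).1
    rw [lqSum_const_mul (hQ.pos x), ← lqNorm_rpow_eq hq0 hqt hr, div_eq_mul_inv, mul_comm,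
      ENNReal.mul_rpow_of_nonneg _ _ hr.le]
  have hg : ∀ j, Measurable fun x => L⁻¹ ^ r * h j x ^ r := fun j =>
    ((hh j).pow_const r).const_mul _
  have hmod := morreyModLe_of_morreyNorm_lt (fun x => (hne (hps x)).2) hr hL
  have hGm : Measurable fun x => (lqNorm (q x) (fun j => h j x) / L) ^ r := by
    simp only [hdiv]
    exact measurable_lqSum hQ.measurable hg
  have hlev := hmain (fun j x => L⁻¹ ^ r * h j x ^ r) _ hg hGm (fun x => (hdiv h x).ge) hmod
  refine morreyNorm_le_of_morreyModLe (fun x => (hne (hps x)).1) (fun x => (hne (hps x)).2) hr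
    (fun x => (hP.gt_one x).le) hC2
    ((hlev.const_mul hP0 hP.le hC0).mono hP0 (fun x => ?_) le_rfl)
  rw [hdiv, ← lqSum_const_mul (hQ.pos x)]
  refine lqSum_mono (hQ.pos x).le fun j => ?_
  rw [levelSum_const_mul hLr, mul_left_comm]
  exact mul_le_mul' le_rfl (hH j x)

lemma peetreMax_eq_enorm_of_subsingleton [Subsingleton (Rn n)] {a : ℝ} (ha : 0 < a) (j : ℕ)
    (F : Rn n → ℂ) (x : Rn n) : peetreMax a j F x = (‖F x‖₊ : ℝ≥0∞) := by
  have : ∀ y : Rn n, (‖F y‖₊ : ℝ≥0∞) / ENNReal.ofReal (1 + ((2 : ℝ) ^ j * ‖y - x‖) ^ a) =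
      (‖F x‖₊ : ℝ≥0∞) := by
    intro y
    rw [Subsingleton.elim y x, sub_self, norm_zero, mul_zero, Real.zero_rpow ha.ne', add_zero,
      ENNReal.ofReal_one, div_one]
  rw [peetreMax, iSup_congr this, iSup_const]

/-- boundedness of the Peetre maximal operator: the Peetre maximal
quasi-norm is controlled by the convolution quasi-norm in the 2-microlocal variable
exponent Triebel–Lizorkin–Morrey scale. -/
theorem statement16 (n : ℕ) (al al1 al2 C : ℝ) (h12 : al1 ≤ al2) (hal : 0 ≤ al)
    (w : ℕ → Rn n → ℝ) (hw : AdmissibleWeights al al1 al2 C w)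
    (p q u : Rn n → ℝ≥0∞) (pinvInf : ℝ)
    (hp : IsPLogWith p pinvInf) (hq : IsPLog q) (hu : IsVarExp u)
    (hpu : ∀ x, p x ≤ u x) (husup : (⨆ x : Rn n, u x) < ∞)
    (hqp : essSup q (volume : Measure (Rn n)) < ∞)
    (eps k : ℝ) (heps : 0 < eps) (hk1 : 1 < k) (hk2 : k ≤ 2)
    (psi0 psi1 : SchwartzMap (Rn n) ℂ)
    (hpsi0 : ∀ x : Rn n, ‖x‖ ≤ k * eps → 0 < ‖psi0 x‖)
    (hpsi1 : ∀ x : Rn n, eps ≤ ‖x‖ → ‖x‖ ≤ 2 * k * eps → 0 < ‖psi1 x‖)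
    (psis : ℕ → SchwartzMap (Rn n) ℂ)
    (hpsis0 : psis 0 = psi0) (hpsis1 : psis 1 = psi1)
    (hpsis : ∀ j : ℕ, 2 ≤ j → ∀ x : Rn n, psis j x = psi1 ((2 : ℝ) ^ (-(j : ℝ) + 1) • x))
    (a : ℝ)
    (ha : (n : ℝ) * (1 / (min (essInf p (volume : Measure (Rn n)))
        (essInf q (volume : Measure (Rn n)))).toReal + cpu p u pinvInf) + al < a) :
    ∃ c : ℝ, 0 < c ∧ ∀ f : TemperedDist n,
      morreySeqNorm p u q (fun j x => ENNReal.ofReal (w j x) *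
          peetreMax a j (distConv (SchwartzMap.fourierTransformCLM ℂ (psis j)) f) x) ≤
        ENNReal.ofReal c *
          morreySeqNorm p u q (fun j x => ENNReal.ofReal (w j x) *
            (‖distConv (SchwartzMap.fourierTransformCLM ℂ (psis j)) f x‖₊ : ℝ≥0∞)) := by
  rcases Nat.eq_zero_or_pos n with rfl | hn
  · refine ⟨1, one_pos, fun f => ?_⟩
    have ha0 : 0 < a := by
      rw [Nat.cast_zero, zero_mul, zero_add] at ha
      exact hal.trans_lt ha
    simp only [peetreMax_eq_enorm_of_subsingleton ha0, ENNReal.ofReal_one, one_mul]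
    exact le_rfl
  have hn' : (0 : ℝ) < n := Nat.cast_pos.2 hn
  obtain ⟨qinvInf, hq⟩ := hq
  have hple : ∀ x, p x ≤ ⨆ x, u x := fun x => (hpu x).trans (le_iSup u x)
  have hmin0 : min (essInf p volume) (essInf q volume) ≠ 0 := (lt_min hp.1.2.2 hq.1.2.2).ne'
  have hpae : ∀ᵐ x : Rn n, min (essInf p volume) (essInf q volume) ≤ p x ∧ p x ≤ ⨆ x, u x := by
    filter_upwards [ae_essInf_le (f := p)] with x hx using ⟨(min_le_left _ _).trans hx, hple x⟩
  have hqae : ∀ᵐ x : Rn n, min (essInf p volume) (essInf q volume) ≤ q x ∧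
      q x ≤ essSup q volume := by
    filter_upwards [ae_essInf_le (f := q), ENNReal.ae_le_essSup q] with x hx hx'
      using ⟨(min_le_right _ _).trans hx, hx'⟩
  have hpb := exponent_bounds hp.2.1 hmin0 husup.ne hpae
  have hqb := exponent_bounds hq.2.1 hmin0 hqp.ne hqae
  have hmint : min (essInf p volume) (essInf q volume) ≠ ∞ := by
    obtain ⟨x, hx, hx'⟩ := hpae.exists
    exact ne_top_of_le_ne_top husup.ne (hx.trans hx')
  set s := (min (essInf p volume) (essInf q volume)).toReal with hs
  have hs0 : 0 < s := ENNReal.toReal_pos hmin0 hmint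
  obtain ⟨r, hr, hrs, hm⟩ := exists_rpow_exponent (A := a - al) hn' hs0 (lt_sub_iff_add_lt.2 ha)
  have ha0 : 0 ≤ a := by
    have : 0 ≤ cpu p u pinvInf := le_max_left _ _
    refine (add_nonneg (mul_nonneg hn'.le (add_nonneg ?_ this)) hal).trans ha.le
    exact (one_div_pos.2 hs0).le
  have hpsis' : ∀ (i : ℕ) (x : Rn n), psis (i + 1) x = psi1 (((2 : ℝ) ^ i)⁻¹ • x) := by
    intro i x
    rcases Nat.eq_zero_or_pos i with rfl | hi
    · rw [zero_add, hpsis1, pow_zero, inv_one, one_smul]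
    · rw [hpsis (i + 1) (by omega), ← Real.rpow_natCast, ← Real.rpow_neg zero_le_two]
      congr 3
      push_cast
      ring
  obtain ⟨C0, hC0, hpt⟩ := weighted_peetreMax_rpow_le hw psi0 psi1 heps hk1 hpsi1 psis hpsis0
    hpsis' hr ha0 1
  obtain ⟨K, hK0, hK, hfin⟩ := exists_morreySeqNorm_le hn hp hq hpu (fun x => le_iSup u x) husup.ne
    hr hrs (fun x => (hpb x).2.2.1) (fun x => (hqb x).2.2) hm hC0
  refine ⟨K.toReal, ENNReal.toReal_pos hK0 hK, fun f => ?_⟩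
  rw [ENNReal.ofReal_toReal hK]
  exact hfin _ _ (fun j => (hw.1 j).ennreal_ofReal.mul (continuous_distConv _ f).measurable.enorm)
    fun j x => hpt f j x

end
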